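/- arXiv:2102.07948 — 2 statements merged into one kernel-verified Lean document; each statement's English description precedes it below -/
import Mathlib

section
/- For all integers a ≥ 6 and b ≥ 6, any two proper 5-colorings of the triangulated toroidal grid T[a×b] are Kempe 5-equivalent. -/
namespace KempePaper

variable {V : Type*}

/-- A proper `k`-coloring: adjacent vertices receive distinct colors. -/
def Proper (G : SimpleGraph V) {k : ℕ} (c : V → Fin k) : Prop :=
  ∀ ⦃u v : V⦄, G.Adj u v → c u ≠ c v

/-- The subgraph of `G` induced by the vertices colored `α` or `β` under `c`
(as a graph on all of `V`, with edges only between such vertices). -/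
def kempeGraph (G : SimpleGraph V) {k : ℕ} (c : V → Fin k) (α β : Fin k) :
    SimpleGraph V :=
  SimpleGraph.fromRel (fun u v =>
    G.Adj u v ∧ (c u = α ∨ c u = β) ∧ (c v = α ∨ c v = β))

/-- `c₂` is obtained from `c₁` by a single Kempe swap: the colors `α` and `β`
are interchanged on the connected component (of the subgraph induced by the
vertices colored `α` or `β`) containing some vertex `w`, and nothing else changes. -/
def KempeStep (G : SimpleGraph V) {k : ℕ} (c₁ c₂ : V → Fin k) : Prop :=
  ∃ (α β : Fin k) (w : V),
    (∀ v : V, (kempeGraph G c₁ α β).Reachable w v → c₂ v = Equiv.swap α β (c₁ v)) ∧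
    (∀ v : V, ¬ (kempeGraph G c₁ α β).Reachable w v → c₂ v = c₁ v)

/-- Two `k`-colorings are Kempe `k`-equivalent if one can be obtained from the
other by a finite sequence of Kempe swaps. -/
def KempeEquiv (G : SimpleGraph V) {k : ℕ} (c₁ c₂ : V → Fin k) : Prop :=
  Relation.ReflTransGen (KempeStep G) c₁ c₂

/-- The triangulated toroidal grid `T[a×b]`. -/
def triGrid (a b : ℕ) : SimpleGraph (ZMod a × ZMod b) :=
  SimpleGraph.fromRel (fun u v =>
    u - v ∈ ({(0,1), (0,-1), (1,0), (-1,0), (1,-1), (-1,1)} : Set (ZMod a × ZMod b)))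

/-- `G` is `d`-degenerate: every nonempty finite set `S` of vertices contains a
vertex with at most `d` neighbors inside `S`. -/
def Degenerate (G : SimpleGraph V) (d : ℕ) : Prop :=
  ∀ S : Set V, S.Finite → S.Nonempty → ∃ v ∈ S, (S ∩ G.neighborSet v).ncard ≤ d

/-- `S` is an independent set in `G`. -/
def Indep (G : SimpleGraph V) (S : Set V) : Prop :=
  ∀ u ∈ S, ∀ v ∈ S, ¬ G.Adj u v

/-- The relation identifying all the vertices of `S`. -/
def identifyRel (S : Set V) (u v : V) : Prop :=
  u = v ∨ (u ∈ S ∧ v ∈ S)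

/-- The identification `G/S`: the vertices of `S` are merged into a single vertex,
and two distinct resulting vertices are adjacent iff some representatives are
adjacent in `G`. -/
def Identify (G : SimpleGraph V) (S : Set V) :
    SimpleGraph (Quot (identifyRel S)) :=
  SimpleGraph.fromRel (fun x y =>
    ∃ u v : V, Quot.mk (identifyRel S) u = x ∧ Quot.mk (identifyRel S) v = y ∧ G.Adj u v)

/-- A good 4-template: an independent set of exactly 4 vertices whose
identification yields a 4-degenerate graph. -/
def GoodFourTemplate (G : SimpleGraph V) (S : Set V) : Prop :=
  Indep G S ∧ S.ncard = 4 ∧ Degenerate (Identify G S) 4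

/-- A coloring is monochromatic on `S`. -/
def Mono {k : ℕ} (c : V → Fin k) (S : Set V) : Prop :=
  ∀ u ∈ S, ∀ v ∈ S, c u = c v

/-- `φ` is nice: it is Kempe 5-equivalent to a proper 5-coloring of `T[a×b]`
containing a good 4-template. -/
def Nice (a b : ℕ) (c : ZMod a × ZMod b → Fin 5) : Prop :=
  ∃ c' : ZMod a × ZMod b → Fin 5,
    Proper (triGrid a b) c' ∧ KempeEquiv (triGrid a b) c c' ∧
    ∃ S : Set (ZMod a × ZMod b), GoodFourTemplate (triGrid a b) S ∧ Mono c' S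

/-- The relation identifying the vertices within each color of the template `T`. -/
def contractRel (T : Set (Set V)) (u v : V) : Prop :=
  u = v ∨ ∃ C ∈ T, u ∈ C ∧ v ∈ C

/-- The contraction `G_T`: the vertices within each color of `T` are identified,
and two distinct resulting vertices are adjacent iff some representatives are
adjacent in `G`. -/
def Contract (G : SimpleGraph V) (T : Set (Set V)) :
    SimpleGraph (Quot (contractRel T)) :=
  SimpleGraph.fromRel (fun x y =>
    ∃ u v : V, Quot.mk (contractRel T) u = x ∧ Quot.mk (contractRel T) v = y ∧ G.Adj u v)

/-- `T` is a template in `G`: a finite collection of pairwise disjoint nonempty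
independent sets of vertices. -/
def IsTemplate (G : SimpleGraph V) (T : Set (Set V)) : Prop :=
  T.Finite ∧ (∀ C ∈ T, C.Nonempty) ∧ T.Pairwise (fun C D => Disjoint C D) ∧
    ∀ C ∈ T, Indep G C

/-- A coloring contains the template `T` if each color of `T` is monochromatic. -/
def ContainsTemplate {k : ℕ} (c : V → Fin k) (T : Set (Set V)) : Prop :=
  ∀ C ∈ T, Mono c C

/-! ### Recoloring on two colors -/

/-- The colorings `c` and `c'` differ only on vertices where both use the colors `α`, `β`. -/
def PairStep {k : ℕ} (c c' : V → Fin k) : Prop :=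
  ∃ α β : Fin k, ∀ u, c u ≠ c' u → (c u = α ∨ c u = β) ∧ (c' u = α ∨ c' u = β)

theorem kempeGraph_adj {G : SimpleGraph V} {k : ℕ} {c : V → Fin k} {α β : Fin k} {u v : V} :
    (kempeGraph G c α β).Adj u v ↔
      G.Adj u v ∧ (c u = α ∨ c u = β) ∧ (c v = α ∨ c v = β) := by
  simp only [kempeGraph, SimpleGraph.fromRel_adj]
  constructor
  · rintro ⟨-, h | ⟨h, h₁, h₂⟩⟩
    · exact h
    · exact ⟨h.symm, h₂, h₁⟩
  · exact fun h => ⟨h.1.ne, .inl h⟩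

theorem KempeStep.proper {G : SimpleGraph V} {k : ℕ} {c c' : V → Fin k} (h : KempeStep G c c')
    (hc : Proper G c) : Proper G c' := by
  obtain ⟨α, β, w, h₁, h₂⟩ := h
  intro u v huv
  have key : ∀ u v, G.Adj u v → (kempeGraph G c α β).Reachable w u →
      ¬ (kempeGraph G c α β).Reachable w v → c' u ≠ c' v := by
    intro u v huv hu hv
    rw [h₁ u hu, h₂ v hv]
    have hne := hc huv
    have hn : ¬ ((c u = α ∨ c u = β) ∧ (c v = α ∨ c v = β)) := fun h =>
      hv (hu.trans (SimpleGraph.Adj.reachable (kempeGraph_adj.2 ⟨huv, h⟩)))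
    intro h
    rw [Equiv.swap_apply_def] at h
    grind
  by_cases hu : (kempeGraph G c α β).Reachable w u <;>
    by_cases hv : (kempeGraph G c α β).Reachable w v
  · rw [h₁ u hu, h₁ v hv]
    exact fun h => hc huv ((Equiv.swap α β).injective h)
  · exact key u v huv hu hv
  · exact (key v u huv.symm hv hu).symm
  · rw [h₂ u hu, h₂ v hv]
    exact hc huv

theorem KempeEquiv.proper {G : SimpleGraph V} {k : ℕ} {c c' : V → Fin k} (h : KempeEquiv G c c')
    (hc : Proper G c) : Proper G c' := by
  induction h with
  | refl => exact hc
  | tail _ h ih => exact h.proper ih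

theorem PairStep.kempeEquiv [Finite V] {G : SimpleGraph V} {k : ℕ} {c c' : V → Fin k}
    (h : PairStep c c') (hc : Proper G c) (hc' : Proper G c') : KempeEquiv G c c' := by
  obtain ⟨α, β, h⟩ := h
  induction hn : {u | c u ≠ c' u}.ncard using Nat.strong_induction_on generalizing c with
  | _ n ih =>
  by_cases hcc : c = c'
  · subst hcc
    exact .refl
  obtain ⟨w, hw⟩ := Function.ne_iff.1 hcc
  have hcomp : ∀ v, (kempeGraph G c α β).Reachable w v → c v ≠ c' v := by
    intro v hv
    rw [SimpleGraph.reachable_iff_reflTransGen] at hv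
    induction hv with
    | refl => exact hw
    | @tail x y _ hxy ih =>
      obtain ⟨hadj, hx, hy⟩ := kempeGraph_adj.1 hxy
      have := hc hadj
      have := hc' hadj
      have := h x ih
      grind
  classical
  let d : V → Fin k := fun v =>
    if (kempeGraph G c α β).Reachable w v then Equiv.swap α β (c v) else c v
  have hstep : KempeStep G c d :=
    ⟨α, β, w, fun v hv => if_pos hv, fun v hv => if_neg hv⟩
  have hd : ∀ v, (kempeGraph G c α β).Reachable w v → d v = c' v := by
    intro v hv
    have hv' := hcomp v hv
    have := h v hv'
    simp only [d, if_pos hv, Equiv.swap_apply_def]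
    grind
  have hd' : ∀ v, ¬ (kempeGraph G c α β).Reachable w v → d v = c v := fun v hv => if_neg hv
  refine .head hstep (ih _ ?_ (hstep.proper hc) ?_ rfl)
  · rw [← hn]
    refine Set.ncard_lt_ncard ⟨?_, ?_⟩ (Set.toFinite _)
    · intro v (hv : d v ≠ c' v)
      by_cases hr : (kempeGraph G c α β).Reachable w v
      · exact absurd (hd v hr) hv
      · rwa [hd' v hr] at hv
    · intro hsub
      exact hsub (show w ∈ {u | c u ≠ c' u} from hw) (hd w (SimpleGraph.Reachable.refl w))
  · intro u hu
    by_cases hr : (kempeGraph G c α β).Reachable w u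
    · exact absurd (hd u hr) hu
    · rw [hd' u hr] at hu ⊢
      exact h u hu

theorem PairStep.symm {k : ℕ} {c c' : V → Fin k} (h : PairStep c c') : PairStep c' c := by
  obtain ⟨α, β, h⟩ := h
  exact ⟨α, β, fun u hu => (h u hu.symm).symm⟩

theorem PairStep.comp_swap {k : ℕ} (c : V → Fin k) (α β : Fin k) :
    PairStep c (Equiv.swap α β ∘ c) := by
  refine ⟨α, β, fun u hu => ?_⟩
  simp only [Function.comp, Equiv.swap_apply_def] at hu ⊢
  grind

theorem KempeStep.pairStep {G : SimpleGraph V} {k : ℕ} {c c' : V → Fin k} (h : KempeStep G c c') :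
    PairStep c c' := by
  obtain ⟨α, β, w, h₁, h₂⟩ := h
  refine ⟨α, β, fun u hu => ?_⟩
  by_cases hr : (kempeGraph G c α β).Reachable w u
  · rw [h₁ u hr, Equiv.swap_apply_def] at hu ⊢
    grind
  · exact absurd (h₂ u hr).symm hu

theorem KempeEquiv.symm [Finite V] {G : SimpleGraph V} {k : ℕ} {c c' : V → Fin k}
    (h : KempeEquiv G c c') (hc : Proper G c) : KempeEquiv G c' c := by
  induction h with
  | refl => exact .refl
  | tail h₁ h₂ ih =>
    have hp := KempeEquiv.proper h₁ hc
    exact (h₂.pairStep.symm.kempeEquiv (h₂.proper hp) hp).trans ih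

/-! ### Five-colorings of 4-degenerate graphs -/

/-- `e` is a proper coloring of the subgraph of `H` induced by `U`. -/
def ProperOn (H : SimpleGraph V) (U : Set V) (e : V → Fin 5) : Prop :=
  ∀ u ∈ U, ∀ v ∈ U, H.Adj u v → e u ≠ e v

/-- A change of coloring on `U` involving two colors only. -/
def PairStepOn (H : SimpleGraph V) (U : Set V) (e f : V → Fin 5) : Prop :=
  ProperOn H U e ∧ ProperOn H U f ∧
    ∃ α β : Fin 5, ∀ u ∈ U, e u ≠ f u → (e u = α ∨ e u = β) ∧ (f u = α ∨ f u = β)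

/-- `U` has a proper 5-coloring, and two-color changes connect any two of them. -/
def RecolorableOn (H : SimpleGraph V) (U : Set V) : Prop :=
  (∃ e, ProperOn H U e) ∧ ∀ e f, ProperOn H U e → ProperOn H U f →
    Relation.ReflTransGen (PairStepOn H U) e f

theorem properOn_insert {H : SimpleGraph V} {U : Set V} {x : V} {e : V → Fin 5}
    (he : ProperOn H U e) (hx : ∀ u ∈ U, H.Adj x u → e u ≠ e x) :
    ProperOn H (insert x U) e := by
  rintro u (rfl | hu) v (rfl | hv) huv
  · exact absurd huv (H.loopless.irrefl _)
  · exact (hx v hv huv).symm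
  · exact hx u hu huv.symm
  · exact he u hu v hv huv

theorem exists_color_notMem (s : Finset (Fin 5)) (hs : s.card ≤ 4) : ∃ δ, δ ∉ s := by
  by_contra! h
  have : s = Finset.univ := Finset.eq_univ_iff_forall.2 h
  simp [this] at hs

theorem PairStepOn.lift {H : SimpleGraph V} {U : Set V} {x : V} (hxU : x ∉ U) {N : Finset V}
    (hN : N.card ≤ 4) (hxN : ∀ u ∈ U, H.Adj x u → u ∈ N) {e f : V → Fin 5}
    (he : ProperOn H (insert x U) e) (h : PairStepOn H U e f) :
    ∃ f', (∀ u ∈ U, f' u = f u) ∧ ProperOn H (insert x U) f' ∧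
      Relation.ReflTransGen (PairStepOn H (insert x U)) e f' := by
  classical
  obtain ⟨heU, hfU, α, β, hαβ⟩ := h
  have hupd : ∀ (g : V → Fin 5) (δ : Fin 5), ∀ u ∈ U, Function.update g x δ u = g u := by
    intro g δ u hu
    exact Function.update_of_ne (by rintro rfl; exact hxU hu) _ _
  have hprop : ∀ (g : V → Fin 5) (δ : Fin 5), ProperOn H U g →
      (∀ u ∈ U, H.Adj x u → g u ≠ δ) → ProperOn H (insert x U) (Function.update g x δ) := by
    intro g δ hg hδ
    refine properOn_insert (fun u hu v hv huv => ?_) (fun u hu hxu => ?_)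
    · rw [hupd g δ u hu, hupd g δ v hv]
      exact hg u hu v hv huv
    · rw [hupd g δ u hu, Function.update_self]
      exact hδ u hu hxu
  have hex : ∀ u ∈ U, H.Adj x u → e u ≠ e x := fun u hu hxu =>
    (he x (.inl rfl) u (.inr hu) hxu).symm
  by_cases h₁ : ∀ u ∈ U, H.Adj x u → f u ≠ e x
  · have hp := hprop f _ hfU h₁
    refine ⟨_, hupd f (e x), hp, .single ⟨he, hp, α, β, ?_⟩⟩
    rintro u (rfl | hu)
    · simp
    · rw [hupd _ _ u hu]
      exact hαβ u hu
  push Not at h₁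
  obtain ⟨y, hyU, hxy, hy⟩ := h₁
  have hyx := hex y hyU hxy
  have hyαβ := hαβ y hyU (by rw [hy]; exact hyx)
  by_cases h₂ : ∀ u ∈ U, H.Adj x u → f u ≠ e y
  · have hp := hprop f _ hfU h₂
    refine ⟨_, hupd f (e y), hp, .single ⟨he, hp, α, β, ?_⟩⟩
    rintro u (rfl | hu)
    · simp only [Function.update_self]
      rw [hy] at hyαβ
      exact fun _ => hyαβ.symm
    · rw [hupd _ _ u hu]
      exact hαβ u hu
  push Not at h₂
  obtain ⟨z, hzU, hxz, hz⟩ := h₂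
  have hyz : y ≠ z := by
    rintro rfl
    exact hyx (hz.symm.trans hy)
  have hcard : ({e x, e y} ∪ ((N.erase y).erase z).image e : Finset (Fin 5)).card ≤ 4 := by
    refine (Finset.card_union_le _ _).trans ?_
    have h1 := Finset.card_le_two (a := e x) (b := e y)
    have h2 : (((N.erase y).erase z).image e).card ≤ ((N.erase y).erase z).card :=
      Finset.card_image_le
    rw [Finset.card_erase_of_mem (Finset.mem_erase.2 ⟨hyz.symm, hxN z hzU hxz⟩),
      Finset.card_erase_of_mem (hxN y hyU hxy)] at h2
    omega
  obtain ⟨δ, hδ⟩ := exists_color_notMem _ hcard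
  simp only [Finset.mem_union, Finset.mem_insert, Finset.mem_singleton, Finset.mem_image,
    Finset.mem_erase, not_or, not_exists, not_and] at hδ
  have hz' : e z = e x ∨ e z = e y := by
    have := hαβ z hzU
    grind
  have heδ : ∀ u ∈ U, H.Adj x u → e u ≠ δ := by
    intro u hu hxu
    have := hδ.2 u
    have := hxN u hu hxu
    grind
  have hfδ : ∀ u ∈ U, H.Adj x u → f u ≠ δ := by
    intro u hu hxu
    have := heδ u hu hxu
    have := hαβ u hu
    grind
  have hpe := hprop e _ heU heδ
  have hpf := hprop f _ hfU hfδ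
  refine ⟨_, hupd f δ, hpf, .tail (.single ⟨he, hpe, e x, δ, ?_⟩) ⟨hpe, hpf, α, β, ?_⟩⟩
  · rintro u (rfl | hu)
    · simp
    · simp [hupd e δ u hu]
  · rintro u (rfl | hu)
    · simp
    · rw [hupd _ _ u hu, hupd _ _ u hu]
      exact hαβ u hu

theorem RecolorableOn.insert {H : SimpleGraph V} {U : Set V} (h : RecolorableOn H U) {x : V}
    (hxU : x ∉ U) {N : Finset V} (hN : N.card ≤ 4) (hxN : ∀ u ∈ U, H.Adj x u → u ∈ N) :
    RecolorableOn H (insert x U) := by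
  classical
  have hsub : ∀ {e}, ProperOn H (Insert.insert x U) e → ProperOn H U e :=
    fun he u hu v hv => he u (.inr hu) v (.inr hv)
  obtain ⟨⟨e, he⟩, hconn⟩ := h
  refine ⟨?_, fun e f he hf => ?_⟩
  · obtain ⟨δ, hδ⟩ := exists_color_notMem (N.image e) (Finset.card_image_le.trans hN)
    have hupd : ∀ u ∈ U, Function.update e x δ u = e u := fun u hu =>
      Function.update_of_ne (by rintro rfl; exact hxU hu) _ _
    refine ⟨Function.update e x δ, properOn_insert (fun u hu v hv huv => ?_) fun u hu hxu => ?_⟩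
    · rw [hupd u hu, hupd v hv]
      exact he u hu v hv huv
    · rw [hupd u hu, Function.update_self]
      rintro rfl
      exact hδ (Finset.mem_image_of_mem e (hxN u hu hxu))
  · have key : ∀ g, Relation.ReflTransGen (PairStepOn H U) e g →
        ∃ g', (∀ u ∈ U, g' u = g u) ∧ ProperOn H (Insert.insert x U) g' ∧
          Relation.ReflTransGen (PairStepOn H (Insert.insert x U)) e g' := by
      intro g hg
      induction hg with
      | refl => exact ⟨e, fun _ _ => rfl, he, .refl⟩
      | @tail g₁ g₂ _ h₂ ih =>
        obtain ⟨g', hg', hp, hc⟩ := ih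
        obtain ⟨-, hpf, α, β, hαβ⟩ := h₂
        have h₂' : PairStepOn H U g' g₂ :=
          ⟨hsub hp, hpf, α, β, fun u hu => by rw [hg' u hu]; exact hαβ u hu⟩
        obtain ⟨g'', ha, hb, hc'⟩ := h₂'.lift hxU hN hxN hp
        exact ⟨g'', ha, hb, hc.trans hc'⟩
    obtain ⟨g, hg, hp, hc⟩ := key f (hconn e f (hsub he) (hsub hf))
    refine hc.tail ⟨hp, hf, g x, f x, ?_⟩
    rintro u (rfl | hu)
    · simp
    · simp [hg u hu]

/-- The vertices of `R` can be deleted one by one, each having at most four neighbors among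
the vertices not deleted before it. -/
inductive Peels (H : SimpleGraph V) : Set V → Prop
  | empty : Peels H ∅
  | insert {R : Set V} (x : V) (N : Finset V) : Peels H R → N.card ≤ 4 →
      (∀ y, H.Adj x y → y ∉ R → y ∈ N) → Peels H (insert x R)

theorem Peels.recolorableOn_univ {H : SimpleGraph V} {R : Set V} (h : Peels H R) :
    RecolorableOn H Rᶜ → RecolorableOn H Set.univ := by
  induction h with
  | empty => simp
  | @insert R x N _ hN hx ih =>
    intro h
    apply ih
    by_cases hxR : x ∈ R
    · rwa [Set.insert_eq_of_mem hxR] at h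
    · have : Rᶜ = Insert.insert x (Insert.insert x R)ᶜ := by
        ext y
        by_cases hy : y = x <;> simp [hy, hxR]
      rw [this]
      refine h.insert (by simp) hN fun u hu hxu => hx u hxu fun hR => hu (.inr hR)

theorem Peels.recolorable {H : SimpleGraph V} (h : Peels H Set.univ) :
    RecolorableOn H Set.univ := by
  refine h.recolorableOn_univ ⟨⟨fun _ => 0, ?_⟩, fun e f he hf => .single ⟨he, hf, 0, 0, ?_⟩⟩ <;>
    simp [ProperOn]

/-- A largest set that can be peeled off. -/
theorem exists_peels_closed [Finite V] (H : SimpleGraph V) :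
    ∃ R, Peels H R ∧ ∀ (x : V) (N : Finset V), N.card ≤ 4 →
      (∀ y, H.Adj x y → y ∉ R → y ∈ N) → x ∈ R := by
  obtain ⟨R, hR⟩ := Set.Finite.exists_maximal (s := {R | Peels H R}) (Set.toFinite _)
    ⟨∅, Peels.empty⟩
  refine ⟨R, hR.1, fun x N hN hx => ?_⟩
  exact hR.2 (Peels.insert x N hR.1 hN hx) (Set.subset_insert x R) (Set.mem_insert x R)

/-! ### Charts of a triangulated torus -/

/-- The six directions of the triangular lattice. -/
def dirs : List (ℤ × ℤ) := [(0, 1), (1, 0), (1, -1), (0, -1), (-1, 0), (-1, 1)]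

/-- The vectors of length at most 5 in the triangular lattice. -/
def Short (v : ℤ × ℤ) : Prop :=
  (-5 ≤ v.1 ∧ v.1 ≤ 5) ∧ (-5 ≤ v.2 ∧ v.2 ≤ 5) ∧ (-5 ≤ v.1 + v.2 ∧ v.1 + v.2 ≤ 5)

instance : DecidablePred Short := fun _ => inferInstanceAs (Decidable (_ ∧ _))

/-- A covering of `G` by the triangular lattice that is injective on small pieces. -/
structure IsChart (G : SimpleGraph V) (P : ℤ × ℤ → V) : Prop where
  surj : Function.Surjective P
  adj : ∀ p w, G.Adj (P p) w ↔ ∃ d ∈ dirs, w = P (p + d)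
  inj : ∀ p q, Short (p - q) → P p = P q → p = q

/-- A translation of the lattice. -/
def shift (p : ℤ × ℤ) : ℤ × ℤ := (p.1 + 1, p.2)

/-- The rotation of the lattice by 60 degrees. -/
def rot (p : ℤ × ℤ) : ℤ × ℤ := (-p.2, p.1 + p.2)

/-- A reflection of the lattice. -/
def flip (p : ℤ × ℤ) : ℤ × ℤ := (p.2, p.1)

theorem IsChart.comp {G : SimpleGraph V} {P τ σ : ℤ × ℤ → _} (h : IsChart G P)
    (hτ : Function.Bijective τ) (hσ : ∀ p d, τ (p + d) = τ p + σ d)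
    (hd : ∀ d ∈ dirs, σ d ∈ dirs) (hd' : ∀ d ∈ dirs, ∃ d' ∈ dirs, σ d' = d)
    (hs : ∀ p q, Short (p - q) → Short (τ p - τ q)) : IsChart G (P ∘ τ) where
  surj := h.surj.comp hτ.2
  adj p w := by
    simp only [Function.comp, h.adj, hσ]
    constructor
    · rintro ⟨d, hd₁, rfl⟩
      obtain ⟨d', hd₂, rfl⟩ := hd' d hd₁
      exact ⟨d', hd₂, rfl⟩
    · rintro ⟨d, hd₁, rfl⟩
      exact ⟨_, hd d hd₁, rfl⟩
  inj p q hpq hP := hτ.1 (h.inj _ _ (hs p q hpq) hP)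

theorem IsChart.comp_shift {G : SimpleGraph V} {P : ℤ × ℤ → V} (h : IsChart G P) :
    IsChart G (P ∘ shift) := by
  refine h.comp (σ := id) (Function.bijective_iff_has_inverse.2
    ⟨fun p => (p.1 - 1, p.2), fun p => ?_, fun p => ?_⟩) ?_ (by decide) (by decide) ?_
  · ext <;> simp [shift]
  · ext <;> simp [shift]
  · intro p d
    ext <;> simp [shift]
    ring
  · intro p q
    simp [shift, Short]

theorem IsChart.comp_rot {G : SimpleGraph V} {P : ℤ × ℤ → V} (h : IsChart G P) :
    IsChart G (P ∘ rot) := by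
  refine h.comp (σ := rot) (Function.bijective_iff_has_inverse.2
    ⟨fun p => (p.1 + p.2, -p.1), fun p => ?_, fun p => ?_⟩) ?_ (by decide) (by decide) ?_
  · ext <;> simp [rot]
  · ext <;> simp [rot]
  · intro p d
    ext <;> simp [rot] <;> ring
  · intro p q
    simp only [rot, Short, Prod.fst_sub, Prod.snd_sub]
    omega

theorem IsChart.comp_flip {G : SimpleGraph V} {P : ℤ × ℤ → V} (h : IsChart G P) :
    IsChart G (P ∘ flip) := by
  refine h.comp (σ := flip) (Function.bijective_iff_has_inverse.2
    ⟨flip, fun p => rfl, fun p => rfl⟩) (fun p d => rfl) (by decide) (by decide) ?_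
  intro p q
  simp only [flip, Short, Prod.fst_sub, Prod.snd_sub]
  omega

/-! ### Contracting a template -/

/-- The coloring `c`, read in the chart `P`, is constant on each class of `T`. -/
def Contains (P : ℤ × ℤ → V) (T : List (List (ℤ × ℤ))) (c : V → Fin 5) : Prop :=
  ∀ C ∈ T, ∀ p ∈ C, ∀ q ∈ C, c (P p) = c (P q)

/-- The representative of `p` when each class of `T` is contracted to its first point. -/
def lrep (T : List (List (ℤ × ℤ))) (p : ℤ × ℤ) : ℤ × ℤ :=
  match T.find? (fun C => decide (p ∈ C)) with
  | some C => C.headD p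
  | none => p

/-- The points contracted to `p`. -/
def fiber (T : List (List (ℤ × ℤ))) (p : ℤ × ℤ) : List (ℤ × ℤ) :=
  if p ∈ T.flatten then T.flatten.filter (fun q => lrep T q = p) else [p]

/-- The classes of `T` can be contracted in every chart. -/
def Contractible (T : List (List (ℤ × ℤ))) : Prop :=
  (∀ p ∈ T.flatten, ∀ q ∈ T.flatten, Short (p - q)) ∧
  (∀ C ∈ T, ∀ p ∈ C, lrep T p ∈ C ∧ ∀ q ∈ C, lrep T p = lrep T q) ∧
  ∀ p ∈ T.flatten, ∀ q ∈ T.flatten, lrep T p = lrep T q → ∀ d ∈ dirs,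
    q ≠ p + d ∧ Short (q - (p + d))

instance : DecidablePred Contractible := fun _ => inferInstanceAs (Decidable (_ ∧ _))

/-- The points of the list can be deleted in this order from the contracted graph, after `R`,
until all of `T` and one edge are deleted. -/
def PeelOrder (T : List (List (ℤ × ℤ))) : List (ℤ × ℤ) → List (ℤ × ℤ) → Prop
  | R, [] => (∀ p ∈ T.flatten, lrep T p ∈ R) ∧ ∃ p ∈ T.flatten, lrep T (p + (1, 0)) ∈ R
  | R, p :: l => lrep T p = p ∧ (p ∈ T.flatten ∨ ∀ o ∈ T.flatten, Short (p - o)) ∧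
      ((((fiber T p).flatMap fun q => dirs.map fun d => lrep T (q + d)).filter
        (fun q => q ∉ R)).dedup).length ≤ 4 ∧ PeelOrder T (p :: R) l

instance decidablePeelOrder (T : List (List (ℤ × ℤ))) :
    ∀ R l, Decidable (PeelOrder T R l)
  | _, [] => inferInstanceAs (Decidable (_ ∧ _))
  | R, p :: l =>
    haveI := decidablePeelOrder T (p :: R) l
    inferInstanceAs (Decidable (_ ∧ _))

/-- Some order of deletions witnesses that contracting `T` leaves a 4-degenerate graph. -/
def Good (T : List (List (ℤ × ℤ))) : Prop :=
  Contractible T ∧ ∃ l, PeelOrder T [] l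

section Contraction

variable {G : SimpleGraph V} {P : ℤ × ℤ → V} {T : List (List (ℤ × ℤ))}

open Classical in
/-- The map contracting the classes of `T`. -/
noncomputable def rep (P : ℤ × ℤ → V) (T : List (List (ℤ × ℤ))) (v : V) : V :=
  if h : ∃ p ∈ T.flatten, P p = v then P (lrep T h.choose) else v

/-- The contracted graph, with the other vertices of each class kept as isolated vertices. -/
def contracted (G : SimpleGraph V) (P : ℤ × ℤ → V) (T : List (List (ℤ × ℤ))) :
    SimpleGraph V where
  Adj x y := x ≠ y ∧ ∃ u v, G.Adj u v ∧ rep P T u = x ∧ rep P T v = y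
  symm := ⟨fun _ _ ⟨h, u, v, huv, hu, hv⟩ => ⟨h.symm, v, u, huv.symm, hv, hu⟩⟩
  loopless := ⟨fun _ h => h.1 rfl⟩

theorem lrep_of_notMem {p : ℤ × ℤ} (hp : p ∉ T.flatten) : lrep T p = p := by
  have : T.find? (fun C => decide (p ∈ C)) = none := by
    simpa [List.find?_eq_none] using fun C hC hpC => hp (List.mem_flatten.2 ⟨C, hC, hpC⟩)
  simp [lrep, this]

theorem Contractible.lrep_mem (hT : Contractible T) {p : ℤ × ℤ} (hp : p ∈ T.flatten) :
    lrep T p ∈ T.flatten := by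
  obtain ⟨C, hC, hpC⟩ := List.mem_flatten.1 hp
  exact List.mem_flatten.2 ⟨C, hC, (hT.2.1 C hC p hpC).1⟩

theorem Contractible.lrep_lrep (hT : Contractible T) (p : ℤ × ℤ) :
    lrep T (lrep T p) = lrep T p := by
  by_cases hp : p ∈ T.flatten
  · obtain ⟨C, hC, hpC⟩ := List.mem_flatten.1 hp
    have h := hT.2.1 C hC p hpC
    exact (h.2 _ h.1).symm
  · rw [lrep_of_notMem hp, lrep_of_notMem hp]

theorem rep_of_mem (hP : IsChart G P) (hT : Contractible T) {p : ℤ × ℤ} (hp : p ∈ T.flatten) :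
    rep P T (P p) = P (lrep T p) := by
  have h : ∃ q ∈ T.flatten, P q = P p := ⟨p, hp, rfl⟩
  rw [rep, dif_pos h]
  rw [hP.inj _ _ (hT.1 _ h.choose_spec.1 _ hp) h.choose_spec.2]

theorem rep_of_notMem {v : V} (hv : ∀ p ∈ T.flatten, P p ≠ v) : rep P T v = v :=
  dif_neg (by simpa using hv)

theorem rep_rep (hP : IsChart G P) (hT : Contractible T) (v : V) :
    rep P T (rep P T v) = rep P T v := by
  by_cases h : ∃ p ∈ T.flatten, P p = v
  · obtain ⟨p, hp, rfl⟩ := h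
    rw [rep_of_mem hP hT hp, rep_of_mem hP hT (hT.lrep_mem hp), hT.lrep_lrep]
  · have h' : rep P T v = v := rep_of_notMem (by simpa using h)
    rw [h', h']

theorem rep_lrep (hP : IsChart G P) (hT : Contractible T) (p : ℤ × ℤ) :
    rep P T (P (lrep T p)) = rep P T (P p) := by
  by_cases hp : p ∈ T.flatten
  · rw [rep_of_mem hP hT hp, rep_of_mem hP hT (hT.lrep_mem hp), hT.lrep_lrep]
  · rw [lrep_of_notMem hp]

theorem rep_eq_of_notMem (hP : IsChart G P) (hT : Contractible T) {u v : V}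
    (hv : ∀ p ∈ T.flatten, P p ≠ v) (h : rep P T u = v) : u = v := by
  by_cases hu : ∃ p ∈ T.flatten, P p = u
  · obtain ⟨p, hp, rfl⟩ := hu
    rw [rep_of_mem hP hT hp] at h
    exact absurd h (hv _ (hT.lrep_mem hp))
  · rwa [rep_of_notMem (by simpa using hu)] at h

theorem rep_ne_of_adj (hP : IsChart G P) (hT : Contractible T) {u v : V} (h : G.Adj u v) :
    rep P T u ≠ rep P T v := by
  intro he
  by_cases hv : ∃ p ∈ T.flatten, P p = v
  · by_cases hu : ∃ p ∈ T.flatten, P p = u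
    · obtain ⟨p, hp, rfl⟩ := hu
      obtain ⟨q, hq, rfl⟩ := hv
      rw [rep_of_mem hP hT hp, rep_of_mem hP hT hq] at he
      have he' := hP.inj _ _ (hT.1 _ (hT.lrep_mem hp) _ (hT.lrep_mem hq)) he
      obtain ⟨d, hd, hqd⟩ := (hP.adj _ _).1 h
      have := hT.2.2 p hp q hq he' d hd
      exact this.1 (hP.inj _ _ this.2 hqd)
    · rw [rep_of_notMem (v := u) (by simpa using hu)] at he
      exact h.ne (rep_eq_of_notMem hP hT (by simpa using hu) he.symm).symm
  · rw [rep_of_notMem (v := v) (by simpa using hv)] at he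
    exact h.ne (rep_eq_of_notMem hP hT (by simpa using hv) he)

theorem Contains.comp_rep (hP : IsChart G P) (hT : Contractible T) {c : V → Fin 5}
    (hc : Contains P T c) (v : V) : c (rep P T v) = c v := by
  by_cases h : ∃ p ∈ T.flatten, P p = v
  · obtain ⟨p, hp, rfl⟩ := h
    rw [rep_of_mem hP hT hp]
    obtain ⟨C, hC, hpC⟩ := List.mem_flatten.1 hp
    exact hc C hC _ (hT.2.1 C hC p hpC).1 _ hpC
  · rw [rep_of_notMem (by simpa using h)]

theorem ProperOn.comp_rep (hP : IsChart G P) (hT : Contractible T) {e : V → Fin 5}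
    (he : ProperOn (contracted G P T) Set.univ e) : Proper G (e ∘ rep P T) :=
  fun u v huv => he _ trivial _ trivial ⟨rep_ne_of_adj hP hT huv, u, v, huv, rfl, rfl⟩

theorem contains_comp_rep (hP : IsChart G P) (hT : Contractible T) (e : V → Fin 5) :
    Contains P T (e ∘ rep P T) := by
  intro C hC p hp q hq
  simp only [Function.comp]
  rw [rep_of_mem hP hT (List.mem_flatten.2 ⟨C, hC, hp⟩),
    rep_of_mem hP hT (List.mem_flatten.2 ⟨C, hC, hq⟩), (hT.2.1 C hC p hp).2 q hq]

theorem contracted_adj_iff_of_notMem (hP : IsChart G P) (hT : Contractible T) {p : ℤ × ℤ}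
    (hp : ∀ q ∈ T.flatten, P q ≠ P p) {y : V} (h : (contracted G P T).Adj (P p) y) :
    ∃ d ∈ dirs, y = rep P T (P (p + d)) := by
  obtain ⟨-, u, v, huv, hu, rfl⟩ := h
  obtain rfl := rep_eq_of_notMem hP hT hp hu
  obtain ⟨d, hd, rfl⟩ := (hP.adj _ _).1 huv
  exact ⟨d, hd, rfl⟩

theorem PeelOrder.mem (hP : IsChart G P) (hT : Contractible T) {R : Set V}
    (hR : ∀ (x : V) (N : Finset V), N.card ≤ 4 →
      (∀ y, (contracted G P T).Adj x y → y ∉ R → y ∈ N) → x ∈ R) {l L : List (ℤ × ℤ)}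
    (h : PeelOrder T L l) (hL : ∀ p ∈ L, rep P T (P p) ∈ R) :
    (∀ p ∈ T.flatten, rep P T (P p) ∈ R) ∧
      ∃ p ∈ T.flatten, rep P T (P (p + (1, 0))) ∈ R := by
  classical
  induction l generalizing L with
  | nil =>
    refine ⟨fun p hp => ?_, ?_⟩
    · rw [← rep_lrep hP hT]
      exact hL _ (h.1 p hp)
    · obtain ⟨p, hp, h⟩ := h.2
      refine ⟨p, hp, ?_⟩
      rw [← rep_lrep hP hT]
      exact hL _ h
  | cons p l ih =>
    obtain ⟨hlp, hp, hcard, h⟩ := h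
    refine ih h fun q hq => ?_
    obtain rfl | hq := List.mem_cons.1 hq
    swap
    · exact hL q hq
    have hreg : q ∉ T.flatten → ∀ o ∈ T.flatten, P o ≠ P q := by
      intro hqT o ho hoq
      obtain rfl := hP.inj _ _ (hp.resolve_left hqT o ho) hoq.symm
      exact hqT ho
    have hrep : rep P T (P q) = P q := by
      by_cases hqT : q ∈ T.flatten
      · rw [rep_of_mem hP hT hqT, hlp]
      · exact rep_of_notMem (hreg hqT)
    rw [hrep]
    refine hR _ (((((fiber T q).flatMap fun q => dirs.map fun d => lrep T (q + d)).filter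
        (fun q => q ∉ L)).dedup).map fun r => rep P T (P r)).toFinset
      ((List.toFinset_card_le _).trans (by rwa [List.length_map])) ?_
    intro y hy hyR
    suffices ∃ r ∈ fiber T q, ∃ d ∈ dirs, y = rep P T (P (r + d)) by
      obtain ⟨r, hr, d, hd, rfl⟩ := this
      simp only [List.mem_toFinset, List.mem_map, List.mem_dedup, List.mem_filter,
        List.mem_flatMap]
      refine ⟨lrep T (r + d), ⟨⟨r, hr, d, hd, rfl⟩, ?_⟩, rep_lrep hP hT _⟩
      rw [← rep_lrep hP hT] at hyR
      simpa using fun hmem => hyR (hL _ hmem)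
    by_cases hqT : q ∈ T.flatten
    · obtain ⟨-, u, v, huv, hu, rfl⟩ := hy
      have hu' : ∃ o ∈ T.flatten, P o = u := by
        by_contra hcon
        have hcon' : ∀ o ∈ T.flatten, P o ≠ u := by simpa using hcon
        rw [rep_of_notMem hcon'] at hu
        exact hcon' q hqT hu.symm
      obtain ⟨o, ho, rfl⟩ := hu'
      rw [rep_of_mem hP hT ho] at hu
      have hoq := hP.inj _ _ (hT.1 _ (hT.lrep_mem ho) _ hqT) hu
      obtain ⟨d, hd, rfl⟩ := (hP.adj _ _).1 huv
      refine ⟨o, ?_, d, hd, rfl⟩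
      rw [fiber, if_pos hqT]
      simpa [hoq] using ho
    · obtain ⟨d, hd, h⟩ := contracted_adj_iff_of_notMem hP hT (hreg hqT) hy
      exact ⟨q, by simp [fiber, hqT], d, hd, h⟩

theorem forall_of_two_neighbors {L : Set (ℤ × ℤ)}
    (hL : ∀ p, ∀ d₁ ∈ dirs, ∀ d₂ ∈ dirs, d₁ ≠ d₂ → p + d₁ ∈ L → p + d₂ ∈ L → p ∈ L)
    {p : ℤ × ℤ} (h₁ : p ∈ L) (h₂ : p + (1, 0) ∈ L) (q : ℤ × ℤ) : q ∈ L := by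
  have up : ∀ x y : ℤ, (x, y) ∈ L → (x + 1, y) ∈ L → (x, y + 1) ∈ L := fun x y h h' =>
    hL _ (0, -1) (by decide) (1, -1) (by decide) (by decide) (by simpa using h) (by simpa using h')
  have up' : ∀ x y : ℤ, (x, y) ∈ L → (x + 1, y) ∈ L → (x + 1, y + 1) ∈ L := fun x y h h' =>
    hL _ (0, -1) (by decide) (-1, 0) (by decide) (by decide) (by simpa using h')
      (by simpa using up x y h h')
  have right : ∀ x y : ℤ, (x, y) ∈ L → (x + 1, y) ∈ L → (x + 1 + 1, y) ∈ L := fun x y h h' =>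
    hL _ (-1, 0) (by decide) (-1, 1) (by decide) (by decide) (by simpa using h')
      (by simpa using up' x y h h')
  have down' : ∀ x y : ℤ, (x, y) ∈ L → (x + 1, y) ∈ L → (x + 1, y - 1) ∈ L := fun x y h h' =>
    hL _ (0, 1) (by decide) (-1, 1) (by decide) (by decide) (by simpa using h')
      (by simpa using h)
  have down : ∀ x y : ℤ, (x, y) ∈ L → (x + 1, y) ∈ L → (x, y - 1) ∈ L := fun x y h h' =>
    hL _ (0, 1) (by decide) (1, 0) (by decide) (by decide) (by simpa using h)
      (by simpa using down' x y h h')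
  have left : ∀ x y : ℤ, (x, y) ∈ L → (x + 1, y) ∈ L → (x - 1, y) ∈ L := fun x y h h' =>
    hL _ (1, 0) (by decide) (1, -1) (by decide) (by decide) (by simpa using h)
      (by simpa [← sub_eq_add_neg] using down x y h h')
  let E : ℤ → ℤ → Prop := fun x y => (x, y) ∈ L ∧ (x + 1, y) ∈ L
  have E₀ : E p.1 p.2 := ⟨h₁, by simpa [Prod.add_def] using h₂⟩
  have Ex : ∀ x, E x p.2 := by
    intro x
    induction x using Int.inductionOn' (b := p.1) with
    | zero => exact E₀
    | succ k _ ih => exact ⟨ih.2, right _ _ ih.1 ih.2⟩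
    | pred k _ ih => exact ⟨left _ _ ih.1 ih.2, by simpa using ih.1⟩
  have Exy : ∀ x y, E x y := by
    intro x y
    induction y using Int.inductionOn' (b := p.2) with
    | zero => exact Ex x
    | succ k _ ih => exact ⟨up _ _ ih.1 ih.2, up' _ _ ih.1 ih.2⟩
    | pred k _ ih => exact ⟨down _ _ ih.1 ih.2, down' _ _ ih.1 ih.2⟩
  exact (Exy q.1 q.2).1

theorem Good.peels [Finite V] (hP : IsChart G P) (hT : Good T) :
    Peels (contracted G P T) Set.univ := by
  classical
  obtain ⟨hT, l, hl⟩ := hT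
  obtain ⟨R, hpeel, hR⟩ := exists_peels_closed (contracted G P T)
  obtain ⟨hmem, p, hp, hpe⟩ := hl.mem hP hT hR (by simp)
  have hall : ∀ q, rep P T (P q) ∈ R := by
    refine forall_of_two_neighbors (L := {q | rep P T (P q) ∈ R}) ?_ (hmem p hp) hpe
    intro q d₁ h₁ d₂ h₂ hne hq₁ hq₂
    by_cases hq : ∃ o ∈ T.flatten, P o = P q
    · obtain ⟨o, ho, hoq⟩ := hq
      show rep P T (P q) ∈ R
      rw [← hoq]
      exact hmem o ho
    · have hq' : ∀ o ∈ T.flatten, P o ≠ P q := by simpa using hq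
      show rep P T (P q) ∈ R
      rw [rep_of_notMem hq']
      refine hR _ (((dirs.toFinset.erase d₁).erase d₂).image fun d => rep P T (P (q + d))) ?_ ?_
      · refine Finset.card_image_le.trans ?_
        rw [Finset.card_erase_of_mem (by simp [hne.symm, h₂]),
          Finset.card_erase_of_mem (by simp [h₁])]
        decide
      · intro y hy hyR
        obtain ⟨d, hd, rfl⟩ := contracted_adj_iff_of_notMem hP hT hq' hy
        refine Finset.mem_image_of_mem (fun d => rep P T (P (q + d))) ?_
        simp only [Finset.mem_erase, List.mem_toFinset]
        exact ⟨by rintro rfl; exact hyR hq₂, by rintro rfl; exact hyR hq₁, hd⟩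
  convert hpeel
  symm
  refine Set.eq_univ_of_forall fun v => ?_
  by_cases hv : rep P T v = v
  · obtain ⟨q, rfl⟩ := hP.surj v
    rw [← hv]
    exact hall q
  · refine hR v ∅ (by simp) fun y hy => ?_
    obtain ⟨-, u, -, -, rfl, -⟩ := hy
    exact absurd (rep_rep hP hT u) hv

theorem Good.exists_contains [Finite V] (hP : IsChart G P) (hT : Good T) :
    ∃ c, Proper G c ∧ Contains P T c := by
  obtain ⟨e, he⟩ := (hT.peels hP).recolorable.1
  exact ⟨_, he.comp_rep hP hT.1, contains_comp_rep hP hT.1 e⟩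

theorem Good.kempeEquiv [Finite V] (hP : IsChart G P) (hT : Good T) {c c' : V → Fin 5}
    (hc : Proper G c) (hc' : Proper G c') (hcT : Contains P T c) (hcT' : Contains P T c') :
    KempeEquiv G c c' := by
  have key : ∀ {c}, Proper G c → Contains P T c → ProperOn (contracted G P T) Set.univ c := by
    rintro c hc hcT - - - - ⟨-, u, v, huv, rfl, rfl⟩
    rw [hcT.comp_rep hP hT.1, hcT.comp_rep hP hT.1]
    exact hc huv
  have h := (hT.peels hP).recolorable.2 c c' (key hc hcT) (key hc' hcT')
  have hcomp : ∀ {c : V → Fin 5}, Contains P T c → c ∘ rep P T = c := fun h =>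
    funext (h.comp_rep hP hT.1)
  rw [← hcomp hcT, ← hcomp hcT']
  clear hcT hcT' hc hc'
  induction h with
  | refl => exact .refl
  | tail _ h ih =>
    refine ih.trans ?_
    obtain ⟨h₁, h₂, α, β, h⟩ := h
    refine PairStep.kempeEquiv ⟨α, β, fun u => h _ trivial⟩ (h₁.comp_rep hP hT.1)
      (h₂.comp_rep hP hT.1)

end Contraction

/-! ### Linked templates -/

/-- An element of the point group of the lattice. -/
def orient (g : ℕ) (p : ℤ × ℤ) : ℤ × ℤ := rot^[g % 6] (if g < 6 then p else flip p)

/-- An image of `T` under a symmetry of the lattice. -/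
def place (g : ℕ) (d : ℤ × ℤ) (T : List (List (ℤ × ℤ))) : List (List (ℤ × ℤ)) :=
  T.map fun C => C.map fun p => orient g p + d

/-- Every class of `T` is contained in a class of `J`. -/
def Refines (T J : List (List (ℤ × ℤ))) : Prop := ∀ C ∈ T, ∃ D ∈ J, ∀ p ∈ C, p ∈ D

instance (T J : List (List (ℤ × ℤ))) : Decidable (Refines T J) :=
  inferInstanceAs (Decidable (∀ C ∈ T, _))

theorem Contains.mono {P : ℤ × ℤ → V} {T J : List (List (ℤ × ℤ))} {c : V → Fin 5}
    (h : Contains P J c) (hTJ : Refines T J) : Contains P T c := by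
  intro C hC p hp q hq
  obtain ⟨D, hD, hCD⟩ := hTJ C hC
  exact h D hD p (hCD p hp) q (hCD q hq)

theorem contains_map {P : ℤ × ℤ → V} {T : List (List (ℤ × ℤ))} {c : V → Fin 5}
    {τ : ℤ × ℤ → ℤ × ℤ} : Contains P (T.map fun C => C.map τ) c ↔ Contains (P ∘ τ) T c := by
  simp only [Contains, List.forall_mem_map, Function.comp]

/-- Colorings containing `T` are Kempe equivalent to colorings containing `T'`. -/
def Linked (G : SimpleGraph V) (P : ℤ × ℤ → V) (T T' : List (List (ℤ × ℤ))) : Prop :=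
  ∀ ⦃c c' : V → Fin 5⦄, Proper G c → Proper G c' → Contains P T c → Contains P T' c' →
    KempeEquiv G c c'

/-- The charts obtained from `P₀` by symmetries of the lattice. -/
inductive Orbit (P₀ : ℤ × ℤ → V) : (ℤ × ℤ → V) → Prop
  | base : Orbit P₀ P₀
  | shift {P} : Orbit P₀ P → Orbit P₀ (P ∘ shift)
  | rot {P} : Orbit P₀ P → Orbit P₀ (P ∘ rot)
  | flip {P} : Orbit P₀ P → Orbit P₀ (P ∘ flip)

namespace Orbit

variable {G : SimpleGraph V} {P₀ P : ℤ × ℤ → V}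

theorem isChart (h₀ : IsChart G P₀) (h : Orbit P₀ P) : IsChart G P := by
  induction h with
  | base => exact h₀
  | shift _ ih => exact ih.comp_shift
  | rot _ ih => exact ih.comp_rot
  | flip _ ih => exact ih.comp_flip

theorem congr {τ τ' : ℤ × ℤ → ℤ × ℤ} (h : Orbit P₀ (P ∘ τ)) (hτ : ∀ p, τ p = τ' p) :
    Orbit P₀ (P ∘ τ') := by
  rwa [← funext hτ]

theorem orient (h : Orbit P₀ P) (g : ℕ) : Orbit P₀ (P ∘ orient g) := by
  have hr : ∀ {P} (n : ℕ), Orbit P₀ P → Orbit P₀ (P ∘ KempePaper.rot^[n]) := by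
    intro P n h
    induction n with
    | zero => exact h
    | succ n ih =>
      rw [Function.iterate_succ, ← Function.comp_assoc]
      exact ih.rot
  by_cases hg : g < 6
  · exact (hr (g % 6) h).congr fun p => by simp [KempePaper.orient, hg]
  · exact (hr (g % 6) h).flip.congr (τ := KempePaper.rot^[g % 6] ∘ KempePaper.flip)
      fun p => by simp [KempePaper.orient, hg]

theorem translate (h : Orbit P₀ P) (d : ℤ × ℤ) : Orbit P₀ (P ∘ fun p => p + d) := by
  have hn : ∀ {P}, Orbit P₀ P → Orbit P₀ (P ∘ fun p => (p.1 - 1, p.2)) := by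
    intro P h
    refine ((h.orient 3).shift.orient 3).congr
      (τ := KempePaper.orient 3 ∘ KempePaper.shift ∘ KempePaper.orient 3) fun p => ?_
    ext <;> simp [KempePaper.orient, KempePaper.rot, KempePaper.shift] <;> ring
  have hx : ∀ {P} (x : ℤ), Orbit P₀ P → Orbit P₀ (P ∘ fun p => (p.1 + x, p.2)) := by
    intro P x h
    induction x using Int.inductionOn' (b := 0) with
    | zero => simpa [Function.comp_def] using h
    | succ k _ ih =>
      refine ih.shift.congr (τ := (fun p => (p.1 + k, p.2)) ∘ KempePaper.shift) fun p => ?_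
      ext <;> simp [KempePaper.shift]
      ring
    | pred k _ ih =>
      refine (hn ih).congr (τ := (fun p => (p.1 + k, p.2)) ∘ fun p => (p.1 - 1, p.2)) fun p => ?_
      ext <;> simp
      ring
  refine ((hx d.2 ((hx d.1 h).orient 1)).orient 5).congr
    (τ := (fun p => (p.1 + d.1, p.2)) ∘ KempePaper.orient 1 ∘ (fun p => (p.1 + d.2, p.2)) ∘
      KempePaper.orient 5) fun p => ?_
  ext <;> simp [KempePaper.orient, KempePaper.rot]
  ring

theorem place (h : Orbit P₀ P) (g : ℕ) (d : ℤ × ℤ) :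
    Orbit P₀ (P ∘ fun p => KempePaper.orient g p + d) :=
  (h.translate d).orient g

end Orbit

section Linked

variable {G : SimpleGraph V} {P : ℤ × ℤ → V} {T T' T'' J : List (List (ℤ × ℤ))}

theorem Linked.mono_right (h : Linked G P T T') (hT : Refines T' T'') : Linked G P T T'' :=
  fun _ _ hc hc' hcT hcT' => h hc hc' hcT (hcT'.mono hT)

variable [Finite V]

theorem Good.linked_of_refines (hP : IsChart G P) (hT : Good T) (h : Refines T T')
    (h' : Refines T T'') : Linked G P T' T'' :=
  fun _ _ hc hc' hcT hcT' => hT.kempeEquiv hP hc hc' (hcT.mono h) (hcT'.mono h')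

theorem Good.kempeEquiv_place (hP : IsChart G P) (hT : Good T) (g : ℕ) (d : ℤ × ℤ) :
    Linked G P (place g d T) (place g d T) := by
  intro c c' hc hc' hcT hcT'
  rw [place, contains_map] at hcT hcT'
  exact hT.kempeEquiv ((Orbit.base.place g d).isChart hP) hc hc' hcT hcT'

/-- The templates that are found in every coloring. -/
def templates : List (List (List (ℤ × ℤ))) :=
  [[[(0, 0), (0, 2), (2, 1)], [(0, 3), (2, 2)]],
   [[(0, 0), (0, 3), (1, 1)], [(1, 3), (2, 1)]],
   [[(0, 0), (0, 3), (1, 1), (2, 2)]],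
   [[(0, 1), (1, 2)], [(2, 2), (3, 0)], [(3, 2), (4, 0)]],
   [[(0, 1), (1, 2), (2, 0)], [(1, 3), (3, 2)]],
   [[(0, 1), (1, 2), (3, 1)], [(0, 2), (1, 0)]],
   [[(0, 1), (2, 0)], [(0, 2), (2, 1)], [(2, 3), (3, 1)]]]

/-- A monochromatic set of four points to which all other templates are linked. -/
def quad : List (List (ℤ × ℤ)) := [[(0, 0), (0, 3), (1, 1), (2, 2)]]

theorem good_of_mem_templates {T : List (List (ℤ × ℤ))} (hT : T ∈ templates) : Good T := by
  simp only [templates, List.mem_cons, List.not_mem_nil, or_false] at hT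
  rcases hT with rfl | rfl | rfl | rfl | rfl | rfl | rfl
  · exact ⟨by decide +kernel,
     [(1, 2), (1, 3), (1, 1), (0, 1), (1, 0), (2, 0), (2, -1), (3, -1), (3, 0), (4, -1), (4, 0),
      (1, -1), (2, -2), (3, 1), (4, 1), (1, -2), (3, 2), (0, -1), (2, 3), (0, 3), (0, 0)],
     by decide +kernel⟩
  · exact ⟨by decide +kernel,
     [(1, 2), (2, 2), (0, 2), (0, 1), (1, 0), (-1, 2), (-1, 3), (-2, 3), (-2, 4), (-1, 1), (-1, 4),
      (-2, 5), (-1, 5), (0, 4), (0, 5), (1, 4), (2, 3), (1, 3), (0, 0)],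
     by decide +kernel⟩
  · exact ⟨by decide +kernel,
     [(1, 2), (1, 3), (2, 1), (0, 2), (0, 1), (1, 0), (2, 0), (3, 0), (3, 1), (4, 0), (4, 1),
      (-1, 2), (-1, 3), (3, 2), (-2, 3), (-2, 4), (-1, 1), (-1, 4), (0, 4), (0, 0)],
     by decide +kernel⟩
  · exact ⟨by decide +kernel,
     [(3, 1), (4, 1), (2, 1), (1, 1), (2, 0), (0, 2), (1, 0), (2, -1), (3, -1), (1, -1), (3, -2),
      (4, -2), (4, -1), (5, -2), (5, -1), (2, 2), (3, 2), (0, 0), (0, 1)],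
     by decide +kernel⟩
  · exact ⟨by decide +kernel,
     [(1, 1), (2, 1), (2, 2), (2, 3), (3, 1), (0, 2), (1, 0), (3, 0), (4, 0), (4, 1), (5, 0),
      (5, 1), (4, -1), (4, 2), (3, -1), (3, 3), (1, 3), (0, 3), (0, 1)],
     by decide +kernel⟩
  · exact ⟨by decide +kernel,
     [(1, 1), (2, 1), (2, 2), (2, 0), (3, 0), (3, -1), (4, -1), (4, 0), (5, -1), (5, 0), (2, -1),
      (3, -2), (4, 1), (2, -2), (3, 2), (1, -1), (2, 3), (1, -2), (1, 3), (0, -1), (0, 0), (0, 1),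
      (0, 2)],
     by decide +kernel⟩
  · exact ⟨by decide +kernel,
     [(1, 1), (1, 2), (2, 2), (3, 2), (1, 0), (1, 3), (0, 3), (0, 4), (1, 4), (-1, 4), (0, 5),
      (1, 5), (2, 4), (3, 3), (2, 3), (-1, 3), (0, 2), (-1, 2), (3, 0), (0, 1)],
     by decide +kernel⟩

theorem templates_join_quad {T : List (List (ℤ × ℤ))} (hT : T ∈ templates) :
    ∃ (g : ℕ) (d : ℤ × ℤ) (J : List (List (ℤ × ℤ))),
      Good J ∧ Refines T J ∧ Refines (place g d quad) J := by
  simp only [templates, List.mem_cons, List.not_mem_nil, or_false] at hT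
  rcases hT with rfl | rfl | rfl | rfl | rfl | rfl | rfl
  · exact ⟨8, (2, 1), [[(-2, 3), (-1, 4), (0, 0), (0, 2), (2, 1)], [(0, 3), (2, 2)]],
     ⟨by decide +kernel,
      [(-1, 3), (1, 2), (1, 3), (-2, 4), (-1, 2), (0, 1), (1, 1), (-1, 1), (1, 0), (2, 0), (-2, 2),
       (2, -1), (3, -1), (3, 0), (-2, 1), (-1, 0), (1, -1), (-3, 2), (-3, 3), (-3, 4), (-3, 5),
       (-2, 5), (0, -1), (-2, 3), (0, 3)],
      by decide +kernel⟩, by decide +kernel, by decide +kernel⟩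
  · exact ⟨10, (0, 3), [[(0, 0), (0, 3), (1, 1), (2, -1)], [(1, 3), (2, 1)]],
     ⟨by decide +kernel,
      [(1, 0), (1, 2), (2, 0), (2, 2), (0, 1), (0, 2), (1, -1), (-1, 2), (-1, 3), (-2, 3), (-2, 4),
       (-1, 1), (-1, 4), (-2, 2), (-2, 1), (-1, 0), (0, -1), (1, -2), (2, -2), (0, 0), (0, 4),
       (1, 3)],
      by decide +kernel⟩, by decide +kernel, by decide +kernel⟩
  · exact ⟨0, (0, 0), [[(0, 0), (0, 3), (1, 1), (2, 2)]],
     ⟨by decide +kernel,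
      [(1, 2), (1, 3), (2, 1), (0, 2), (0, 1), (1, 0), (2, 0), (3, 0), (3, 1), (4, 0), (4, 1),
       (-1, 2), (-1, 3), (3, 2), (-2, 3), (-2, 4), (-1, 1), (-1, 4), (0, 4), (0, 0)],
      by decide +kernel⟩, by decide +kernel, by decide +kernel⟩
  · exact ⟨1, (3, 0), [[(0, 1), (1, 2)], [(0, 3), (1, 4), (2, 2), (3, 0)], [(3, 2), (4, 0)]],
     ⟨by decide +kernel,
      [(1, 3), (2, 3), (3, 1), (4, 1), (0, 4), (2, 1), (1, 1), (2, 0), (0, 2), (1, 0), (2, -1),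
       (3, -1), (0, 1), (-1, 2), (-1, 3), (-1, 4), (-1, 5), (0, 5), (0, 3), (2, 4), (3, 3), (3, 2)],
      by decide +kernel⟩, by decide +kernel, by decide +kernel⟩
  · exact ⟨10, (0, 4), [[(0, 1), (0, 4), (1, 2), (2, 0)], [(1, 3), (3, 2)]],
     ⟨by decide +kernel,
      [(1, 1), (2, 1), (2, 2), (2, 3), (3, 1), (0, 2), (0, 3), (1, 0), (3, 0), (4, 0), (4, 1),
       (1, 3), (-1, 3), (-1, 4), (1, 4), (-2, 4), (-2, 5), (-1, 2), (-1, 5), (0, 5), (0, 1)],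
      by decide +kernel⟩, by decide +kernel, by decide +kernel⟩
  · exact ⟨2, (3, 1), [[(-1, 3), (0, 1), (1, 2), (3, 1)], [(0, 2), (1, 0)]],
     ⟨by decide +kernel,
      [(1, 1), (2, 1), (2, 2), (2, 0), (3, 0), (3, -1), (4, -1), (4, 0), (2, -1), (3, -2), (2, -2),
       (1, -1), (0, 2), (-1, 2), (0, 0), (0, 3), (1, 3), (2, 3), (3, 2), (4, 1), (-1, 3)],
      by decide +kernel⟩, by decide +kernel, by decide +kernel⟩
  · exact ⟨5, (-1, 3), [[(-1, 3), (1, 2), (2, 3), (3, 1)], [(0, 1), (2, 0)], [(0, 2), (2, 1)]],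
     ⟨by decide +kernel,
      [(1, 1), (2, 2), (3, 2), (1, 0), (1, 3), (0, 3), (0, 4), (1, 4), (0, 2), (-1, 4), (-1, 5),
       (0, 5), (1, 5), (2, 4), (3, 3), (4, 2), (-2, 5), (4, 1), (-2, 4), (-1, 3), (-1, 2), (3, 0),
       (0, 1)],
      by decide +kernel⟩, by decide +kernel, by decide +kernel⟩

theorem good_quad : Good quad := good_of_mem_templates (by decide)

theorem Linked.place {g : ℕ} {d : ℤ × ℤ} (h : Linked G P quad (place g d quad))
    (hP : IsChart G P) (g' : ℕ) (d' : ℤ × ℤ) (hJ : Good J)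
    (h₁ : Refines (KempePaper.place g d quad) J) (h₂ : Refines (KempePaper.place g' d' quad) J) :
    Linked G P quad (KempePaper.place g' d' quad) := by
  intro c c' hc hc' hcT hcT'
  obtain ⟨e, he, heJ⟩ := hJ.exists_contains hP
  exact (h hc he hcT (heJ.mono h₁)).trans
    (good_quad.kempeEquiv_place hP g' d' he hc' (heJ.mono h₂) hcT')

theorem linked_quad_shift (hP : IsChart G P) :
    Linked G P quad (quad.map fun C => C.map shift) := by
  have h₀ : Linked G P quad (place 0 (0, 0) quad) :=
    good_quad.linked_of_refines hP (by decide) (by decide)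
  have h₁ := h₀.place hP 1 (2, -1) (J := [[(-1, 2), (0, 0), (0, 3), (1, 1), (2, -1), (2, 2)]])
    ⟨by decide +kernel,
     [(0, 1), (0, 2), (1, 0), (1, 2), (1, 3), (2, 0), (2, 1), (3, 0), (3, 1), (4, 0), (4, 1),
      (-1, 1), (-1, 3), (1, -1), (3, -1), (3, 2), (4, -1), (2, 3), (4, -2), (1, 4), (3, -2),
      (0, 4), (2, -2), (-1, 4), (-1, 2)],
     by decide +kernel⟩ (by decide +kernel) (by decide +kernel)
  have h₂ := h₁.place hP 9 (3, 2)
    (J := [[(-1, 2), (0, 3), (1, 1), (2, -1)], [(0, 2), (1, 0), (2, 1), (3, 2)]])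
    ⟨by decide +kernel,
     [(0, 1), (1, 2), (2, 0), (2, 2), (3, 1), (1, 3), (2, 3), (3, 0), (4, 0), (4, 1), (1, 4),
      (2, 4), (3, -1), (3, 3), (4, 2), (0, 2), (-1, 3), (0, 0), (0, 4), (1, -1), (-1, 1), (-1, 4),
      (-1, 2)],
     by decide +kernel⟩ (by decide +kernel) (by decide +kernel)
  have h₃ := h₂.place hP 0 (1, 0) (J := [[(0, 2), (1, 0), (1, 3), (2, 1), (3, 2)]])
    ⟨by decide +kernel,
     [(1, 1), (1, 2), (2, 0), (2, 2), (2, 3), (3, 1), (0, 1), (0, 3), (3, 0), (4, 0), (4, 1),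
      (5, 0), (5, 1), (3, -1), (4, 2), (2, -1), (3, -2), (3, 3), (2, -2), (2, 4), (1, -1), (1, 4),
      (0, 2)],
     by decide +kernel⟩ (by decide +kernel) (by decide +kernel)
  exact h₃.mono_right (by decide +kernel)

theorem linked_quad_rot (hP : IsChart G P) :
    Linked G P quad (quad.map fun C => C.map rot) := by
  have h₀ : Linked G P quad (place 0 (0, 0) quad) :=
    good_quad.linked_of_refines hP (by decide) (by decide)
  have h₁ := h₀.place hP 4 (-2, 4) (J := [[(-2, 4), (-1, 2), (0, 0), (0, 3), (1, 1), (2, 2)]])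
    ⟨by decide +kernel,
     [(-1, 3), (-1, 4), (0, 1), (0, 2), (1, 0), (1, 2), (1, 3), (2, 1), (-2, 3), (-1, 1), (0, 4),
      (1, 4), (2, 0), (2, 3), (3, 0), (3, 1), (3, 2), (-2, 2), (-1, 5), (-3, 3), (-3, 4), (-2, 5),
      (-2, 4)],
     by decide +kernel⟩ (by decide +kernel) (by decide +kernel)
  have h₂ := h₁.place hP 1 (0, 0) (J := [[(-3, 3), (-2, 4), (-1, 2), (0, 0), (1, 1)]])
    ⟨by decide +kernel,
     [(-2, 3), (-1, 3), (0, 1), (0, 2), (0, 3), (1, 0), (1, 2), (1, 3), (2, 2), (-3, 4), (-2, 2),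
      (-1, 1), (-1, 4), (0, 4), (2, 1), (-2, 1), (-1, 0), (-1, 5), (2, 0), (-3, 2), (-2, 0),
      (-2, 5), (-1, -1), (0, -1), (-3, 3)],
     by decide +kernel⟩ (by decide +kernel) (by decide +kernel)
  exact h₂.mono_right (by decide +kernel)

theorem linked_quad_flip (hP : IsChart G P) :
    Linked G P quad (quad.map fun C => C.map flip) := by
  have h₀ : Linked G P quad (place 0 (0, 0) quad) :=
    good_quad.linked_of_refines hP (by decide) (by decide)
  have h₁ := h₀.place hP 6 (0, 0) (J := [[(0, 0), (0, 3), (1, 1), (2, 2), (3, 0)]])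
    ⟨by decide +kernel,
     [(1, 2), (1, 3), (2, 1), (3, 1), (0, 2), (2, 0), (0, 1), (1, 0), (2, -1), (3, -1), (-1, 2),
      (-1, 3), (1, -1), (3, -2), (4, -2), (4, -1), (4, 0), (-2, 3), (-2, 4), (-1, 1), (-1, 4),
      (0, 4), (0, 0)],
     by decide +kernel⟩ (by decide +kernel) (by decide +kernel)
  exact h₁.mono_right (by decide +kernel)
end Linked

/-- The coloring `c` is Kempe equivalent to a coloring containing a copy of `quad`. -/
def IsTame (G : SimpleGraph V) (P₀ : ℤ × ℤ → V) (c : V → Fin 5) : Prop :=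
  ∃ P, Orbit P₀ P ∧ ∃ c', Proper G c' ∧ KempeEquiv G c c' ∧ Contains P quad c'

section Tame

variable [Finite V] {G : SimpleGraph V} {P₀ P : ℤ × ℤ → V}

theorem Orbit.linked_quad (h₀ : IsChart G P₀) (h : Orbit P₀ P) {c c' : V → Fin 5}
    (hc : Proper G c) (hc' : Proper G c') (hcP : Contains P₀ quad c)
    (hcP' : Contains P quad c') : KempeEquiv G c c' := by
  have step : ∀ {P τ}, Orbit P₀ P → Linked G P quad (quad.map fun C => C.map τ) →
      (∀ {c'}, Proper G c' → Contains P quad c' → KempeEquiv G c c') →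
      ∀ {c'}, Proper G c' → Contains (P ∘ τ) quad c' → KempeEquiv G c c' := by
    intro P τ hP hL ih c' hc' h
    obtain ⟨e, he, heP⟩ := good_quad.exists_contains (hP.isChart h₀)
    exact (ih he heP).trans (hL he hc' heP (contains_map.2 h))
  induction h generalizing c' with
  | base => exact good_quad.kempeEquiv h₀ hc hc' hcP hcP'
  | shift hP ih => exact step hP (linked_quad_shift (hP.isChart h₀)) ih hc' hcP'
  | rot hP ih => exact step hP (linked_quad_rot (hP.isChart h₀)) ih hc' hcP'
  | flip hP ih => exact step hP (linked_quad_flip (hP.isChart h₀)) ih hc' hcP'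

theorem IsTame.kempeEquiv (h₀ : IsChart G P₀) {c c' : V → Fin 5} (hc' : Proper G c')
    (h : IsTame G P₀ c) (h' : IsTame G P₀ c') : KempeEquiv G c c' := by
  obtain ⟨P, hP, d, hd, hcd, hdP⟩ := h
  obtain ⟨P', hP', d', hd', hcd', hdP'⟩ := h'
  obtain ⟨e, he, heP⟩ := good_quad.exists_contains h₀
  have h₁ := hP.linked_quad h₀ he hd heP hdP
  have h₂ := hP'.linked_quad h₀ he hd' heP hdP'
  exact (hcd.trans (h₁.symm he)).trans (h₂.trans (hcd'.symm hc'))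

theorem isTame_of_contains (h₀ : IsChart G P₀) (hP : Orbit P₀ P) {c : V → Fin 5}
    (hc : Proper G c) {T : List (List (ℤ × ℤ))} (hT : T ∈ templates) (hcT : Contains P T c) :
    IsTame G P₀ c := by
  obtain ⟨g, d, J, hJ, hTJ, hqJ⟩ := templates_join_quad hT
  obtain ⟨e, he, heJ⟩ := hJ.exists_contains (hP.isChart h₀)
  exact ⟨_, hP.place g d, e, he,
    (good_of_mem_templates hT).kempeEquiv (hP.isChart h₀) hc he hcT (heJ.mono hTJ),
    contains_map.1 (heJ.mono hqJ)⟩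

end Tame

/-! ### Colorings of the lattice without tame classes -/

/-- A class of colorings of the lattice that avoids `templates` and is closed under symmetries,
permutations of the colors, and Kempe swaps on pull-backs of Kempe components. -/
structure BadClass (B : (ℤ × ℤ → Fin 5) → Prop) : Prop where
  place : ∀ {f}, B f → ∀ (g : ℕ) (d : ℤ × ℤ), B fun p => f (orient g p + d)
  recolor : ∀ {f}, B f → ∀ σ : Equiv.Perm (Fin 5), B (σ ∘ f)
  proper : ∀ {f}, B f → ∀ p, ∀ d ∈ dirs, f p ≠ f (p + d)
  templates : ∀ {f}, B f → ∀ T ∈ templates, ¬ ∀ C ∈ T, ∀ p ∈ C, ∀ q ∈ C, f p = f q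
  swap : ∀ {f}, B f → ∀ (α β : Fin 5) (p : ℤ × ℤ), f p = α ∨ f p = β →
    ∃ C : Set (ℤ × ℤ), p ∈ C ∧
      (∀ q ∈ C, ∀ d ∈ dirs, f (q + d) = α ∨ f (q + d) = β → q + d ∈ C) ∧
      (∀ D : Set (ℤ × ℤ),
        (∀ q ∈ D, ∀ d ∈ dirs, f (q + d) = α ∨ f (q + d) = β → q + d ∈ D) →
        ∀ q₀ ∈ D, q₀ ∈ C → ∀ q' ∈ C, (∀ q ∈ D, Short (q - q')) → q' ∈ D) ∧
      ∃ f', B f' ∧ (∀ q ∈ C, f' q = Equiv.swap α β (f q)) ∧ ∀ q ∉ C, f' q = f q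

theorem Proper.comp_perm {G : SimpleGraph V} {c : V → Fin 5} (hc : Proper G c)
    (σ : Equiv.Perm (Fin 5)) : Proper G (σ ∘ c) :=
  fun _ _ huv h => hc huv (σ.injective h)

theorem kempeEquiv_comp_perm [Finite V] {G : SimpleGraph V} {c : V → Fin 5} (hc : Proper G c)
    (σ : Equiv.Perm (Fin 5)) : KempeEquiv G c (σ ∘ c) := by
  induction σ using Equiv.Perm.swap_induction_on with
  | one => exact .refl
  | swap_mul σ α β _ ih =>
    exact ih.trans ((PairStep.comp_swap (σ ∘ c) α β).kempeEquiv (hc.comp_perm σ)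
      ((hc.comp_perm σ).comp_perm _))

/-- The pull-backs to the lattice of the proper colorings that are not tame. -/
def IsBad (G : SimpleGraph V) (P₀ : ℤ × ℤ → V) (f : ℤ × ℤ → Fin 5) : Prop :=
  ∃ P, Orbit P₀ P ∧ ∃ c, Proper G c ∧ ¬ IsTame G P₀ c ∧ f = c ∘ P

theorem IsTame.of_kempeEquiv {G : SimpleGraph V} {P₀ : ℤ × ℤ → V} {c c' : V → Fin 5}
    (h : IsTame G P₀ c') (hc : KempeEquiv G c c') : IsTame G P₀ c := by
  obtain ⟨P, hP, d, hd, hcd, hdP⟩ := h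
  exact ⟨P, hP, d, hd, hc.trans hcd, hdP⟩

theorem badClass_isBad [Finite V] {G : SimpleGraph V} {P₀ : ℤ × ℤ → V} (h₀ : IsChart G P₀) :
    BadClass (IsBad G P₀) where
  place := by
    rintro _ ⟨P, hP, c, hc, hnt, rfl⟩ g d
    exact ⟨_, hP.place g d, c, hc, hnt, rfl⟩
  recolor := by
    rintro _ ⟨P, hP, c, hc, hnt, rfl⟩ σ
    exact ⟨P, hP, σ ∘ c, hc.comp_perm σ,
      fun h => hnt (h.of_kempeEquiv (kempeEquiv_comp_perm hc σ)), rfl⟩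
  proper := by
    rintro _ ⟨P, hP, c, hc, hnt, rfl⟩ p d hd
    exact hc (((hP.isChart h₀).adj _ _).2 ⟨d, hd, rfl⟩)
  templates := by
    rintro _ ⟨P, hP, c, hc, hnt, rfl⟩ T hT h
    exact hnt (isTame_of_contains h₀ hP hc hT h)
  swap := by
    classical
    rintro _ ⟨P, hP, c, hc, hnt, rfl⟩ α β p hp
    have hchart := hP.isChart h₀
    let K := kempeGraph G c α β
    let c' : V → Fin 5 := fun v =>
      if K.Reachable (P p) v then Equiv.swap α β (c v) else c v
    have hstep : KempeStep G c c' :=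
      ⟨α, β, P p, fun v hv => if_pos hv, fun v hv => if_neg hv⟩
    have hcol : ∀ v, K.Reachable (P p) v → c v = α ∨ c v = β := by
      intro v hv
      rw [SimpleGraph.reachable_iff_reflTransGen] at hv
      cases hv with
      | refl => exact hp
      | tail _ h => exact (kempeGraph_adj.1 h).2.2
    refine ⟨{q | K.Reachable (P p) (P q)}, SimpleGraph.Reachable.refl _, ?_, ?_, c' ∘ P,
      ⟨P, hP, c', hstep.proper hc, fun h => hnt (h.of_kempeEquiv (.single hstep)), rfl⟩,
      fun q hq => if_pos hq, fun q hq => if_neg hq⟩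
    · intro q hq d hd hcd
      exact hq.trans (SimpleGraph.Adj.reachable
        (kempeGraph_adj.2 ⟨(hchart.adj _ _).2 ⟨d, hd, rfl⟩, hcol _ hq, hcd⟩))
    · intro D hD q₀ hq₀ hq₀C q' hq' hshort
      have hreach : K.Reachable (P q₀) (P q') := (SimpleGraph.Reachable.symm hq₀C).trans hq'
      rw [SimpleGraph.reachable_iff_reflTransGen] at hreach
      have : ∀ v, Relation.ReflTransGen K.Adj (P q₀) v → ∃ q ∈ D, P q = v := by
        intro v hv
        induction hv with
        | refl => exact ⟨q₀, hq₀, rfl⟩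
        | tail _ h ih =>
          obtain ⟨q, hq, rfl⟩ := ih
          obtain ⟨hadj, -, hw⟩ := kempeGraph_adj.1 h
          obtain ⟨d, hd, rfl⟩ := (hchart.adj _ _).1 hadj
          exact ⟨_, hD q hq d hd hw, rfl⟩
      obtain ⟨q, hq, hqq'⟩ := this _ hreach
      rwa [← hchart.inj _ _ (hshort q hq) hqq']

/-- The template `T`, with classes of pairwise different colors if `d` holds, does not occur. -/
def Excluded (B : (ℤ × ℤ → Fin 5) → Prop) (d : Bool) (T : List (List (ℤ × ℤ))) : Prop :=
  ∀ f, B f → ∀ cs : List ℕ, (d = true → cs.Nodup) →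
    ¬ List.Forall₂ (fun C c => ∀ p ∈ C, (f p : ℕ) = c) T cs

theorem Excluded.place {B : (ℤ × ℤ → Fin 5) → Prop} (hB : BadClass B) {b : Bool}
    {T : List (List (ℤ × ℤ))} (h : Excluded B b T) (g : ℕ) (d : ℤ × ℤ) :
    Excluded B b (place g d T) := by
  intro f hf cs hcs hT
  refine h _ (hB.place hf g d) cs hcs ?_
  rw [KempePaper.place, List.forall₂_map_left_iff] at hT
  exact hT.imp fun C c hC p hp => hC (KempePaper.orient g p + d) (List.mem_map.2 ⟨p, hp, rfl⟩)

theorem excluded_of_mem_templates {B : (ℤ × ℤ → Fin 5) → Prop} (hB : BadClass B)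
    {T : List (List (ℤ × ℤ))} (hT : T ∈ templates) : Excluded B false T := by
  intro f hf cs _ h
  refine hB.templates hf T hT fun C hC p hp q hq => ?_
  have : ∀ {T : List (List (ℤ × ℤ))} {cs : List ℕ},
      List.Forall₂ (fun C c => ∀ p ∈ C, (f p : ℕ) = c) T cs →
        ∀ C ∈ T, ∃ c, ∀ p ∈ C, (f p : ℕ) = c := by
    intro T cs h
    induction h with
    | nil => simp
    | cons h _ ih => exact List.forall_mem_cons.2 ⟨⟨_, h⟩, ih⟩
  obtain ⟨c, hc⟩ := this h C hC
  exact Fin.ext ((hc p hp).trans (hc q hq).symm)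

/-! ### Partial colorings as bit masks -/

/-- The lattice point with code `n`. -/
def point (n : ℕ) : ℤ × ℤ := ((n % 16 : ℕ), (n / 16 : ℕ))

/-- The code of a lattice point with small nonnegative coordinates. -/
def code (p : ℤ × ℤ) : ℕ := 16 * p.2.toNat + p.1.toNat

/-- The bit mask of a finite set of points. -/
def mask (C : List (ℤ × ℤ)) : ℕ := C.foldr (fun p m => m ||| 1 <<< code p) 0

/-- The points at distance at most 3 from the point with code 68. -/
def window : ℕ := 155773818054450052060216447139315712

/-- The points at distance at most 2 from the point with code 68. -/
def core : ℕ := 2218461088236008372987938996224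

/-- The code `n'` is the code of a neighbor of the point with code `n`. -/
def Near (n n' : ℕ) : Prop :=
  n' = n + 1 ∨ n = n' + 1 ∨ n' = n + 16 ∨ n = n' + 16 ∨ n' = n + 15 ∨ n = n' + 15

instance (n n' : ℕ) : Decidable (Near n n') := inferInstanceAs (Decidable (_ ∨ _))

/-- The mask of the neighbors of a set of points. -/
def nb (D : ℕ) : ℕ :=
  Nat.lor (Nat.lor (Nat.lor (Nat.shiftLeft D 1) (Nat.shiftRight D 1))
    (Nat.lor (Nat.shiftLeft D 16) (Nat.shiftRight D 16)))
    (Nat.lor (Nat.shiftLeft D 15) (Nat.shiftRight D 15))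

/-- Inclusion of masks. -/
def incl (a b : ℕ) : Bool := Nat.beq (Nat.land a b) a

/-- The value `k n`, with `n` evaluated first. -/
def force {α : Type} (n : ℕ) (k : ℕ → α) : α :=
  match n with
  | 0 => k 0
  | m + 1 => k (Nat.succ m)

/-- The masks of the points known to have the colors 0, 1, 2, 3, 4. -/
structure Masks where
  /-- The points of color 0. -/
  c0 : ℕ
  /-- The points of color 1. -/
  c1 : ℕ
  /-- The points of color 2. -/
  c2 : ℕ
  /-- The points of color 3. -/
  c3 : ℕ
  /-- The points of color 4. -/
  c4 : ℕ

namespace Masks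

/-- The points of color `c`. -/
def get (S : Masks) (c : ℕ) : ℕ :=
  match c with
  | 0 => S.c0
  | 1 => S.c1
  | 2 => S.c2
  | 3 => S.c3
  | 4 => S.c4
  | _ => 0

/-- Replace the points of color `c`. -/
def set (S : Masks) (c x : ℕ) : Masks :=
  match S with
  | ⟨a₀, a₁, a₂, a₃, a₄⟩ => force x fun x =>
    match c with
    | 0 => ⟨x, a₁, a₂, a₃, a₄⟩
    | 1 => ⟨a₀, x, a₂, a₃, a₄⟩
    | 2 => ⟨a₀, a₁, x, a₃, a₄⟩
    | 3 => ⟨a₀, a₁, a₂, x, a₄⟩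
    | 4 => ⟨a₀, a₁, a₂, a₃, x⟩
    | _ => ⟨a₀, a₁, a₂, a₃, a₄⟩

/-- All the points with a known color. -/
def support (S : Masks) : ℕ :=
  Nat.lor (Nat.lor (Nat.lor (Nat.lor S.c0 S.c1) S.c2) S.c3) S.c4

end Masks

/-- Whether some color `c` with color class `a` satisfies `P c a`. -/
def anyColor (S : Masks) (P : ℕ → ℕ → Bool) : Bool :=
  match S with
  | ⟨a₀, a₁, a₂, a₃, a₄⟩ =>
    cond (P 0 a₀) true (cond (P 1 a₁) true (cond (P 2 a₂) true (cond (P 3 a₃) true (P 4 a₄))))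

/-- The masks in the list, shifted by `k`, lie in color classes of `S`; the color classes are
different if `b` holds, and different from those in `used`. -/
def occurs (b : Bool) (S : Masks) (k : ℕ) : List ℕ → List ℕ → Bool
  | _, [] => true
  | used, M :: Ms => force (Nat.shiftLeft M k) fun M => anyColor S fun c a =>
      cond (incl M a) (cond (b && used.any (Nat.beq c)) false (occurs b S k (c :: used) Ms)) false

/-- Add `S` to the list if `b` holds. -/
def consIf (b : Bool) (S : Masks) (l : List Masks) : List Masks :=
  match b with
  | true => S :: l
  | false => l

/-- Whether a point with neighbors `N` may be added to the color class `a`, where an empty class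
may be used only if the preceding class `a'` is not empty. -/
def free (N a a' : ℕ) : Bool :=
  cond (Nat.beq (Nat.land a N) 0) (cond (Nat.beq a 0) (!Nat.beq a' 0) true) false

/-- The ways to color one more point, up to permutations of the unused colors. -/
def reveal (S : Masks) (v : ℕ) : List Masks :=
  match S with
  | ⟨a₀, a₁, a₂, a₃, a₄⟩ => force (Nat.shiftLeft 1 v) fun x => force (nb x) fun N =>
    consIf (free N a₀ 1) (force (Nat.lor a₀ x) fun y => ⟨y, a₁, a₂, a₃, a₄⟩) <|
    consIf (free N a₁ a₀) (force (Nat.lor a₁ x) fun y => ⟨a₀, y, a₂, a₃, a₄⟩) <|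
    consIf (free N a₂ a₁) (force (Nat.lor a₂ x) fun y => ⟨a₀, a₁, y, a₃, a₄⟩) <|
    consIf (free N a₃ a₂) (force (Nat.lor a₃ x) fun y => ⟨a₀, a₁, a₂, y, a₄⟩) <|
    consIf (free N a₄ a₃) (force (Nat.lor a₄ x) fun y => ⟨a₀, a₁, a₂, a₃, y⟩) []

/-- The component of `D` in `m`. -/
def flood (m : ℕ) : ℕ → ℕ → ℕ
  | 0, D => D
  | n + 1, D => force (Nat.land (Nat.lor D (nb D)) m) fun E =>
      cond (Nat.beq E D) D (flood m n E)

/-- In colorings matching `S`, the set `E` is a union of components of the subgraph induced by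
two colors, where `m` is the mask of these two colors in `S`. -/
def isolated (S : Masks) (m E : ℕ) : Bool :=
  force (nb E) fun N => incl E core && incl N S.support && incl (Nat.land N m) E

/-- Swap the colors `α` and `β` on the component of `i`. -/
def move (S : Masks) (α β i : ℕ) : List Masks :=
  force (Nat.lor (S.get α) (S.get β)) fun m => force (flood m 8 (Nat.shiftLeft 1 i)) fun D =>
    cond (!Nat.beq α β && Nat.ble α 4 && Nat.ble β 4 && incl (Nat.shiftLeft 1 i) m &&
        (isolated S m D || isolated S m (Nat.xor m D)))
      [(S.set α (Nat.xor (S.get α) D)).set β (Nat.xor (S.get β) D)] [S]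

/-- One step of the search; `t` encodes the step and `tab` contains the known templates. -/
def expand (tab : List (Bool × List (List ℕ))) (S : Masks) (t : ℕ) : List Masks :=
  force (Nat.div t 4) fun q =>
    match Nat.mod t 4 with
    | 1 =>
      match tab.getD (Nat.mod q 16) (false, []) with
      | (b, Ms) => match Ms.getD (Nat.mod (Nat.div q 16) 16) [] with
        | [] => [S]
        | M :: Ms => cond (occurs b S (Nat.add (Nat.mod (Nat.div q 256) 8)
            (Nat.mul 16 (Nat.mod (Nat.div q 2048) 8))) [] (M :: Ms)) [] [S]
    | 2 => cond (incl (Nat.shiftLeft 1 q) window) (reveal S q) [S]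
    | 3 => force (Nat.mod q 8) fun α => force (Nat.mod (Nat.div q 8) 8) fun β =>
      force (Nat.div q 64) fun i => move S α β i
    | _ => [S]

/-- Apply the first `k` steps encoded in `n` to a stack. -/
def runWord (tab : List (Bool × List (List ℕ))) : ℕ → ℕ → List Masks → List Masks
  | 0, _, st => st
  | k + 1, n, st =>
    match st with
    | [] => []
    | S :: st => force n fun n => force (Nat.mod n 65536) fun t =>
      runWord tab k (Nat.div n 65536)
        (List.append (match S with
          | ⟨a₀, a₁, a₂, a₃, a₄⟩ => expand tab ⟨a₀, a₁, a₂, a₃, a₄⟩ t) st)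

/-- Apply the steps encoded in a list of words to a stack; `true` if nothing is left. -/
def run (tab : List (Bool × List (List ℕ))) : List ℕ → List Masks → Bool
  | ns, st =>
    match ns with
    | [] => st.isEmpty
    | n :: ns =>
      match runWord tab 19 n st with
      | [] => true
      | S :: st => run tab ns (S :: st)

/-! ### Soundness of the search -/

theorem force_eq {α : Type} (n : ℕ) (k : ℕ → α) : force n k = k n := by
  cases n <;> rfl

theorem beq_eq_false_of_ne {a b : ℕ} (h : a ≠ b) : Nat.beq a b = false :=
  Bool.eq_false_iff.2 fun h' => h (Nat.eq_of_beq_eq_true h')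

theorem testBit_land (a b n : ℕ) :
    (Nat.land a b).testBit n = (a.testBit n && b.testBit n) := Nat.testBit_and a b n

theorem testBit_lor (a b n : ℕ) :
    (Nat.lor a b).testBit n = (a.testBit n || b.testBit n) := Nat.testBit_or a b n

theorem testBit_lxor (a b n : ℕ) :
    (Nat.xor a b).testBit n = (a.testBit n ^^ b.testBit n) := Nat.testBit_xor a b n

theorem testBit_shl (a k n : ℕ) :
    (Nat.shiftLeft a k).testBit n = (decide (k ≤ n) && a.testBit (n - k)) :=
  Nat.testBit_shiftLeft a

theorem testBit_shr (a k n : ℕ) : (Nat.shiftRight a k).testBit n = a.testBit (k + n) :=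
  Nat.testBit_shiftRight a

theorem testBit_one_shl (k n : ℕ) : (Nat.shiftLeft 1 k).testBit n = true ↔ n = k := by
  change (1 <<< k).testBit n = true ↔ _
  rw [Nat.one_shiftLeft, Nat.testBit_two_pow]
  simp [eq_comm]

theorem incl_testBit {a b : ℕ} (h : incl a b = true) {n : ℕ} (hn : a.testBit n = true) :
    b.testBit n = true := by
  have h' := Nat.eq_of_beq_eq_true h
  rw [← h', testBit_land] at hn
  simp_all

theorem testBit_nb {D n : ℕ} :
    (nb D).testBit n = true ↔ ∃ n', D.testBit n' = true ∧ Near n' n := by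
  simp only [nb, testBit_lor, testBit_shl, testBit_shr, Bool.or_eq_true, Bool.and_eq_true,
    decide_eq_true_eq, Near]
  constructor
  · rintro (((⟨h, hD⟩ | hD) | (⟨h, hD⟩ | hD)) | (⟨h, hD⟩ | hD)) <;>
      exact ⟨_, hD, by omega⟩
  · rintro ⟨n', hD, rfl | rfl | rfl | rfl | rfl | rfl⟩ <;> simp [hD, Nat.add_comm]

theorem point_injective : Function.Injective point := by
  intro n n' h
  simp only [point, Prod.mk.injEq, Nat.cast_inj] at h
  omega

theorem lt_of_window {n : ℕ} (h : window.testBit n = true) : n < 128 := by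
  by_contra hn
  rw [Nat.testBit_lt_two_pow] at h
  · cases h
  · exact lt_of_lt_of_le (by decide) (Nat.pow_le_pow_right two_pos (not_lt.1 hn))

theorem lt_of_core {n : ℕ} (h : core.testBit n = true) : n < 128 := by
  by_contra hn
  rw [Nat.testBit_lt_two_pow] at h
  · cases h
  · exact lt_of_lt_of_le (by decide) (Nat.pow_le_pow_right two_pos (not_lt.1 hn))

theorem exists_near {n : ℕ} (h : window.testBit n = true) {d : ℤ × ℤ} (hd : d ∈ dirs) :
    ∃ n', Near n n' ∧ point n' = point n + d := by
  have key : ∀ n < 128, window.testBit n = true → ∀ d ∈ dirs,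
      Near n (code (point n + d)) ∧ point (code (point n + d)) = point n + d := by
    decide +kernel
  exact ⟨_, key n (lt_of_window h) h d hd⟩

theorem Near.exists_dirs {n n' : ℕ} (h : window.testBit n = true)
    (h' : window.testBit n' = true) (hn : Near n n') : ∃ d ∈ dirs, point n' = point n + d := by
  have key : ∀ n < 128, window.testBit n = true → ∀ n' < 128, window.testBit n' = true →
      Near n n' → dirs.contains (point n' - point n) = true := by
    decide +kernel
  exact ⟨_, List.contains_iff_mem.1 (key n (lt_of_window h) h n' (lt_of_window h') h' hn),
    (add_sub_cancel ..).symm⟩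

theorem short_of_core {n n' : ℕ} (h : core.testBit n = true)
    (h' : window.testBit n' = true) : Short (point n - point n') := by
  have key : ∀ n < 128, core.testBit n = true → ∀ n' < 128, window.testBit n' = true →
      Short (point n - point n') := by
    decide +kernel
  exact key n (lt_of_core h) h n' (lt_of_window h') h'

/-- The coloring `f` of the lattice has the colors recorded by `S`. -/
def Matches (f : ℤ × ℤ → Fin 5) (S : Masks) : Prop :=
  ∀ c n, (S.get c).testBit n = true → window.testBit n = true ∧ (f (point n) : ℕ) = c

/-- No coloring of the class `B` matches `S`. -/
def Dead (B : (ℤ × ℤ → Fin 5) → Prop) (S : Masks) : Prop := ∀ f, B f → ¬ Matches f S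

theorem Masks.get_set {S : Masks} {c x e : ℕ} (hc : c ≤ 4) :
    (S.set c x).get e = if e = c then x else S.get e := by
  obtain ⟨a₀, a₁, a₂, a₃, a₄⟩ := S
  simp only [Masks.set, force_eq]
  by_cases he : e ≤ 4
  · interval_cases c <;> interval_cases e <;> rfl
  · have h : ∀ S : Masks, S.get e = 0 := by
      intro S
      obtain ⟨e, rfl⟩ : ∃ k, e = k + 5 := ⟨e - 5, by omega⟩
      rfl
    rw [h, h, if_neg (by omega)]

theorem Masks.support_testBit {S : Masks} {n : ℕ} (h : S.support.testBit n = true) :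
    ∃ c, (S.get c).testBit n = true := by
  simp only [Masks.support, testBit_lor, Bool.or_eq_true] at h
  rcases h with (((h | h) | h) | h) | h
  exacts [⟨0, h⟩, ⟨1, h⟩, ⟨2, h⟩, ⟨3, h⟩, ⟨4, h⟩]

section Soundness

variable {B : (ℤ × ℤ → Fin 5) → Prop}

/-- The list of masks comes from a template that does not occur in colorings of the class `B`. -/
def Sound (B : (ℤ × ℤ → Fin 5) → Prop) (b : Bool) (Ms : List ℕ) : Prop :=
  ∃ T : List (List (ℤ × ℤ)), Ms = T.map mask ∧ Excluded B b T ∧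
    ∀ C ∈ T, ∀ p ∈ C, 0 ≤ p.1 ∧ p.1 < 8 ∧ 0 ≤ p.2

theorem exists_of_anyColor {S : Masks} {P : ℕ → ℕ → Bool} (h : anyColor S P = true) :
    ∃ c, P c (S.get c) = true := by
  obtain ⟨a₀, a₁, a₂, a₃, a₄⟩ := S
  simp only [anyColor, Bool.cond_true_left, Bool.or_eq_true] at h
  rcases h with h | h | h | h | h
  exacts [⟨0, h⟩, ⟨1, h⟩, ⟨2, h⟩, ⟨3, h⟩, ⟨4, h⟩]

theorem mem_consIf {b : Bool} {S S' : Masks} {l : List Masks} :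
    S' ∈ consIf b S l ↔ b = true ∧ S' = S ∨ S' ∈ l := by
  cases b <;> simp [consIf]

theorem mem_reveal {S : Masks} {v c : ℕ} (hc : c < 5)
    (h : free (nb (Nat.shiftLeft 1 v)) (S.get c) (if c = 0 then 1 else S.get (c - 1)) = true) :
    S.set c (Nat.lor (S.get c) (Nat.shiftLeft 1 v)) ∈ reveal S v := by
  obtain ⟨a₀, a₁, a₂, a₃, a₄⟩ := S
  simp only [reveal, force_eq, mem_consIf, Masks.set]
  interval_cases c
  exacts [.inl ⟨h, rfl⟩, .inr (.inl ⟨h, rfl⟩), .inr (.inr (.inl ⟨h, rfl⟩)),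
    .inr (.inr (.inr (.inl ⟨h, rfl⟩))), .inr (.inr (.inr (.inr (.inl ⟨h, rfl⟩))))]

theorem occurs_sound {b : Bool} {S : Masks} {k : ℕ} {Ms : List ℕ} :
    ∀ {used : List ℕ}, occurs b S k used Ms = true → ∃ cs : List ℕ,
      List.Forall₂ (fun M c => incl (Nat.shiftLeft M k) (S.get c) = true) Ms cs ∧
      (b = true → cs.Nodup ∧ ∀ c ∈ cs, c ∉ used) := by
  induction Ms with
  | nil => exact fun _ => ⟨[], .nil, by simp⟩
  | cons M Ms ih =>
    intro used h
    rw [occurs, force_eq] at h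
    obtain ⟨c, h⟩ := exists_of_anyColor h
    simp only [Bool.cond_false_right, Bool.cond_false_left, Bool.and_eq_true,
      Bool.not_eq_true'] at h
    obtain ⟨hc, hb, h⟩ := h
    obtain ⟨cs, hcs, hcs'⟩ := ih h
    refine ⟨c :: cs, .cons hc hcs, fun hb' => ?_⟩
    obtain ⟨h₁, h₂⟩ := hcs' hb'
    have hu : c ∉ used := by
      intro hu
      rw [hb', Bool.true_and] at hb
      have := List.any_eq_false.1 hb c hu
      exact this (Nat.beq_refl c)
    refine ⟨List.nodup_cons.2 ⟨fun hc => h₂ c hc (List.mem_cons_self ..), h₁⟩, ?_⟩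
    intro e he
    rcases List.mem_cons.1 he with rfl | he
    · exact hu
    · exact fun heu => h₂ e he (List.mem_cons_of_mem _ heu)

theorem testBit_mask {C : List (ℤ × ℤ)} {n : ℕ} :
    (mask C).testBit n = true ↔ ∃ p ∈ C, code p = n := by
  induction C with
  | nil => simp [mask]
  | cons p C ih =>
    have h : mask (p :: C) = mask C ||| 1 <<< code p := rfl
    rw [h, Nat.testBit_or, Bool.or_eq_true, ih]
    have h' : (1 <<< code p).testBit n = true ↔ n = code p := testBit_one_shl _ _
    rw [h']
    simp [or_comm, eq_comm]

theorem point_code_add {p : ℤ × ℤ} (h₁ : 0 ≤ p.1) (h₂ : p.1 < 8) (h₃ : 0 ≤ p.2) {x y : ℕ}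
    (hx : x < 8) : point (code p + (x + 16 * y)) = p + ((x : ℤ), (y : ℤ)) := by
  obtain ⟨u, v⟩ := p
  simp only [point, code, Prod.mk_add_mk, Prod.mk.injEq]
  simp only at h₁ h₂ h₃
  constructor <;> omega

theorem Sound.dead (hB : BadClass B) {b : Bool} {Ms : List ℕ} (h : Sound B b Ms) {S : Masks}
    {x y : ℕ} (hx : x < 8) (hS : occurs b S (x + 16 * y) [] Ms = true) : Dead B S := by
  intro f hf hfS
  obtain ⟨T, rfl, hT, hT'⟩ := h
  obtain ⟨cs, hcs, hb⟩ := occurs_sound hS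
  refine hT _ (hB.place hf 0 (x, y)) cs (fun h => (hb h).1) ?_
  rw [List.forall₂_map_left_iff] at hcs
  rw [List.forall₂_iff_get] at hcs ⊢
  refine ⟨hcs.1, fun i h₁ h₂ p hp => ?_⟩
  have hpT := hT' _ (List.get_mem T ⟨i, h₁⟩) p hp
  have hbit := incl_testBit (hcs.2 i h₁ h₂) (n := code p + (x + 16 * y)) (by
    rw [testBit_shl, Nat.add_sub_cancel, testBit_mask.2 ⟨p, hp, rfl⟩]
    simp)
  have := (hfS _ _ hbit).2
  rw [point_code_add hpT.1 hpT.2.1 hpT.2.2 hx] at this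
  exact this

theorem Matches.disjoint_nb (hB : BadClass B) {f : ℤ × ℤ → Fin 5} (hf : B f) {S : Masks}
    (hS : Matches f S) {v c : ℕ} (hv : window.testBit v = true) (hc : (f (point v) : ℕ) = c) :
    Nat.land (S.get c) (nb (Nat.shiftLeft 1 v)) = 0 := by
  refine Nat.eq_of_testBit_eq fun n => ?_
  rw [Nat.zero_testBit, ← Bool.not_eq_true, testBit_land, Bool.and_eq_true, testBit_nb]
  rintro ⟨hn, v', hv', hnear⟩
  obtain rfl := (testBit_one_shl _ _).1 hv'
  obtain ⟨hn₁, hn₂⟩ := hS _ _ hn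
  obtain ⟨d, hd, hnd⟩ := hnear.exists_dirs hv hn₁
  exact hB.proper hf _ d hd (Fin.ext (by rw [hc, ← hnd, hn₂]))

theorem Matches.set {f : ℤ × ℤ → Fin 5} {S : Masks} (hS : Matches f S) {v c : ℕ}
    (hv : window.testBit v = true) (hc : (f (point v) : ℕ) = c) :
    Matches f (S.set c (Nat.lor (S.get c) (Nat.shiftLeft 1 v))) := by
  intro e n hn
  rw [Masks.get_set (by have := (f (point v)).2; omega)] at hn
  split_ifs at hn with he
  · subst he
    rw [testBit_lor, Bool.or_eq_true, testBit_one_shl] at hn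
    rcases hn with hn | rfl
    · exact hS _ _ hn
    · exact ⟨hv, hc⟩
  · exact hS _ _ hn

theorem reveal_dead (hB : BadClass B) {S : Masks} {v : ℕ} (hv : window.testBit v = true)
    (h : ∀ S' ∈ reveal S v, Dead B S') : Dead B S := by
  have key : ∀ f, B f → Matches f S →
      (S.get (f (point v)) = 0 → ∀ e < (f (point v) : ℕ), S.get e ≠ 0) → False := by
    intro f hf hS hfirst
    refine h _ (mem_reveal (f (point v)).2 ?_) f hf (hS.set hv rfl)
    rw [free, hS.disjoint_nb hB hf hv rfl]
    by_cases hz : S.get (f (point v)) = 0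
    · rw [hz]
      split_ifs with h0
      · rfl
      · have := beq_eq_false_of_ne (hfirst hz (f (point v) - 1) (by omega))
        rw [this]
        rfl
    · rw [beq_eq_false_of_ne hz]
      rfl
  intro f hf hS
  by_cases hz : ∃ e < (f (point v) : ℕ), S.get e = 0
  · by_cases hz' : S.get (f (point v)) = 0
    · classical
      have hfind := Nat.find_spec hz
      have hmin := fun e => Nat.find_min (m := e) hz
      set e := Nat.find hz
      have he : e < 5 := hfind.1.trans (f (point v)).2
      let σ := Equiv.swap (⟨e, he⟩ : Fin 5) (f (point v))
      have hσ : σ (f (point v)) = ⟨e, he⟩ := Equiv.swap_apply_right _ _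
      refine key (σ ∘ f) (hB.recolor hf σ) ?_ ?_
      · intro c n hn
        obtain ⟨h₁, h₂⟩ := hS c n hn
        refine ⟨h₁, ?_⟩
        have : σ (f (point n)) = f (point n) := by
          refine Equiv.swap_apply_of_ne_of_ne ?_ ?_
          · intro hc
            rw [hc] at h₂
            simp only at h₂
            rw [← h₂, hfind.2] at hn
            simp at hn
          · intro hc
            rw [hc] at h₂
            rw [← h₂, hz'] at hn
            simp at hn
        simp only [Function.comp, this, h₂]
      · intro _ e' he'
        simp only [Function.comp, hσ] at he'
        exact fun h0 => hmin e' he' ⟨he'.trans hfind.1, h0⟩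
    · exact key f hf hS fun h0 => absurd h0 hz'
  · push Not at hz
    exact key f hf hS fun _ => hz

theorem flood_subset {m k D : ℕ} {P : ℕ → Prop} (hD : ∀ n, D.testBit n = true → P n)
    (hP : ∀ n n', P n → Near n n' → m.testBit n' = true → P n') :
    ∀ n, (flood m k D).testBit n = true → P n := by
  induction k generalizing D with
  | zero => exact hD
  | succ k ih =>
    rw [flood, force_eq]
    cases Nat.beq (Nat.land (Nat.lor D (nb D)) m) D with
    | true => exact hD
    | false =>
      refine ih fun n hn => ?_
      rw [testBit_land, testBit_lor, Bool.and_eq_true, Bool.or_eq_true, testBit_nb] at hn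
      obtain ⟨hn | ⟨n', hn', hnear⟩, hm⟩ := hn
      · exact hD n hn
      · exact hP n' n (hD n' hn') hnear hm

theorem flood_incl {m k D n : ℕ} (hD : ∀ n, D.testBit n = true → m.testBit n = true)
    (h : (flood m k D).testBit n = true) : m.testBit n = true :=
  flood_subset hD (fun _ _ _ _ h => h) n h

theorem subset_flood {m k D n : ℕ} (hD : ∀ n, D.testBit n = true → m.testBit n = true)
    (h : D.testBit n = true) : (flood m k D).testBit n = true := by
  induction k generalizing D with
  | zero => exact h
  | succ k ih =>
    rw [flood, force_eq]
    cases Nat.beq (Nat.land (Nat.lor D (nb D)) m) D with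
    | true => exact h
    | false =>
      refine ih (fun n hn => ?_) ?_
      · rw [testBit_land, Bool.and_eq_true] at hn
        exact hn.2
      · rw [testBit_land, testBit_lor, h, hD n h]
        rfl

theorem isolated_closed {f : ℤ × ℤ → Fin 5} {S : Masks} (hS : Matches f S) {α β : Fin 5} {E : ℕ}
    (h : isolated S (Nat.lor (S.get α) (S.get β)) E = true) {n : ℕ} (hn : E.testBit n = true)
    {d : ℤ × ℤ} (hd : d ∈ dirs) (hc : f (point n + d) = α ∨ f (point n + d) = β) :
    ∃ n', E.testBit n' = true ∧ point n' = point n + d := by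
  simp only [isolated, force_eq, Bool.and_eq_true] at h
  obtain ⟨⟨hE', hK⟩, hE⟩ := h
  obtain ⟨n', hnear, hn'⟩ :=
    exists_near (incl_testBit (by decide) (incl_testBit hE' hn)) hd
  refine ⟨n', incl_testBit hE ?_, hn'⟩
  have hnb : (nb E).testBit n' = true := testBit_nb.2 ⟨n, hn, hnear⟩
  obtain ⟨c, hc'⟩ := Masks.support_testBit (incl_testBit hK hnb)
  have hcn := (hS c n' hc').2
  rw [hn'] at hcn
  rw [testBit_land, testBit_lor, hnb]
  rcases hc with hc | hc <;> · rw [← hc, hcn, hc']; simp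

theorem move_dead (hB : BadClass B) {S : Masks} {α β i : ℕ}
    (h : ∀ S' ∈ move S α β i, Dead B S') : Dead B S := by
  intro f hf hS
  simp only [move, force_eq] at h
  set m := Nat.lor (S.get α) (S.get β) with hm
  set D := flood m 8 (Nat.shiftLeft 1 i) with hD
  cases hcond : !Nat.beq α β && Nat.ble α 4 && Nat.ble β 4 && incl (Nat.shiftLeft 1 i) m &&
      (isolated S m D || isolated S m (Nat.xor m D)) with
  | false =>
    rw [hcond] at h
    exact h S (List.mem_singleton_self S) f hf hS
  | true =>
    rw [hcond] at h
    simp only [Bool.and_eq_true, Bool.not_eq_true', Bool.or_eq_true] at hcond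
    obtain ⟨⟨⟨⟨hne, hα⟩, hβ⟩, him⟩, hiso⟩ := hcond
    replace hne : α ≠ β := fun h => by simp [h] at hne
    replace hα : α ≤ 4 := Nat.le_of_ble_eq_true hα
    replace hβ : β ≤ 4 := Nat.le_of_ble_eq_true hβ
    replace him : m.testBit i = true := incl_testBit him ((testBit_one_shl _ _).2 rfl)
    obtain ⟨a, rfl⟩ : ∃ a : Fin 5, α = a := ⟨⟨α, by omega⟩, rfl⟩
    obtain ⟨b, rfl⟩ : ∃ b : Fin 5, β = b := ⟨⟨β, by omega⟩, rfl⟩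
    have hmS : ∀ n, m.testBit n = true →
        window.testBit n = true ∧ (f (point n) = a ∨ f (point n) = b) := by
      intro n hn
      rw [testBit_lor, Bool.or_eq_true] at hn
      rcases hn with hn | hn
      · exact ⟨(hS _ _ hn).1, .inl (Fin.ext (hS _ _ hn).2)⟩
      · exact ⟨(hS _ _ hn).1, .inr (Fin.ext (hS _ _ hn).2)⟩
    obtain ⟨C, hiC, hC, hCD, f', hf', hfC, hfC'⟩ := hB.swap hf a b _ (hmS i him).2
    have hDm : ∀ n, D.testBit n = true → m.testBit n = true := fun n =>
      flood_incl fun n hn => (testBit_one_shl _ _).1 hn ▸ him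
    have hDC : ∀ n, D.testBit n = true → point n ∈ C := by
      intro n hn
      refine (flood_subset (P := fun n => m.testBit n = true ∧ point n ∈ C) ?_ ?_ n hn).2
      · intro n hn
        rw [(testBit_one_shl _ _).1 hn]
        exact ⟨him, hiC⟩
      · rintro n n' ⟨hn, hnC⟩ hnear hn'
        obtain ⟨d, hd, hnd⟩ := hnear.exists_dirs (hmS n hn).1 (hmS n' hn').1
        refine ⟨hn', ?_⟩
        rw [hnd]
        exact hC _ hnC d hd (hnd ▸ (hmS n' hn').2)
    have hiD : D.testBit i = true :=
      subset_flood (fun n hn => (testBit_one_shl _ _).1 hn ▸ him) ((testBit_one_shl _ _).2 rfl)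
    have key : ∀ E, isolated S m E = true → ∀ n₀, E.testBit n₀ = true → point n₀ ∈ C →
        ∀ n, window.testBit n = true → point n ∈ C → ∃ n', E.testBit n' = true ∧
          point n' = point n := by
      intro E hE n₀ hn₀ hn₀C n hn hnC
      refine hCD {p | ∃ n', E.testBit n' = true ∧ point n' = p} ?_ _ ⟨n₀, hn₀, rfl⟩ hn₀C _ hnC ?_
      · rintro _ ⟨n, hn, rfl⟩ d hd hc
        exact isolated_closed hS hE hn hd hc
      · rintro _ ⟨n', hn', rfl⟩
        simp only [isolated, force_eq, Bool.and_eq_true] at hE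
        exact short_of_core (incl_testBit hE.1.1 hn') hn
    have hCD' : ∀ n, m.testBit n = true → point n ∈ C → D.testBit n = true := by
      intro n hn hnC
      rcases hiso with hE | hE
      · obtain ⟨n', hn', hnn'⟩ := key D hE i hiD hiC n (hmS n hn).1 hnC
        rwa [← point_injective hnn']
      · by_contra hnD
        have hnE : (Nat.xor m D).testBit n = true := by
          rw [testBit_lxor, hn, Bool.eq_false_iff.2 hnD]
          rfl
        obtain ⟨n', hn', hnn'⟩ := key _ hE n hnE hnC i (hmS i him).1 hiC
        rw [point_injective hnn', testBit_lxor, him, hiD] at hn'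
        cases hn'
    refine h _ (List.mem_singleton_self _) f' hf' fun c n hn => ?_
    rw [Masks.get_set hβ, Masks.get_set hα] at hn
    have hxor : ∀ e e' : Fin 5, (e = a ∧ e' = b ∨ e = b ∧ e' = a) →
        (Nat.xor (S.get e) D).testBit n = true → window.testBit n = true ∧ f' (point n) = e := by
      intro e e' he hn
      have hsw : Equiv.swap a b e' = e := by
        rcases he with ⟨rfl, rfl⟩ | ⟨rfl, rfl⟩ <;> simp
      have hme : (S.get e').testBit n = true ∨ (S.get e).testBit n = true →
          m.testBit n = true := by
        rw [testBit_lor, Bool.or_eq_true]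
        rcases he with ⟨rfl, rfl⟩ | ⟨rfl, rfl⟩ <;> tauto
      rw [testBit_lxor] at hn
      cases hDn : D.testBit n with
      | true =>
        have hn' : (S.get e').testBit n = true := by
          have hmn := hDm n hDn
          rw [testBit_lor, Bool.or_eq_true] at hmn
          rw [hDn, Bool.xor_true, Bool.not_eq_true', ← Bool.not_eq_true] at hn
          rcases he with ⟨rfl, rfl⟩ | ⟨rfl, rfl⟩ <;> tauto
        obtain ⟨h₁, h₂⟩ := hS _ _ hn'
        exact ⟨h₁, by rw [hfC _ (hDC n hDn), Fin.ext h₂, hsw]⟩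
      | false =>
        rw [hDn, Bool.xor_false] at hn
        obtain ⟨h₁, h₂⟩ := hS _ _ hn
        refine ⟨h₁, ?_⟩
        rw [hfC' _ fun hnC => ?_, Fin.ext h₂]
        rw [hCD' n (hme (.inr hn)) hnC] at hDn
        cases hDn
    split_ifs at hn with h₁ h₂
    · subst h₁
      exact ⟨(hxor b a (.inr ⟨rfl, rfl⟩) hn).1, by rw [(hxor b a (.inr ⟨rfl, rfl⟩) hn).2]⟩
    · subst h₂
      exact ⟨(hxor a b (.inl ⟨rfl, rfl⟩) hn).1, by rw [(hxor a b (.inl ⟨rfl, rfl⟩) hn).2]⟩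
    · obtain ⟨h₃, h₄⟩ := hS _ _ hn
      refine ⟨h₃, ?_⟩
      by_cases hnC : point n ∈ C
      · rw [hfC _ hnC, Equiv.swap_apply_of_ne_of_ne, h₄]
        · rintro h
          exact h₂ (by rw [← h₄, h])
        · rintro h
          exact h₁ (by rw [← h₄, h])
      · rw [hfC' _ hnC, h₄]

theorem getD_mem {α : Type*} {l : List α} {n : ℕ} {d : α} (h : l.getD n d ≠ d) :
    l.getD n d ∈ l := by
  by_cases hn : n < l.length
  · rw [List.getD_eq_getElem _ _ hn]
    exact List.getElem_mem hn
  · exact absurd (List.getD_eq_default _ _ (not_lt.1 hn)) h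

theorem expand_dead (hB : BadClass B) {tab : List (Bool × List (List ℕ))}
    (htab : ∀ x ∈ tab, ∀ Ms ∈ x.2, Sound B x.1 Ms) {S : Masks} {t : ℕ}
    (h : ∀ S' ∈ expand tab S t, Dead B S') : Dead B S := by
  have hself : (∀ S' ∈ [S], Dead B S') → Dead B S := fun h => h S (List.mem_singleton_self S)
  simp only [expand, force_eq] at h
  split at h
  · split at h
    · exact hself h
    · rename_i M Ms' hMs
      set x := tab.getD (Nat.mod (Nat.div t 4) 16) (false, [])
      cases hocc : occurs x.1 S (Nat.add (Nat.mod (Nat.div (Nat.div t 4) 256) 8)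
          (Nat.mul 16 (Nat.mod (Nat.div (Nat.div t 4) 2048) 8))) [] (M :: Ms') with
      | false =>
        rw [hocc] at h
        exact hself h
      | true =>
        have hMs' : M :: Ms' ∈ x.2 := hMs ▸ getD_mem fun h => by cases hMs.symm.trans h
        refine Sound.dead hB (htab x (getD_mem fun hx => ?_) _ hMs')
          (Nat.mod_lt _ (by norm_num)) hocc
        change x = _ at hx
        simp [hx] at hMs'
  · cases hv : incl (Nat.shiftLeft 1 (Nat.div t 4)) window with
    | false =>
      rw [hv] at h
      exact hself h
    | true =>
      rw [hv] at h
      exact reveal_dead hB (incl_testBit hv ((testBit_one_shl _ _).2 rfl)) h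
  · exact move_dead hB h
  · exact hself h

theorem runWord_dead (hB : BadClass B) {tab : List (Bool × List (List ℕ))}
    (htab : ∀ x ∈ tab, ∀ Ms ∈ x.2, Sound B x.1 Ms) {k n : ℕ} {st : List Masks}
    (h : ∀ S ∈ runWord tab k n st, Dead B S) : ∀ S ∈ st, Dead B S := by
  induction k generalizing n st with
  | zero => exact h
  | succ k ih =>
    cases st with
    | nil => simp
    | cons S st =>
      simp only [runWord, force_eq] at h
      have := ih h
      simp only [List.append_eq, List.mem_append] at this
      exact List.forall_mem_cons.2
        ⟨expand_dead hB htab fun S' hS' => this S' (.inl hS'), fun S' hS' => this S' (.inr hS')⟩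

theorem run_dead (hB : BadClass B) {tab : List (Bool × List (List ℕ))}
    (htab : ∀ x ∈ tab, ∀ Ms ∈ x.2, Sound B x.1 Ms) {ns : List ℕ} {st : List Masks}
    (h : run tab ns st = true) : ∀ S ∈ st, Dead B S := by
  induction ns generalizing st with
  | nil =>
    rw [run, List.isEmpty_iff] at h
    simp [h]
  | cons n ns ih =>
    refine runWord_dead hB htab (k := 19) (n := n) ?_
    rw [run] at h
    split at h
    · rename_i hw
      simp [hw]
    · rename_i hw
      rw [hw]
      exact ih h

end Soundness

/-! ### The patterns excluded in turn -/

/-- A point and its neighbors, in cyclic order. -/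
def hexagon : List (ℤ × ℤ) := [(4, 4), (3, 4), (3, 5), (4, 5), (5, 4), (5, 3), (4, 3)]

/-- The color classes of a coloring of a point and its neighbors. -/
def ring (l : List ℕ) : List (List (ℤ × ℤ)) :=
  ([0, 1, 2, 3, 4].map fun c => ((hexagon.zip l).filter fun x => x.2 == c).map Prod.fst).filter
    fun C => !C.isEmpty

/-- The colorings of a point and its neighbors, in the order in which they are excluded. -/
def rings : List (List ℕ) :=
  [[4, 0, 1, 0, 1, 0, 1],
   [4, 0, 1, 0, 1, 0, 2],
   [4, 0, 1, 0, 2, 1, 2],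
   [4, 0, 1, 2, 0, 1, 2],
   [4, 0, 1, 0, 2, 3, 2],
   [4, 0, 1, 0, 2, 0, 3],
   [4, 0, 1, 0, 1, 2, 3],
   [4, 0, 1, 0, 2, 1, 3],
   [4, 0, 1, 2, 0, 1, 3]]

/-- The patterns in the order in which they are excluded, each with a flag telling whether its
classes have different colors; the last one occurs in every coloring. -/
def patterns : List (Bool × List (List (ℤ × ℤ))) :=
  templates.map (Prod.mk false) ++ rings.map (fun l => (true, ring l)) ++ [(true, [])]

/-- The translation moving `T` to the corner of the quadrant of points with nonnegative
coordinates. -/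
def toCorner (T : List (List (ℤ × ℤ))) : ℤ × ℤ :=
  (-(T.flatten.foldr (fun p m => min p.1 m) 8), -(T.flatten.foldr (fun p m => min p.2 m) 8))

/-- The images of `T` under the symmetries fixing the origin, moved to the corner. -/
def images (T : List (List (ℤ × ℤ))) : List (List (List (ℤ × ℤ))) :=
  (List.range 12).map fun g => place g (toCorner (place g 0 T)) T

/-- The masks of the images of the patterns in a list. -/
def table (L : List (Bool × List (List (ℤ × ℤ)))) : List (Bool × List (List ℕ)) :=
  L.map fun x => (x.1, (images x.2).map fun T => T.map mask)

/-- The value `k l`, with the entries of `l` evaluated first by means of `F`. -/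
def forceList {α β : Type} (F : α → (α → β) → β) : List α → (List α → β) → β
  | [], k => k []
  | a :: l, k => F a fun a => forceList F l fun l => k (a :: l)

theorem forceList_eq {α β : Type} {F : α → (α → β) → β} (hF : ∀ a k, F a k = k a) (l : List α)
    (k : List α → β) : forceList F l k = k l := by
  induction l generalizing k with
  | nil => rfl
  | cons a l ih => rw [forceList, hF, ih]

/-- The value `k tab`, with `tab` evaluated first. -/
def forceTable {β : Type} (tab : List (Bool × List (List ℕ)))
    (k : List (Bool × List (List ℕ)) → β) : β :=
  forceList (fun x k => match x with
    | (b, l) => forceList (forceList force) l fun l => k (b, l)) tab k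

theorem forceTable_eq {β : Type} (tab : List (Bool × List (List ℕ)))
    (k : List (Bool × List (List ℕ)) → β) : forceTable tab k = k tab :=
  forceList_eq (fun x k => by
    obtain ⟨b, l⟩ := x
    exact forceList_eq (forceList_eq force_eq) l _) tab k

/-- The partial coloring giving the color `i` to the `i`-th class of `T`. -/
def start (T : List (List (ℤ × ℤ))) : Masks :=
  (((((⟨0, 0, 0, 0, 0⟩ : Masks).set 0 (mask (T.getD 0 []))).set 1 (mask (T.getD 1 []))).set 2
    (mask (T.getD 2 []))).set 3 (mask (T.getD 3 []))).set 4 (mask (T.getD 4 []))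

theorem start_get {T : List (List (ℤ × ℤ))} {c : ℕ} :
    (start T).get c = if c ≤ 4 then mask (T.getD c []) else 0 := by
  by_cases hc : c ≤ 4
  · rw [if_pos hc]
    interval_cases c <;> simp [start, Masks.get_set]
  · rw [if_neg hc]
    obtain ⟨c, rfl⟩ : ∃ k, c = k + 5 := ⟨c - 5, by omega⟩
    rfl

theorem exists_perm_fin {n : ℕ} {u : Fin n → Fin 5} (hu : Function.Injective u) :
    ∃ σ : Equiv.Perm (Fin 5), ∀ i, (σ (u i) : ℕ) = i := by
  have hn : n ≤ 5 := by simpa using Fintype.card_le_of_injective u hu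
  have := Equiv.Perm.isMultiplyPretransitive (Fin 5) n
  obtain ⟨σ, hσ⟩ := MulAction.exists_smul_eq (Equiv.Perm (Fin 5)) (⟨u, hu⟩ : Fin n ↪ Fin 5)
    (Fin.castLEEmb hn)
  exact ⟨σ, fun i => congrArg Fin.val (DFunLike.congr_fun hσ i)⟩

/-- The classes of `T` are nonempty and lie in the window. -/
def InWindow (T : List (List (ℤ × ℤ))) : Prop :=
  ∀ C ∈ T, C ≠ [] ∧ ∀ p ∈ C, window.testBit (code p) = true ∧ point (code p) = p

instance (T : List (List (ℤ × ℤ))) : Decidable (InWindow T) :=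
  inferInstanceAs (Decidable (∀ C ∈ T, _))

theorem Dead.excluded {B : (ℤ × ℤ → Fin 5) → Prop} (hB : BadClass B) {T : List (List (ℤ × ℤ))}
    (hT : InWindow T) (h : Dead B (start T)) : Excluded B true T := by
  intro f hf cs hcs hTcs
  rw [List.forall₂_iff_get] at hTcs
  obtain ⟨hlen, hTcs⟩ := hTcs
  have hlt : ∀ i : Fin cs.length, cs.get i < 5 := by
    intro i
    have hi : i < T.length := lt_of_lt_of_eq i.2 hlen.symm
    obtain ⟨p, hp⟩ := List.exists_mem_of_ne_nil _ (hT _ (List.get_mem T ⟨i, hi⟩)).1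
    have := (f p).2
    rwa [hTcs i hi i.2 p hp] at this
  obtain ⟨σ, hσ⟩ := exists_perm_fin (u := fun i => (⟨cs.get i, hlt i⟩ : Fin 5)) fun i j hij =>
    (hcs rfl).injective_get (Fin.mk.inj hij)
  refine h _ (hB.recolor hf σ) fun c n hn => ?_
  rw [start_get] at hn
  split_ifs at hn
  · obtain ⟨p, hp, rfl⟩ := testBit_mask.1 hn
    have hc : c < T.length := by
      by_contra hc
      rw [List.getD_eq_default _ _ (not_lt.1 hc)] at hp
      simp at hp
    rw [List.getD_eq_getElem _ _ hc] at hp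
    obtain ⟨h₁, h₂⟩ := (hT _ (List.getElem_mem hc)).2 p hp
    refine ⟨h₁, ?_⟩
    have hfp : f p = ⟨cs.get ⟨c, hlen ▸ hc⟩, hlt _⟩ := Fin.ext (hTcs c hc (hlen ▸ hc) p hp)
    rw [h₂, Function.comp, hfp]
    exact hσ ⟨c, hlen ▸ hc⟩
  · simp at hn

theorem sound_of_mem_table {B : (ℤ × ℤ → Fin 5) → Prop} (hB : BadClass B)
    {L : List (Bool × List (List (ℤ × ℤ)))} (hL : ∀ x ∈ L, Excluded B x.1 x.2)
    (hL' : ∀ x ∈ L, ∀ T ∈ images x.2, ∀ C ∈ T, ∀ p ∈ C, 0 ≤ p.1 ∧ p.1 < 8 ∧ 0 ≤ p.2) :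
    ∀ y ∈ table L, ∀ Ms ∈ y.2, Sound B y.1 Ms := by
  intro y hy Ms hMs
  obtain ⟨x, hx, rfl⟩ := List.mem_map.1 hy
  obtain ⟨T, hT, rfl⟩ := List.mem_map.1 hMs
  refine ⟨T, rfl, ?_, hL' x hx T hT⟩
  obtain ⟨g, -, rfl⟩ := List.mem_map.1 hT
  exact (hL x hx).place hB g _

/-! ### The searches -/

/-- The search excluding the coloring `4010101` of a point and its neighbors. -/
def search4010101 : List ℕ :=
  [12803786371587296694392921096321165088564592155845460568204128791193296815685334576082321738,
   2039760850044365325370248564900166]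

/-- The search excluding the coloring `4010102` of a point and its neighbors. -/
def search4010102 : List ℕ :=
  [9298453661224435916521105563137602263013734447919100405498386970350287683340739221027160462,
   13275251378797252990497323497316779060878314988500071029572105589406939939384213751545088449,
   13370538689584692875709054684330692267997196915222801949124569604770477321669248370299978895,
   17156427934134696208025486595348387612268585060893847921392202987038550604068615277502743695,
   17420868837106201401142223346437550914908090262909279078860091907856420464268029838533674127,
   164326666002002958314400937760311034319208224017691917812971841064842441093351583467858513,
   193958566468034077391951869111288254384263768628538319050736943827495103167599940131553498,
   76737462580393912385039304840560723414474761517365302185540903328763437497255600941786177,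
   13758661555733136529287659302297806388890073607735080363020957817354379863228677962077260485,
   14072759129711117247852508310312236038651748756622314180425146261987267411929372364118753686,
   17382941225345220218069578785638555142595402282050466280933898959945877382191582874833612417,
   16969361486458359386552444944579257774554950690421193886719132665804394462998709213420978518,
   164120207503514232949709540248878349859045866317666683576861281154382197246741611559937169,
   14068780540759801412442327782156540620723346350987539498697696534253890996217573969060233498,
   108626463524106854392998125967864483201671955562543917700759710541920515394141107620807058,
   10727762981771472198293341911287657791335573834277278184182144196839179785006788067128181066,
   132290485153220534471978672797950651257208361455494085772361974659586624961617156587995939,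
   200138616629177756837181793776319913246725068203073581864817963788712689570211926074886537,
   200129571261489336144708395387437822143749052323799844645845470470837744769687254485827914,
   231963904222235094056782721579152557694785474941820258648256361018573313336896640141361482,
   13348862804327847755282050252374783836612017744949725635589389136323158431374726673287545162,
   16965320754245426443102479354057997816819391826258222791486232956231306303747298237079962767,
   13762629911043879824413352543620012083043974961337627169551947657965940545651114381478265222,
   17508393781609283052408330102478191786029381495197595085151207611341498756458979155057405509,
   9220778183584420509891660201367988146105925]

/-- The search excluding the coloring `4010212` of a point and its neighbors. -/
def search4010212 : List ℕ :=
  [10743807065324071332361621246453336531886140833228311998674621629764482312097897307301347726,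
   170085717630709051307717641708276431437764086862153911078473758184690557705378358272017731,
   17380951931562140364535576789222321704584585329054972317031571354248820378902961403380171034,
   12966712221494890424900000565656666844706604270677701530076486405719735571669061489149936010,
   8706639463107159841041271172092159575875034440141643600717149459134472268891274501303986817,
   10185810391588913736567739776405849337306210283704512334010442929009352868941615475639609601,
   74600142885963732420069285701809713108683616760065590541197139511487956330964854939145283,
   12998735592860061340113961418150504194707251138386197521167183260286506085898526009574182145,
   21071091712469154198610960938108016750990669169847843967469010176324152411412428824655495494,
   74600142996660969730943568526743574776989256667791695881549518733209409002434840182587734,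
   13273274559449635092336829403239134118237942136116097265880705755343041791554869010906631425,
   13368549397545041334280509902609829609269965835044258388392682357329353061725467436536719449,
   162325720034081107899724222899263110768219884815029403166621762299154873894991596163039686,
   8452199871499758615215486902421948648829112671540147387980443919515574217323314016091792709,
   21071252140931950431750110721820037950645264164195794687931581873350635112415019992710023253,
   13559651230386663971745401916580705225959229629095088154612863885405647080437943640990613710,
   14015215416816705559319527408145779481695928265849017941541160736300208132123989184585204038,
   170284165659539845559810314075380011896980391462279259327701977240745873573341713190438031,
   225988737205372112473478630849170784457074436028789790774117242451591722902901816723461251,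
   162325720034081107899724222953499613109182572509465612269817507452474543392313514812572050,
   10747816399537599094799658666052995265535482761630208387421036811573752160711508457363498309,
   9903342828733694838038587673869854190519318957929713991819225983647840505103349800795088257,
   13082090696570184519826384595817500732533982650745618884975850747855029061143534147629678738,
   8579456337976515446804353288728064593235159020210515266965869142283802379883053822299996614,
   9998882984240108823857828108260580550198467365602160616101850369247487216371194348208293057,
   12998735592860061340113950758823423609933403488994377383767649030043954938017243213801848978,
   225988737205372112473492936507093366766855366399285758327180309569612874294139519689228494,
   13336850420472345880746537723845571165033286651933878597836986734714514270031832150745612690,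
   17490494087988781951194538511609068660090922346988526403046702392281347673299535129968731673,
   13273274559449635093256564010812781605838855837058010156506030985938743650983070418006507910,
   12998666430915393970037573536077140666688575644100736331948518623811289349901972811874723929,
   16901532666299957752456875216278712439875511004051623405095797254583130722220114798790661251,
   227777490479456328847145514741601713311715783113112420807196764158109589923735171761111246,
   21071252444946859515153867163343204965045730254993559459823547090926994637969211162501906834,
   10602593886303513114080688370531253358691823450529805047677182751185651521249244152315597891,
   12998539448649605379748147914422897476517447537846039930161909292583600478895312395920442885,
   13056429642487930599074895072677060022226558120379770466032603808819266104136296908782633418,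
   13798394978559573003893585548995648086371215475087890735306767963228219894361416224324871501]

/-- The search excluding the coloring `4012012` of a point and its neighbors. -/
def search4012012 : List ℕ :=
  [14341443358335487128644178717130992815266850630925113206869973790239325572625736430479081870,
   8595448072030758925243598037759307943580622664066955133852950274482853104268438429254680794,
   8595379805015805023212147436924353105122028441065570015769788227730524866450213450979955267,
   76805640131667210508662871296781255854576283224431594413716421025285979189744680241939843,
   140456215008899016799019058427027843171846920359264336969648008557146151593063395214033046,
   8728738953280147254203339316960508700570718176215911022701926556059416668632679801019650951,
   10235542383302210841065874121955232967147550623286807865150882472129707141987627057987350693,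
   72751500618103830673193034184023543250321250889664579746127844789863201409878914647671683,
   8728723413931901194568813517592627532922976169908165282236707014664747281537855778183267435,
   14307595690069035101048095585224474763002408957933922482521166690354317141555298073862952043,
   8708628334274883674828002474533851476117265249277894968918655767212249850591015416417567887,
   8728521294085476581343727611644360849366783258193379645599352986290709193472382212354828325,
   8547656733360508741083654334553164985556367225903280598579056706787327534997425644069342741,
   9694455034000249792412987839262082780288755740514437427096184021271966357232681472658918593,
   72765858155848597991858902551225043421741955184271593430574817058260867101385223634899847,
   8728521230173950156986139268942173924521789350308751841722109971855800137689967877739332715,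
   13495991335250703111337341583362202051904481157337542716365104981986883928801890379492903973,
   8547656732467054411542921138565147576419108159512546653976837053060504576066411186633528199,
   108689207653054532844353597889947426125725859621487601290105261795343151799930101838073185,
   8722685098202959714437997570958475809455382373042056648463815218635467579245831519417336202,
   10267371402344820041132322926271713039160929886567729641237155701324392651751930033325100133,
   108561689678725496189150520250459678479344139323371936359397229914400791847747841559843979,
   6783093454182668573526787529118732918485251278372044874137120924030021122602049945282626659,
   74809547802803561530855650726853115410482514224239859429206988689108690146038573408153697,
   8849868649555259321174204185202233439403852890726679906504782561952328231299660887695512455,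
   76736038391539529809327311459490813331073139143642197458593808466161056182025474336441443,
   8728777806677908086420481745544538488532698843456422449876370562676594454559147579861451919,
   10602598075214344581039382908120251915210640141088963201308791681946679045976760065580159847,
   13495991336906767783664425316292348331324816341350949877993300700982239791885918159300946021,
   10634265756359003114412738924099807688121317029989088369546373601546373144218552737094107526,
   162275300709398462850320062748047626512075245428388773789331777713074290250207819718102053,
   8547752150577146599413400144922580312522512407032612656592419228223606656253858272415908230,
   196100778277686073443183537176679792852611126848017744079587529506939521161683449594997925,
   9694425835498693067304171494635388468333092630616593280068369391382074535947294990628377479,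
   8708628363665664823789762984826035726488711993368373157019578225775232613362331708417048722,
   8708899449220708308096856503051564087443537070321026987337218887782270986792637398434401561,
   162130336861390352089271268944848891673581357996684361800736190338850127048082439539493925,
   8547693780396314105819093302242781282696774084403988676868264253504381035664367483739653223,
   9963009581661569030861436691229074707575560608873270445187090833045702363878202629408837057,
   194166639352395102399068053177962780987292794319167967596634723619478416981908738617590927,
   13945651934508148825661106490447096541740110628752213233207253515413257340093969339922338411,
   10618481611387031258463110505210510494566269714472290026819199815592727300734541744791552282,
   72610333892463668755806189040346115846106236292206114173706605449155973198939474251910181,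
   10267239386510512848090476789541962797103183508094125507792058621239360954861133919877678223,
   13322793746628882984212997297499968624238867986061284012070268189808938107045810895532930375,
   8710835318772250590258392126303858125016838384575480879052407931440480930100206687545682145,
   108573131184763936950405579269175280166237340236901467858575099208149693515209267312936075,
   13768524772819108565887040086720521021426661771352459090848822627553149819835619442801591403,
   13768524469518142597211389707710626319154876329851567004810760330203252105843699461770924651,
   17842598943475561616741061235529320661724798895324141506673870131575237941401974085394563218,
   76790828335789901745593267971385885277307113554231353275132485208458773319219870557667670,
   14341311822685649669666443184418658102270855104058233696062686316762086718694340518970999951,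
   194158868684677846120893909140734263017815408014988513643158530232548578127156536456594575,
   8563560829186436192397820464240542073433277675461903485549802317869671624243361314207126155,
   8563557217036468328684756869409677059040302883091101500053219462210499806544848889046002725,
   13800384271490861104327784254579580183881479801920779613669464694719259983970097446576614437,
   13498115872288975553578299305357720404828648909947345830676042844643550582522435129183961482,
   8728787005949632976698148657308506485734472648081037159879695112627200007794278959903998354,
   17999892635507507533073377189933913245521801654759261835382840317697132411370810622205905345,
   140246811132759284991478348344256353206694001604182890455086560683071011528867178273702218,
   14068907463258351963319730336084416340357565484568328851434250288771290138916080328846165135,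
   17072742573353449217209558652230043107919164758365242566537681630040324217746126580603027610,
   13768524467286299836497272200361929362930270987343846080165550850822128598407134073647858054,
   108418605548136339634054565192143480635162221862855967740333809013082883920297967728280719,
   8722685098525552852547555318126371291407994086537668945189521102379200928468544306694549669,
   8912662574551095483754913536848606276102643649568227604982477064192162329646961390628522305,
   9203126600632360700770713597295847108347175906244034899150223845082412268348162314456858826,
   108419064042112441528483336149320560110950552658641302343946422974934119280514217808315203,
   17365168632406105136766330888458622860720933865675581314370748433397186786934128017187995930,
   200193649751473684722452327635044923674334611135294475224251225617185981769602124417204566,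
   17490491570098284734930330933622819495337810313590557833069463241534514346403786326093943623,
   13259136369193497158203517592913838277531246880226276025332250349334238150884673631793858629,
   10602706819141006975527552387057097018930870116557422576566771645761052579808770889332638863,
   6799039151622969355760920297441279198853854669228120529041555429835357646917474726100429925,
   8728738953280147254203324642795574059598433366797223324346642414298313249011334064103310627,
   10600606293193154989927409315466406573145291140614760596520711351671348033436599522982260901,
   9326437693970695699027432395372321740625504140937447052483748788777012799821663795367274185,
   8547759435585492445181713060313969004308279735672306951951139393816773435812400982550463299,
   210577152566276658937554313461869371889476728833756667159732852471634894829368823409829]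

/-- The search excluding the coloring `4010232` of a point and its neighbors. -/
def search4010232 : List ℕ :=
  [9901211367446948703600887642448516615367387188479197461357668947320421439355364590653931918,
   6939254817220021282388122671058731325497528175463247156573180746653758556844562909598122206,
   17380951933411619988339777629738764661968722482680742316801031564342613111043085246544833669,
   13603493304392134960666692369420143851845476460389227570776448875493516064476333823468568734,
   9696444266237982333705865246583815591280773998859259490639504242225579621536933446363990157,
   130500793824544661262431886818635325906836037113070465712990150962593130810122955313578126,
   225994840819043993109327886518987629712976288969856803013217050834061605835890003674726546,
   9529211703767287170191349526287563444596902454218081405342031264668064579649720315638514122,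
   16981203464826840431073691990901209780695928712365218186751635104896508144669860592798222849,
   14070769837807096464028696430712397589414409993446058071412146794703684853294726224408569177,
   13056423722442753340438366900480734573666505014531682713682940159999298266636493396048937242,
   9398111780409270173585270567560158680782570110371995910673620223253933888635793290608069193,
   8579486847249819716341995650882597691096487941326766955281203395202482966633201229550125382,
   9211067975996382928434291276614747630669660471472282293169019335228610705679373915791905859,
   100462256291327891833731037709681734838085989180063878249778116750524744871527752311898318,
   20900142139160385705860315692047534682647133373138027379753378176866241811746331338366609417,
   130500793824499510174652912376140698855492323275761236377866461896858263897697648862888078,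
   12903246617430410977794369499715360237071439406674172992602665661001269768370917465676906642,
   8579472503562432501501708122853464709021287176716086737478123360277662261367980019706560902,
   227981584572923906455425707248660191068602261316823822090876971149339547416955528733609125,
   229765933598699427690898898310961018234539070832406616559729061755446878093450541377152273,
   14578249881843021410807540852441173438186661524706106041711730169096870183721277775572004485,
   13368676346501253019729303133948022870273846949687197390562692966545913437402403696477274458,
   17094622274662459623047663028356503796557412588827000739371102436463312862435173732489494930,
   12545976821214283582358032755255051194123165055584406691548584727171217649679427826161379469,
   9772035184580772241145687591901096225738138690619966608882513548636699050801774191059110273,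
   8547692140821139235338081555104579600491743056461500410117378012337174170004675205958598810,
   199927416610168843978058314917762815924830772206315153198807848608038512735729980621547201,
   8689924158639921847272296251227065274368713270607128020661654183934910204433395561373534217,
   225981482535927193567703876259589616776753994822971988437648785616499502766453566837686422,
   17581871006629107077289867101491941362684332733907343049640225503988905152144858458570490314,
   172277829610204083216982282049263680010639157787653749259235287666622667721336207958299715,
   14070769833691961510639062198436385507266343618091231049028065930581771768575246394516399207,
   102663289609318134106518946624690519665874586967023843348226467704348871725110478302216474,
   74795218667352054557787598992524192546214690690633924933672694097631446074981895383761763,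
   199926536338824250273805819435838203718943839511323649028100089197079390482530255652323474,
   8563564474794649404983470438802436024010987088581129833073946626048098606573294810770916483,
   13082090696295988611506595164526447092246072582782891875009347151522214302807403840278463525,
   72865937934051179297290268085423009453544782093533999683585587944806883766468562781864390,
   13404564951891367026393265397308285994810696348280660488373418636941348969214245077878394053,
   9803734097653995990026705348186951539472027193182542766812581224088451110090407136685785430,
   108611258505140582230959403662665441465076520749671303659793459985649357729052929297809554,
   170343448464708618786763357235028813041338559303920656938799179866098153958672943385112617,
   140388586133581234655523470640880516723346296506962267307718194985892038702467559650575491,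
   17844457644024769511938876308509076602316853864851725146892173046421516990997983530603577750,
   72758785626449790855607846580085667965022311321972803104443918928770800283100630355935690,
   108614142183452792846986152081493897190996399067357555656329681096894563233716103905758293,
   194212807618025818704793568720939420752899699590245867620627665050278687220460329906696233,
   162262006587443357603881939208903653031508370227176725608964175040656355387790659749635777,
   72610332949485360130641805057419791668385060914874223767550052722578242859381422244980037,
   14070769836745514794144266285769731682159293467615610834315708280524629504239779405564018778,
   172392750658064459540494509588873557397239399020292386360176373229855912835225765714395542,
   17605742976370409581017124531916603761948874076343892644582727482419047847539199646051423079,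
   10618624442133349930075599633410511568208654587942790889187044718104253711860013917642321345,
   202119348630110688518753298692883162933514546133050563751900393548566393857903398904491045,
   132290940472291225724465661544566821789192153075810538248767290516992018774917432062151241,
   74820596735824505500217053414502635659006113296935615605021274585141887687967235245277390,
   227776671234739222166529357160708090537495611836856088979505244642135349738489521100770345,
   8563556763737831004236382550282911546353179460216011194419594899665031498565401523465028046,
   229764993611071328473118383422076811153329314166499427637608238313729424159492672204264547,
   9901341441837325719677610634899119142287723055266575115734953316231927664227207535739956869,
   8724807296991382712041855301672651194140300016870432901330079948330192521048324499053150362,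
   172339082431182425787893952394149857909734059641855209878679225907291361493345682585194005,
   10743992785034670338523352712866374446126807724750304556798180363101976068742969619946488975,
   164119266575559197516119088951284037896166883435849379791475484048956894866598544513264085,
   13888070956367495905869492356855673673330780904993626384590618612262188066001896523855626458,
   10743676839645771036064106217945009282389486329086153613145541109309262894066585716534149450,
   108684743598347726073927213297785734609911715634825259548644797188322187943492869954380833,
   22042190753546457579213848258094941416058473986351018504281708561250628794760517248515899722,
   108737562370258297005654327569794825456077328963357561706998020505075709913214659501621714,
   12893107377814990001756387039789462947741926280415723151078090357231172900079021234803929129,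
   17380951932399085260661621553212220794146533974379504581987163809868020352991478709272528003,
   108628379152225830680531199147582156896884052213673895968303849956392450841697539152085334,
   162326991932024088282223442201689488735283661897616020177868369296581001895213328720620033,
   8547696997467845633056701712978167048476797482281677812038995832785457655249992517939520837,
   227776549523804823596902022376445841929545132608665198139020435186844952960149258640656897,
   14309645420033127241480808291726035844920013117918719596824739929755783950235584318155417857,
   17164119820979176999230494386549792786817893729359889950845868305501116295344813395223407897,
   12893107377815035492051956411837392764748921013031622790212168192614193980586632521420308746,
   21439271094368824538685718292552555326062285704391361797106164004643252145409323152408969622,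
   108614142187170345154955597342290428020344409367931332380509437040169804289740518101418202,
   74857022285148692435952149916379771606417134370254105242014324346696736660130125832220713,
   12998744364291530508249611599556193547198353395474862422816721585596339003847000678998278290,
   9805855350378034450924136841214643955667123702360398398181528995835374442067731154509299918,
   140457885001339822166249807115768696141900466464229838919717064229351761462051461491150217,
   13056430915278556276161053368560369686104563345175627803753297370695103660737264089589940370,
   102709458326998446416627321936025660213482397184712069110915117535224383553437556623697229,
   170299249761032919896339961333445009897095028912307867669398313691196708647116363486545027,
   6655886690695402947935172846834293131718733341793231600146534280609577898849560334216549475,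
   13052379008876381892982271833649242550895201284529685652734768756947054243056979443274638677,
   13052379009086197158680288779757157651425183467829895082334981705481428491550233715289771473,
   13082218161207930854623947781063028910306019093656038426884495618219406068090266195184665411,
   8724672205850117209398347076909100062625076534260938028060119209891321432771392173530218702,
   12893235331387481344622204187136539552630839001895607221718084271332171534193098445094732683,
   13368549397559832407906074074176044783516844509069421463438328226097951651056904268663619734,
   12867247058167917531547891396164829377054987228544233166509600351592515031437829629602300358,
   100460371346760425093635642959638117949431720331864951912085269786155990669165628181774662,
   9996842179484475634195754169068511853268602261143964320198467973610124425514987813587011785,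
   6655765787926723896950304797146403411766024741374538451515831262568176046717342901446004361,
   10743948832152887393287969135635306827647408833926098980525944793520518781397375749099578441,
   8820238415270865518054723718516428169943062696461705687423176895166317878388650564408011221,
   21439271093315157495695218218703055344178521538655843273108500026523235533451921432183408789,
   9931200882774406669877996693170854077349986652787950504422832962197624006822492697338407565,
   21240308774076141450869627204633861331869615682679653774115418314587351335019656467188089054,
   74856384376339140134244096706285970542049749976341810909803739924328336776955177306515597,
   5930580282036797126283870692835683875719515913704415919829459356858585707377438523201224922,
   10759721406390972663223235110913850860530257704859201327114239672452294447324638844135287873,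
   14015068269208140175499816213591663660308324803769176170923642341302034049996319265771382425,
   140396324197152301788605586176668452213530674951937296327654115551222413340968246529578051,
   78728242882305444259943164381790168116904720479016981769983600868488317694636327647379614,
   20900219101610285044973169048286479943922047927391402000933468843958835780399750093994020569,
   12954906080847200135188963450349628137725562008569631563771681369190952185271892769534706058,
   21075230486864309112307743655986859680152878937340286602983741522020324377795497161923848917,
   17482598778063251068996356743070715823824300597344129854874782091321591525172355485287148825,
   8689730017733969886637591850786873226792035797116254502814962067544891888206315598483899171,
   8722553806672271204863249988348900578942895932431838965236434675324127629253899458264058921,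
   12954906080847214694008788722611423599505419677493763827017919748376511606321553926593537729,
   17094622274662459623027604828036143720550180329602258134149916401012942675842699319246678741,
   17329231167454069059010227327533646461143437313336411123849037796105128322162421940801857677,
   2300676385]

/-- The search excluding the coloring `4010203` of a point and its neighbors. -/
def search4010203 : List ℕ :=
  [100662340627600015101938665125630579331164069980387460326537013061619827756537304526225738,
   13245211288219821472604009182520633748322974914971970294282455186662969212393002106193799177,
   74746745134391330033545866751317819443175481470192354897221104233246298943589437967564942,
   13277041952398946910292509664149260671501338529654148166471687486330897542221175878419563655,
   108681708170729516465210693707084101441143775526232508786159087974431502074950057904898454,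
   8820030223419999065982104928253930217495728894988267055311135892472393267833250248530488005,
   140511006430229008604367909951482018387907690487344262363587976244090899656114578503329861,
   76855026920412491102815774813557109416879522281678806608564729234990692659173609470323969,
   13758665076665335957231394165039042316601355194788558918988546694271426398432748830439571614,
   74747291658661116875955448355725979498447862456249297696804980618570316322481820797659845,
   202120651854674706643969736990069399805012484776421722209107283455567616379293699040953479,
   10271217942124479933110851388603800485968668079388510486484388275768420488355826842977529033,
   76855026920412491868656854066684651170871150004165600376695778935967780359078934862712997,
   20965658641790274080083079952647567945230960784055408422422307509299879449034745795527462609,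
   140512401916656604828093606869117010690087543889182276477696033957997409805458797696730247,
   13410514206039075426035082441018567226113377791207430794334298496365450693446764860309932169,
   8728522751913871398681421289518091935405385008211460716257066992391948898296751047617889419,
   10714830815420212028630133089286579950182884580253932155082812340204900309351737249225476449,
   230029188983990604247980048650163072484172555807786522192671210668557328220624064649494814,
   74599658371531140501578816953786171355397653065640499460435999287698520256989756430641225,
   17490554310711984802193130213982018107792415420546660406317262940126168623162310208095601799,
   8724544617342293130241253733007394601006052184029844577361584437215334859296705961710154917,
   12803791835406577289619521257555181451439705356716117745445867069989921863325551973436650113,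
   10743892224496341391834166538202707078656476359125987785597593833852985929883896308812825739,
   226111428887584601903932760671937106926993645668177848499090167162906998864005042823848995,
   16806208308315261535304156900403083432560523594667787526998726177055278327864397966596505990,
   9718194500983101062885220681841879910790711399201830768228417316475866478334065950540778849,
   10743996885308206242349141968367489035489121188749373144495102439587905441269813600991527747,
   10743865342928768787166963262444222616970134122867081820721746815977777950336014545527718691,
   8547693264452507095433065647742948937127762080344646159371919688378799125421442677157897797,
   8920690912127382968225450991986513034036560008272887944796631811154816007399384295804064579,
   8547688862571116090053469381808631267631679003532626514648959682293487629993064351402968409,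
   9807852583430619504655159349379482185375378903039565294591748495778182106095262068562937289,
   10743892282253831048488468624213885129625313202915409426250324995123176946906471581201026505,
   14492660370911505468632185716177543869955143917906571185497525081863144191367156445319163353,
   10743883815782569557582309835005339829152003843237671463780968598727781774160139369928609489,
   13824359520303236275360737958158450874936318033006783332342229852128639844402618017197146915,
   10727760673437244742865235398273872639354786678353388179019805145555934812927899223976640730,
   13849957891751496512751152927147290603944811401314635425856807556217891546544491916415313961,
   13344807591732681749308444287938636333204740312843997292437249010211661708853113287757595090,
   8579491199771301844964490687884689227345097760509518884435343944289901241247603060226288657,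
   20900213030766350771964306992690536232117877693971779820292986572611990902422239085886081221,
   231963961752955558095958708299409661747879860825613793975145329094327281065539106614445525,
   102645350260501886770005209180584095660330002514051869998635606434992174135607638156247386,
   12782903165670805120411058880913796098756417810816392623525070719219676334813812772164420419,
   13822257827121792920023214870585237560118809960943066229453432932778970764029561796015327569,
   132548460377621376280746246451208827506751115946285217995177334429402923802147437393366281,
   17156292814357536586727123856077870084624008843299938917444474243901897207310292228282147985,
   200188424828586045184100733568952044639421198087932566706657499887915051378679685984643477,
   162399693248018916122731638983941125210028715434489478921627310670519152754560984303600078,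
   108419063802698519337651874242344246202868726704480227699126695440873548025978021371864393,
   202232144805087515369734146169298923649424382273021294866346234221098427043023078372540698,
   14068938815146790068267935943969224650708214177704327998555379123634741272081240606981123273,
   102449727245235551615747962574509151189642803228237140760397575877913937473969072018620870,
   225787711867057293506361304289584782711556185543376169350742983904590661625896409301667405,
   12547966026277290329487909773382195683542466662527465860079995100733236827722752747104719499,
   130503707827897431925512542275184836453746146520270784259633736210921353091022634504514137,
   10727761672606851183477802332407487294469367558051106549508029995772447937377494612089857125,
   17381142925534811864127217308786556665781644050510872610581046056521149594071869837561400009,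
   10602437039603602838499321659874225141191021703487958852620153414818124629218742192311987281,
   194155864123379523783671241250037354868213287181798160215670868544177689015897049711143969,
   13750651915435312843625102316474020115331137759529957954322135174272506763634301232388833734,
   21041412744769103988132148339310558234329357493571557842255084934126072838445063367367419153,
   225988921746058084165163815177752949628324556120696691126937738514587360055234620324795491,
   132290581153960914179328725831208231570318995471062253026703656818233756472999485334814926,
   12803790893348814684082168346553650444813750068601550525966373568002797611764437514478747974,
   13370696991227477355365700279255854560887147374512697858878095923707754700433419546831290758,
   10872979602318462136995646599458382788968892934225521703400477969259401853583050785043972550,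
   8820029286498834990448617418643210402979343415516696487768398268532791970939840885731185763,
   140525210564285136599646367500704597750624945795059411977782590387328955195265139316190849,
   10602437041421096266503907119924210037026498513977609006755591574632617861481109510742999506,
   194152825759856579642239572727595026709541415742827738767706656552168395063857923687345345,
   10743676471497463629717769720216297946198703088205093410960298727557756411735740429737198022,
   20929979071607153482420553042483108976602598278897627898358304141541951174478660946189263905,
   172285173383826369349711640463092931351046361069026251512191857928420011998902102782288997,
   17387081603608637404294809843846012330649785992760136049046543043965808563648763643096072474,
   102450608404510213272529039595609890172214372211034982816331768574532330172140465053565146,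
   9296464400423605047531420762252597233176093341594391550906133415273890980811278818948481350,
   44915820004977384000705883040006513246744273802417944038993662773034124375408055631413390,
   140247747998332269992982709716994915922786439125527877178365442260724361422914730937691209,
   20959820929303465240270593091272412433020942378647339729672120719545642405854741405243443337,
   225788228162677698574477851022212472506010846817280536423049717241232639757921309089412203,
   13476129520349853447167634818475011605297696677165685183170870958809074635181038117267792523,
   17844457644863086989770536243932541728903507158850404469611983832783724730264052241729388998,
   198132838306013521106789287504423214794041644843043387633809959223291806802975668155384070,
   42856043355352878258849168063780817110252910455957160955192348632382558067388854567501970,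
   40920903188084725324515261238015616473153730939685121198579175846621247048360421466714153,
   9429902613927895911816306618338386415184742796628531987385506174726945173846467021648249667,
   227777487522766347542387360486009455598664374739061109873898902558831217215400145777721606,
   17999892700337992893851330948991190115562090914934659331765412678821713843878928648602780050,
   227988775538723122991193419765392025134638550082652770612721703714693168028453106589788625,
   16826128498797020653982914425940377815314318346795739749990700100902492881560038496323436998,
   100460860132888433234127472122772573182187764077314322268118149883376949622847520855380807,
   20944099986693145851658344658091556193986993354254770081665865493283783008586686003604253065,
   231963961753029813377751921634208310952188784811312599956210909632046152255017114286320081,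
   14072759126621915618322936874501009698788594564773540464369088520410455141662414552196014955,
   227978214254526025944185807362737134743608259911021573349287102540728965505129711193883082,
   16891714153947555931453562181904794982392047708094925199638526219602887052804188987083543367,
   8563409461728888139598462396514536501303748038304626573302258933709161551847053755809892389,
   10205710167883509317665441118749696011938749058993498764348908738768018526775209895201286293,
   44846640400219213660609699419802599871535296409600855888968463698276613573601283790685319,
   72688850902401431449356090892728663073923823493705827063560235827055623698327876274826313,
   130503707827898753064687439119878337762841928831263571710891650655879665730119800220961033,
   8455990433930558883189307127838045283509060141116144516348501636339377876653138510516282409,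
   130299767591404556031169865324087148870550038725362980961051526914303790893363833319539523,
   197937638005199730940325128609474809045719193207674295942541415900575069089953231887746191,
   70621889848273390098747128600565604830222374751781704544148629128186537327442860231967879,
   42770420609785493601748802700656248792473028060966327627418257006228805432207062581985931,
   195948317713995391529733004583598224262452275731130556540059873061884515173185818652131979,
   72753567667530050509907394892371272521581576674308695922559179888084766775616501107720590,
   42856045187183284747724848720068717865858069158475774442254041660647611774166981053334087,
   12835418399748097185501829557746408865601168303777220106759350217530807372338125473789444178,
   12782979200924445319339506213071362329452635118417394263260613903031038111898540550906511758,
   200122103316725074313210625619615909957124237371600668364274142367480644294206242946116049,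
   16871852578541055251685824409118674362866150650989927912386436049755503238410605230723498446,
   8986266823215168318219395561721635284019701102456974771354428257831136300298156181719417294,
   13472263807670572440303171621461415271998400858400083979909071290167563456286646216897423701,
   17369144701894350692475833943828724486809381653692141719443523016975308295589444446321770954,
   13380696408868395451437778572207549450138035265052126824109570032869935356931646606726555221,
   9179224005739717174707409042285419137359521635614241941013153591733526028898448317089162965,
   8724543190658717513401820700659282675009870304583932801977038524675563189080087915595170186,
   225788224932255092246386376007527209955405072213413801406586793933901326809780257791627305,
   13472193324328722622760979697349692779154305330701543093518080513735091189390477046790121113,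
   4650470239329643651569578062228150603126379643447073430394434173513952406487990916902093142,
   17337188366098073015490622202982992029594627044733598857061323686942589884224571805008815313,
   12867438675640379169890731436931026605726177151942552148584530358324968134903405338359055171,
   8455988976921928971797334544175527810259763505610169520982159198101990817856870607859089810,
   227777487524155852613231753573172467762243247346002330721327480520936548581402624087255381,
   130563720054581632341067814257519233225820711668697991511847167950676298718127232335635729,
   130503707827837976433194128592504015907309450584735191820691906445196713752769850996122665,
   229766388814529349084923281544715830909938842986872553134085290153475672688543802725843563,
   17337188364770238287295847933722579375467806564317118989169771506869901753581660388657294985,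
   13766566287417514995156629014898716873636095077703199023463997579895522737838857318147686854,
   13326903952737794588004709452077514897503982577574296214213345996251466741461423940345111661,
   5220505241839645755164894325816342352275376943052471272126736712700091012171212402326588501,
   9461723471560433644233870107089400394060004517502183170025378321662355435168079586374271811,
   10271360690106045355948996383501919198834109558064364622468478446246955834836073180607938954,
   12835674765508212656737188635871889659381789945157428725930070820098077036528189779852460122,
   5638154214165162680193351112215691443842310748245127270183435974829820519208500109717143950,
   5638154216318766143410512854462201650077830465740286306531996988988770092925554497964343514,
   10618612965085549455031870013323443629428665901486723141106210124623121913233905169997311449,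
   74599595661826537503023466314823738185841267728672464650087238544371660182718922173080729,
   13084178827118117877908385615736895287818857761746435185008142804297809514276421667998483599,
   5622343145195364154639883446449291164262804570418696759122528214103568603173163426519592045,
   9935027492774569485330368284806805853998897793458499586265815327269618019925260793677021642,
   9187126992081111605599266513779693419333780530935509292757237462374623229438897178152468574,
   8728521260527657679287866717601121714715570316582045414315020019349451307989176768149009699,
   132291004250442228318428386963676813740846947346530957466367481228898676174318752341780653,
   8920647247402728780196519031295437286468435108802619953687447360212676667969303443631636686,
   8438085340388434598553249337547882066430115356546906878357690412609232488636331914733700625,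
   9758128179514138660219201225716338896779929871495195507115192836578263578738397531303529637,
   8563665279970495871618829905160294147247116639780233278371607933523778427071481610662660437,
   170085626503261151217431819390060171870608318443819056809988690140793591144926303782078549,
   10584661110134386236985537497473529564231089097380093379473443239604323314990219375666659610,
   12891217411397665145265825712899824615046474573941892835339800905881084621079948832842009173,
   5737619347105976450847234429994815122848566553730986386081918543280880409953323562244131409,
   170406066195904445035015961975601713823698590504192300385926972495426441516148419233120346,
   229765930552093866489699020154516186992696582043029596572850395360423714286366759064240534,
   102662776006612015836841670251871692414108746150869627830191190856383904690100787570436377,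
   21980198619071272482819209253586711097179652882487972127790635317782358343121317956357521558,
   10618675100143370186542719115119001904188091716053303092978757850768145994458934443809025197,
   9758128179514138659308730044039932392728763287441713633824597395009034021681914319085659205,
   8471903323569265068219780284162169610622615470403984071327767262070088385618432411921678490,
   14068911621069705978988509263263010595861110464110395939352479976746103150571975127958005801,
   76589467931480206980457500770991681546198856020523653235629285113734880975978902786998490,
   21409397275190677394247334515721972792718041575557991075934434762720694011494439421245214021,
   17317453924136398057027750005919418551348065407007234589490254195950168492590605204218659651,
   12751867097015567622378660194167299565989667628158467160613694452426472543142288821248917766,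
   13505969429538519256546168998582315504225110362658298523288738040097793233290778806178759491,
   8471904810777877762223150063863726098136957656557916587061730724867785264830099926772175687,
   12742118410674748023776367866858207165089747043687056831412017128552624098075490595208579665,
   44904343737158839770210219287029499512588755318038727246855736556268115862867160318476550,
   5323932796208674276269361757792451674904360827516753473497992121309417930041890900295429193,
   17164313077389009765362179497323504731743663269517934600772733245962841246268044415519509189,
   14072759126644592845976517848145524616851020884550121504348532239180634105362917463559832014,
   225785887657801901440556039515387959639686735739206604270864831514167734285433136504465689,
   14072759126644547836265723050817414207031901261745364740881741144026080018534952249454625226,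
   100460373405951177089283168438401252704751189977258211202565286178411336015883237912897817,
   13082189566585377948815911277870170492042556691136487863890064367931758599778457609665184006,
   102706152908293457248459445597151435101083427134231566955643116421501372607546993020652113,
   230020081563089220806984548924167915685718791183636884382718204653825967308946882518384786,
   21918530537777689169880770199506586069141656068922598105829770565268073379780937998943103017,
   231755257987512038306457329726624125720067317612936195897495568848095483052023376723661923,
   17005134931671021288028281064888480341511419645942905212940778079873036858510937474083153039,
   13472184203887927580263277337026357901538445951625493506101093187394349873805597912865532233,
   8547814377156973821979348304681961801132263180422278625237240886697309753308645479444802577,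
   10744008326394669360788811302395279684810937356887300077939570191904318773254260089189263001,
   102770106044189108178402987949964171164508780528680156800707183033218981330520611143190701,
   12803844287339765975572444789930754739161102600328985488632553749610942794633477677468156106,
   13028581844115654087281099465819877166005042111306152191908901878985999512883054076687155590,
   14313461724550785202473846941260542244765572846577535319568178204191429338672571506830147986,
   12530062480692044874450340112455255785889607986219163557041211143020847541979302754925281434,
   8438283000889663510959853843988866144412757133253513287000155657473509202788902423509423203,
   229967508445333702089616496911842660938442609604468631951938404251347813889530004308583569,
   130497488321506978267296392637581552292554415886369327126208609671440139989240535368232585,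
   72610270115271562209379325614945292119218732734866840956474936549491163261714363998077210,
   13531866101753875590331858496126727147478693026861701176937946543369102566917313672698986646,
   51306613740327867975078366565829680565525133906569681]

/-- The search excluding the coloring `4010123` of a point and its neighbors. -/
def search4010123 : List ℕ :=
  [16825940020924462534693490925029046469135783724054804088584123719473797422688796099369107786,
   108573193900238069600338805821219110604649012141954528671417784795589620101147445852045518,
   14015068269185445830659208463101757838350418211607138920728683065704560799935101316755685530,
   8595370681527245869626666141846991422576036843241381827132444062524205976565585470300701475,
   229766815651460506667669951787102252492936973772332716184215710212166701824393704899183657,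
   13442407807606061181647479378537028523138702367218305572383647837326366196150102972932383375,
   13442476863373558769317225576438237544148712260169242404036778140619058899518513620789887434,
   10602637612002231603602353084259207375941110812870544422757605341773231992506463563920280661,
   8728521778815264583481152787164126467319422814096055264457381669334561298202910454417368193,
   13352764732713106401445024500598782211910744319045437219678825477802777299444868620671861867,
   17866470367840322401416611139162144129608562748093755967512489571631333072679217029621830723,
   5652209736745368608666383335241439621491392385889466603468495685027862622987574389263106510,
   13529811802839249392025637688730712748194547124885825756687146105116545481617310560941319307,
   9845641237197072710573446736855873368333149367051282956620096106541183957519557289444462633,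
   74863029961697589135468715447881574515807156687245330790348471076288302946014942447355011,
   9845509283917299678362345026317092010909868227375333082978311632157760231033533231191949654,
   198199680210018089749469645557171160519010448345863381017426498585441332939190105129222362,
   10743831484820331770815459369323662938112995979240149206124317189745514272969474161784555565,
   12548228882906662317070303175126025770545781574554058701088718932096473296404934837662077333,
   13856053360087832720275115565286220720282715846961573419314559150970006324169899596757560321,
   13400538299939151870224870678076414416554016185904987733144435275238884329117690105493013831,
   232027584159239358537181704658693043471257888874692676247543208490546309919771051881230377,
   17866555160569599008054219923382394987685403434087441919225143143897274588131856106585260494,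
   10618558390657549936360229563209335323052084470279359519220034243523098467771104474318849351,
   13750701286547636712606065320265531796347052240074341904762910347032928142094660673608176675,
   17337188367116100544041925620683211972816599085522983917197511200281274353155107614484153187,
   108418609678556195333767985471276877016653135977245558208634577421654877593051180932350819,
   229766810794790218494384205741531494244381920042265075430948796070322717868196061250977946,
   8820292934594801518071885397198731831943322702688789120805306428617412261964285783544562130,
   13539758299957387159561991402603687735076904835816832351953002865385972849280242236758002133,
   70764638023496533944705035516095414922880662578701554905569934856753717150327912434058567,
   132289121548856056249554968159339868449156395251143239876274593726591425294160415277794147,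
   9696459096301557155137966080076788819167667003753158452651482883550606201474477988089495758,
   10205701048493881568226024010079892118685135969405138195722994762264568620438125553231462606,
   202056576141069420975977691686608721653716984445906582406354208596309346804676370260445441,
   170302499983243909693849782415151615501402270607973916861165515873411928200511313219382337,
   13531801099107109932521241108461824667106117924147863737696436469114273228827852501547614490,
   13846107197673098952312056116834254991399955436603762958620853820654782851557901935900754126,
   10602691761469984154215098804898916505111963040510184774078285734898963590593012821285732498,
   227777490562826526393696165022579755386610120077521063566415292578379747506073404473164935,
   10743942002464043816355441197434100506807995240667979844110879351435114797630735747075604942,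
   10618351926548251270338342585321438850987621513372701234296779000286177916874830734694630531,
   13535779654409366816116457923622308725606306029513842332068961926391950377784969703580723329,
   72610333090753285419856797783130103096103266427179692355475026073384834316376224679150435,
   9712358609838800348092108840764801688772508067774996112927130326794981350772338907784609998,
   10281296452970790785249445022001509687312519824097136877661161892198581070483475456953320965,
   8724545016759152781023360034375873164406600416460217792155037073394265200383313781990508801,
   162326661214399128266008778292017636181492291450414565993900880687403710931633069655149641,
   172348767764991832339854867324430668934802210996146463820939788802389953927967699810713990,
   76790160541945411975199544897280850914153086256862390669508439416156215648912404592787918,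
   9972823970796084100652963078514053104566402114793650487835707009612299071255434584676257109,
   13836160430534639640466458261469996169577303942261037762885365258993996620771651163872886986,
   6207174432331721563331234879555245964120995915468352869001039731144879140951415173703427733,
   9294621982199972837354534311182590260821638163115762097416359940799854741487058812772876382,
   100665226214761386286780130716265789243449732808878316696395170876790371594795549684007118,
   8724703316687225447793278386662794602136471839857016975842018703524095673393463505296712741,
   70816359580804275508989573038993423485472852180870630257855133174724086082604984489429329,
   10602437038715247805836348273713755489568383238935736544346699363579330291395025209950077014,
   193957202804349853097308833276686487062444000879594216751791975820414121407531927977936007,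
   13836160671822442293739269665792980670551401635209822695410908220904239013342100023889232198,
   70621435782131744028411314962582813738467900184076248113317194843641485368513032184353607,
   194161144804681019040693291860352280876908970028487191083523244885512023534748263822870573,
   14279775273698980966473893247793450103990209624857498548793667281443812439887106167909090345,
   8692845977614202942498842758671309997068959653539670102650535550970196422579775841689534790,
   9294678471134290567440413111984654036085436924351865476163261045264015478466306620566760009,
   9306538751081535790262662260216221893540389620290202015423611546457172737013317798313197774,
   9845638537911954245734249340677321436412714161165343285354559027903735501861442404176970595,
   194218000125480772849332191787173573115224834311016257226449843580410007267251703711617137,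
   8563550300297314906349552106848297785927933506989140261037591951684781459741344254443258118,
   8547636774724342429292357483516403678889994893946944275405137616134668884005999250260782253,
   193958536098035294353946832585260789381006448481413755842051429581650400636257535712905537,
   228034400938552452425653091892051681009641331043167006420815771674870230013633468336276653,
   162326661212083286528497924803446901286382026510399490314106486401438793544566406184522379,
   196218583277380893649836961783964450865846249780670463441819665050445264640736939601101190,
   201915859646091666469109417139908736749495434186015737875978055308552749773550920429273486,
   17866544718720597947904873545754212786098843928451044205801928690461205780411718733566283817,
   162279548286870789049820742566502972875962519576642598231766220648901813318730237995253914,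
   225787712792990344691853790437104346457151698680485504464474204121525859999691194644202709,
   9845660681181018533975588277547356417261649534745574736131934435841546481123638550318481866,
   202117739858299152152939928689029159263178704705311434781225383391111905157750933898002582,
   8547696812894248693389723979118553902325939586922309213727577216528921524492880834445509070,
   10313155389585049808865613415235902098119231634600679504702459828705297583436032967447760937,
   8710749642034473149111808269397949193245969091949103515230959109817999192164755726189023273,
   194111788839348728473406850551775915011688864019263703856124808380868204141389098485770565,
   16871948843894761057894141010472663327051064536658611301064065517797418479427003100308788071,
   228030788621108693289419259955497457000687510973262701998272461040697270353851521004077446,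
   17826554917395268570351041660405813743762409574549337316702306182159981924464374091807806279,
   8547658401949982231817213465915515287140017424634451863863925672551653907545311539030589706,
   17878407610800128511727475744998363047078318998204421339379964309735857270640028949103987753,
   227987898190052732016413663231504181430072646388151270998631496988983437357852508154121557,
   74748716010847186530291935569726528560641017938813788836077322390053906726562041280414855,
   18353847168110750584511234323932167268728436857403612680491919028033639446727481286019470151,
   12545976790872987639304044647407681378376346916514769228539719546120615850443869174869983382,
   16911479131910922476833546369710356730888570791438601839689017403884170807756887042747223489,
   13496054075888445573252387625967331939992555107785085682635666299723116288350978301959422819,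
   18184757269370837265170002360581012996689608489546207535920617072634455455454405579640275398,
   194213507708299071340529945929323821484720285220057308982422497118125209653154200628319299,
   9845638539548358218189417795889161552725320661319610619330953829326167278714197452014617030,
   8728651036228024590888776809794662814007872632004672956255935390574355113248986016647564553,
   17452567844324226568226119537715586053843835956387354084478887278564124707659647798439465601,
   72610755788004023943967723478836896019713442198201617308225401512852782303033709418595459,
   17643676826477208161061703049253888206617929963978419477350514582892387227950820235478647951,
   8547642420194984371602892286385903017126009712282711704537785305665525110191595618550760579,
   108418605532450452637576085506349708128219303751853844294302496160307208772352275349655593,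
   8726531969857416511679844367354757004537267371533550925391789260120375276456826985530917014,
   9209196304557448864863130708312699686322876144573716525632854504440954244723874149596227621,
   9899410462081512301667252336571383043335042893425897672517754514394973274384564963651699523,
   17452567845287613920642614040045225289672864394733747581737689132437067366097070842394050822,
   9972823970741431195012026808843989181091324460968723001559108067984666195694714435505837123,
   76589341673772318160225579837381123244419988199301394992693402362811495125341521642342657,
   8820029282404041377989694105721390235687772159285911474380619674430124339560522148056812885,
   13412443278196361538086218093485158299635075564651651444054514399565912279085821986304111617,
   72811541235101895960446063936511271055810567849222974554081960297139306132467702426580331,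
   9996827531384125086153810110555175027103933310782429355865272872429021712267261173862649429,
   9708408921139382056210053650651015196833995609828056109131430673090102032087046581844529193,
   10728016157071612828245617592275093419341998409579024469164705314117791150939049351625392995,
   108621001767507567006093059523948068452267831330623951238255461180248508572743309653338645,
   13082189535355788948969692028788311501204890948284383096581506107401274679103429883662237850,
   10718909379490759378012947593097120011269514509112806044677561817965288450556175565644186435,
   100661705630858231156689906891763643378204812115585171262301951483347262066155592022360286,
   108564419521109729032714925078046130415280809537500319955473998506775281624758649066505945,
   13265264707920420106111435908097558400847237226911605148079164822182259624160771967269142682,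
   10602437586875462257563701796724576756268708721307586154899680166198263606414876502391128206,
   10185679347256243277001979733814737339920272462647242789885781883422918522349303921145103139,
   16871893117471913754669110653488342353240369932975469184204131961115366093815655559548240026,
   8456181566718780084952375248171995611953244089594194868766840949189530335667149090516500686,
   13507929612771165245890580680270578449308417809918444318500278223699545317794558184765680129,
   17516354896290025913155833947856154795054067622355543940900504847550626500865750196954420071,
   10545949410139003751564360209569178011570222625761368384867557320385955355044716297388905539,
   9867520759333450781067466947304349116108431422446008390200680868140432421549088473195937942,
   100461282000191190963366253958063188160691796432193849714351761520366961130365932230553153,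
   8579526170265294900070051409061979991444395857717217739732230415820041797559495524856063017,
   13261257255185409892068149887948877816452056246127592226977777229869994755220270528913818767,
   100670416808205253122569204286196362014976894262859463929766788894069875750704208234041985,
   21409271510168238878867472234720143415002546068717683411519092113895170743870110781654778475,
   12986763457658623366218857898995994664506775256944928380900238359092945620422648038064739143,
   193958539154861296525096764648009535364907679231806409624017990024577803833491900366489097,
   10205701046774600514410585928567837940105531121773947512372725080059662511405151351081370797,
   100461282000191190963366253958062154618096572738816589948224132814226911780626268550529414,
   10504094989443066801536685194676710466933065891327546457672348898023877616950869649542308905,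
   100461281992720199154306371313141878922131108131786987703884208713308677102055547859977059,
   8692845977617956755694925020626676743882071266941088634823159918010694177241590166850716267,
   102590411376659018384351292596231763346678217843600860027726805178550138842773298304420225,
   194108723539750969706742965222295394500175599646823483266650317723254725697869743563892777,
   9326303821054762486381321308831360603950520928726364071575830957437182231615896842800432169,
   100604548228600921696744133960607778779032585945209625745041479251413237074502452370425159,
   12752027127945471598415115082393640245638478998370399849032677985729001930724702045258802761,
   8726532000295481633308376431289782199999330885280538484708584280119573140095814632576017449,
   8728521778923645031977254024866588252640088007784130750476059722168512785920536750202637957,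
   13836160429544818222709202104260447230025206569120189732984909058843186222723897829217354859,
   14279775273714230695932665957072228880568202927698977175460872721178215997166631950021380437,
   194214112887084856094457636506097442289996757990536405078539336947456576889109466732130345,
   8726532969279005456034400234947374292557114454188627540676085162041674243066047270041650217,
   9712358609818347264793589405040983153791281764024487202299503090043220796277745760172983687,
   8471902865158300608368124091207492030777871570133412174480204853517138417275918691556982986,
   12954976004199097584865815396308989510653897422817152714399473352121840313765436881921222697,
   10743822074991947595203371562669783835458825216114659317467391820020307394409837182312678549,
   16879845645050534229615484055629691115372600246245764965087905842647162345193862972320072835,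
   70620552195942245398616168599854658218805188711954736524645238247826766296913041447094933,
   8579417865315958884836961039943437917259476381169251097722201858109420692723072657172660426,
   17420870233431391704325966004379537265090108568534380891770054401374860837149274418654171177,
   14279775002525567816143033150066094558165978732150078724729892476905985859221569204399046810,
   229766813897867938121924664682372991354808537121042386625311618255863378434153305126552419,
   8820110654421217388227680786551503157359962979235850433373877858036416882053677175810795561,
   10271349991306323393040330361439984512711293778040023359432957480037406148627736583698465935,
   17675496058648187443581900766528993413726999570785091187710370271207088070255628597302722902,
   9696445726342730827271879941930074390309911265350623421829861207623376940588871742054091221,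
   17166108628225602962024059952913419215581924981397665993478660935532379748913140139378233517,
   14434970633521883195971573363181078537335518169393342036782565174150826481793284567959425679,
   17379093654630695238918762017770153783657384919045549893325807045294177421266593961560589639,
   8579533819516213967245148416694073180492148236900449692163699856960573451953591599397159779,
   2127229331424841298356343345875669]

/-- The search excluding the coloring `4010213` of a point and its neighbors. -/
def search4010213 : List ℕ :=
  [13298922228106280111734733167065366330568858392855880224039746539960946589579795057775083850,
   8728521230180371389369337704151082943600514823033351491725089969712800805113259428972226605,
   102666476772189359045680999442436747538421902970049023926591022174126503213200384182151769,
   10602437038812510712356423944480204610996995422806435805816241881575491316495939929994559638,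
   194228410152327592378119945433966459654879491575380184620651041428286303024645571812223569,
   130571035891815595109417015376116461115920041567223573835048029420807675568636328757593129,
   193958538218801570223474637188221338086177494866914022471362298412383899726511260627239114,
   140247752137615258103120030419790669769347931663222530024248440448307125097733012108838053,
   132505870956777292588451434387779467174896764931336399753966809533869404176134356242989274,
   100461282000191190963366253958065504170102797795599723752255944570241734345539907883434190,
   16832115149191330616142887601888916277262516329301027070694550777202361920912741839875564585,
   17335326964116010992791046848607042047630491033975942921478098386459577329320734792254908053,
   13298922228106330599180184001530207598283961020639625787215043859746705081434948361200533658,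
   12751866637700850280751623805394467237892028624637429156350787543518961404225912490228082733,
   13060462348149229103179701581540778733470529488625413119634671059939772120906887669598995051,
   9835725342380203638230271590763997770821697199128791599442659609437527852765296244199129242,
   8728521232414163728095641740557569309518137017773113932076339618626589977994397974510850089,
   17468743223394012107117524784265040962466307179720199040719507482328507709368470050066098385,
   102450608603222927020284281520514033833470593094705870561207635028362974202563841095762318,
   162269199540882604911276569363160347382626915187226613851842209270952520241063560374469763,
   10618351382284064788496786128443278640871958891069725665259433760849473518634284552181580166,
   78725877747712298432353420402507951985009530608953334858963691018902723212321979180084341,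
   17848568216765611504364008074263109279215015460929545377315799899129379844895634945979842906,
   8581443357548138381293823140495810975035914779053599234111461088502864723050417622422454418,
   9962877505181384577628240351896620573227721478612245439512034690386881548281534891380067493,
   74740310141878633090277375589096372972675826050948776828214118540549561483685324219567413,
   9187053225913976113324196406283560544435221085043066429525653386771369027254489703664713946,
   9187053227819451681559534775201212046271363893370043340783372449300098678064437116921267331,
   9700446454818047182758238175277982716974630373864966234495274608806756643122461102240777347,
   13808341685988420624713456599052675982220325035196661396596978993897335149258141184408748238,
   100724538386441960958601078171547637362584174228689643320313974278513319306201095010320774,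
   8722685023462629029050883612627483827828790985685002814463808798853459001789096508307883521,
   194105171623868455984287808900231603777444555680596416879691994980558562040213015940991113,
   9326460896450796533250618173414448630364310400488566102047150544676773258005463996669711207,
   76588916734880235311730175718219477138616059540220926295015136894736741941182428007432342,
   13340857839854704007743687740428786023252160348925973114376891909230040999773210571900801333,
   193958540127051684828784051982798581353083365939576388670158840895374292854073134360380195,
   8728651034568058933666710934317637396533380826723030612337149212126709869170462266079151277,
   140517437482687846565094385229777900850348036862879088164366960839383657539750044157510757,
   13267225164368157029138039228856578759599259887466829895920790358045756878248070699579408602,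
   8547766751422756646248589281540824984606928799342491593105665025263178991826830467389849818,
   12803717149939772513005742988748172214676693131230516341996348696122435654792466037591926797,
   12986858964457389130880831143441035990679013906206927722330833111339881996060661617995153670,
   12751866637700850280751623805394467237892028604745164439261471700190738873927324803055642661,
   16863990461056096481998636168074364222281289924244166230452917815477461436580977222212469355,
   9696441810697554481768175825994377901868976874697685433539579035211349648746310631208386886,
   102658768769899081552641458738778857709307847192456921837326549323427214134276800293847907,
   946443351011645918625969811275744178917494622540864744328796920481015849]

/-- The search excluding the coloring `4012013` of a point and its neighbors. -/
def search4012013 : List ℕ :=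
  [17842738158905799102115992691100734625690421213754062864499629629967630169890901235958677834,
   9696575656413784847951918115233301429106105729095167152526911413488199441697885365807546710,
   170356866137950909472284067102403549130683303935461650555352376927870942748655311409184914,
   8563626697811887848237005696750077293676529125016982974401446545186295134197652013237010714,
   17502429815302457007299107997375635383103101786111215994074841963481933679672948583055322169,
   3108949150855727493469953866904176415405820600069607999863993442917941673224211705]

/-- The search excluding all colorings, starting from nothing. -/
def searchRoot : List ℕ :=
  [13768395396807661698752260650192618894170709327019324987198598073009567186371661524575846674,
   13832262689953904032370875293307086599238466174255672772517128756054384561470359418503851065,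
   212156316463090826884258627873502974815048708837731857062677986834636228845447071034541]

/-- The searches excluding the patterns after the templates. -/
def searches : List (List ℕ) :=
  [search4010101, search4010102, search4010212, search4012012,
   search4010232, search4010203, search4010123, search4010213,
   search4012013, searchRoot]

theorem patterns_images : ∀ x ∈ patterns, ∀ T ∈ images x.2, ∀ C ∈ T, ∀ p ∈ C,
    0 ≤ p.1 ∧ p.1 < 8 ∧ 0 ≤ p.2 := by
  decide +kernel

theorem patterns_inWindow : ∀ j < 10, InWindow (patterns.getD (7 + j) (true, [])).2 := by
  decide +kernel

theorem searches_run : ∀ j < 10, forceTable (table (patterns.take (7 + j))) (fun tab =>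
    run tab (searches.getD j []) [start (patterns.getD (7 + j) (true, [])).2]) = true := by
  decide +kernel

theorem excluded_of_mem_patterns {B : (ℤ × ℤ → Fin 5) → Prop} (hB : BadClass B) :
    ∀ j ≤ 10, ∀ x ∈ patterns.take (7 + j), Excluded B x.1 x.2 := by
  intro j
  induction j with
  | zero =>
    intro _ x hx
    have : patterns.take (7 + 0) = templates.map (Prod.mk false) := rfl
    rw [this] at hx
    obtain ⟨T, hT, rfl⟩ := List.mem_map.1 hx
    exact excluded_of_mem_templates hB hT
  | succ j ih =>
    intro hj
    have ih := ih (by omega)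
    have hlen : 7 + j < patterns.length := by
      have : patterns.length = 17 := rfl
      omega
    have hrun := searches_run j hj
    rw [forceTable_eq] at hrun
    have hdead := run_dead hB (sound_of_mem_table hB ih fun x hx =>
      patterns_images x (List.mem_of_mem_take hx)) hrun _ (List.mem_singleton_self _)
    have hex := hdead.excluded hB (patterns_inWindow j hj)
    have hflag : (patterns.getD (7 + j) (true, [])).1 = true := by
      have : ∀ j < 10, (patterns.getD (7 + j) (true, [])).1 = true := by decide +kernel
      exact this j hj
    intro x hx
    rw [← Nat.add_assoc, List.take_succ_eq_append_getElem hlen, List.mem_append] at hx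
    rcases hx with hx | hx
    · exact ih x hx
    · rw [List.mem_singleton.1 hx, ← List.getD_eq_getElem _ (true, []) hlen, hflag]
      exact hex

theorem BadClass.not_mem {B : (ℤ × ℤ → Fin 5) → Prop} (hB : BadClass B) (f : ℤ × ℤ → Fin 5) :
    ¬ B f := fun hf =>
  excluded_of_mem_patterns hB 10 le_rfl (true, []) (by decide +kernel) f hf [] (by simp) .nil

/-! ### The universal cover of the torus -/

/-- The universal covering of the torus. -/
def cover (a b : ℕ) (p : ℤ × ℤ) : ZMod a × ZMod b := (p.1, p.2)

theorem cover_add (a b : ℕ) (p q : ℤ × ℤ) : cover a b (p + q) = cover a b p + cover a b q := by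
  simp [cover]

theorem cover_sub (a b : ℕ) (p q : ℤ × ℤ) : cover a b (p - q) = cover a b p - cover a b q := by
  simp [cover]

theorem cover_eq_zero {a b : ℕ} {p : ℤ × ℤ} (h : cover a b p = 0) (h₁ : |p.1| < a)
    (h₂ : |p.2| < b) : p = 0 := by
  simp only [cover, Prod.mk_eq_zero, ZMod.intCast_zmod_eq_zero_iff_dvd] at h
  exact Prod.ext (Int.eq_zero_of_abs_lt_dvd h.1 h₁) (Int.eq_zero_of_abs_lt_dvd h.2 h₂)

theorem triGrid_adj_cover {a b : ℕ} (ha : 6 ≤ a) (hb : 6 ≤ b) (p : ℤ × ℤ) (w : ZMod a × ZMod b) :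
    (triGrid a b).Adj (cover a b p) w ↔ ∃ d ∈ dirs, w = cover a b (p + d) := by
  have hmem : ∀ u : ZMod a × ZMod b, u ∈ ({(0, 1), (0, -1), (1, 0), (-1, 0), (1, -1), (-1, 1)} :
      Set (ZMod a × ZMod b)) ↔ ∃ d ∈ dirs, u = cover a b d := by
    intro u
    simp only [dirs, cover, Set.mem_insert_iff, Set.mem_singleton_iff, List.mem_cons,
      List.not_mem_nil, or_false, exists_eq_or_imp, exists_eq_left]
    push_cast
    tauto
  have hneg : ∀ d ∈ dirs, -d ∈ dirs := by decide
  have hdirs : ∀ d ∈ dirs, d ≠ 0 ∧ |d.1| ≤ 1 ∧ |d.2| ≤ 1 := by decide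
  rw [triGrid, SimpleGraph.fromRel_adj, hmem, hmem]
  constructor
  · rintro ⟨-, ⟨d, hd, h⟩ | ⟨d, hd, h⟩⟩
    · refine ⟨-d, hneg d hd, ?_⟩
      rw [← sub_eq_add_neg, cover_sub, ← h, sub_sub_cancel]
    · exact ⟨d, hd, by rw [cover_add, ← h, add_sub_cancel]⟩
  · rintro ⟨d, hd, rfl⟩
    rw [cover_add]
    refine ⟨fun h => ?_, .inr ⟨d, hd, add_sub_cancel_left ..⟩⟩
    obtain ⟨h₀, h₁, h₂⟩ := hdirs d hd
    exact h₀ (cover_eq_zero (left_eq_add.1 h) (by omega) (by omega))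

theorem isChart_cover {a b : ℕ} (ha : 6 ≤ a) (hb : 6 ≤ b) :
    IsChart (triGrid a b) (cover a b) where
  surj u := by
    obtain ⟨x, hx⟩ := ZMod.intCast_surjective u.1
    obtain ⟨y, hy⟩ := ZMod.intCast_surjective u.2
    exact ⟨(x, y), Prod.ext hx hy⟩
  adj := triGrid_adj_cover ha hb
  inj p q hpq h := by
    have hz : cover a b (p - q) = 0 := by rw [cover_sub, h, sub_self]
    have h₁ := abs_le.2 hpq.1
    have h₂ := abs_le.2 hpq.2.1
    exact sub_eq_zero.1 (cover_eq_zero hz (by omega) (by omega))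

theorem isTame_of_proper [Finite V] {G : SimpleGraph V} {P₀ : ℤ × ℤ → V} (h₀ : IsChart G P₀)
    {c : V → Fin 5} (hc : Proper G c) : IsTame G P₀ c := by
  by_contra h
  exact (badClass_isBad h₀).not_mem _ ⟨P₀, .base, c, hc, h, rfl⟩

/-- For all integers `a ≥ 6` and `b ≥ 6`, any two proper 5-colorings of
the triangulated toroidal grid `T[a×b]` are Kempe 5-equivalent. -/
theorem statement_0 (a b : ℕ) (ha : 6 ≤ a) (hb : 6 ≤ b)
    (c₁ c₂ : ZMod a × ZMod b → Fin 5)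
    (h₁ : Proper (triGrid a b) c₁) (h₂ : Proper (triGrid a b) c₂) :
    KempeEquiv (triGrid a b) c₁ c₂ := by
  have : NeZero a := ⟨by omega⟩
  have : NeZero b := ⟨by omega⟩
  have h₀ := isChart_cover ha hb
  exact IsTame.kempeEquiv h₀ h₂ (isTame_of_proper h₀ h₁) (isTame_of_proper h₀ h₂)

end KempePaper
end

section
/- Let G be a finite simple graph, d a nonnegative integer, and k a positive integer with d < k. If G is d-degenerate, then any two proper k-colorings of G are Kempe k-equivalent. -/
namespace KempePaper

variable {V : Type*}

theorem eq_of_reachable_of_forall_not_adj {G : SimpleGraph V} {v x : V}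
    (hv : ∀ y, ¬ G.Adj v y) (h : G.Reachable v x) : x = v := by
  rw [SimpleGraph.reachable_iff_reflTransGen] at h
  rcases h.cases_head with h | ⟨y, hy, -⟩
  · exact h.symm
  · exact (hv y hy).elim

theorem kempeStep_recolor {G : SimpleGraph V} {k : ℕ} {c c' : V → Fin k}
    (hc : Proper G c) (v : V) (hfree : ∀ u, G.Adj v u → c u ≠ c' v)
    (heq : ∀ u, u ≠ v → c' u = c u) : KempeStep G c c' := by
  have hiso : ∀ y, ¬ (kempeGraph G c (c v) (c' v)).Adj v y := by
    intro y hy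
    rw [kempeGraph_adj] at hy
    rcases hy.2.2 with h | h
    · exact hc hy.1 h.symm
    · exact hfree y hy.1 h
  refine ⟨c v, c' v, v, fun x hx => ?_, fun x hx => heq x ?_⟩
  · rw [eq_of_reachable_of_forall_not_adj hiso hx, Equiv.swap_apply_left]
  · rintro rfl
    exact hx (SimpleGraph.Reachable.refl _)

/-- Deleting a vertex with at most one neighbor does not affect reachability between other
vertices. -/
theorem reachable_iff_of_subsingleton_neighbors {K K' : SimpleGraph V} {v : V}
    (hK : ∀ a b, K'.Adj a b ↔ K.Adj a b ∧ a ≠ v ∧ b ≠ v)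
    (hv : ∀ a b, K.Adj v a → K.Adj v b → a = b) {w x : V} (hw : w ≠ v) (hx : x ≠ v) :
    K.Reachable w x ↔ K'.Reachable w x := by
  refine ⟨fun h => ?_, fun h => h.mono fun a b hab => ((hK a b).1 hab).1⟩
  rw [SimpleGraph.reachable_iff_reflTransGen] at h
  have key : (x ≠ v → K'.Reachable w x) ∧ (x = v → ∀ u, K.Adj v u → K'.Reachable w u) := by
    clear hx
    induction h with
    | refl => exact ⟨fun _ => SimpleGraph.Reachable.refl _, fun h => (hw h).elim⟩
    | @tail y z _ hyz ih =>
      refine ⟨fun hz => ?_, fun hz u hu => ?_⟩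
      · by_cases hy : y = v
        · exact ih.2 hy z (hy ▸ hyz)
        · exact (ih.1 hy).trans ((hK y z).2 ⟨hyz, hy, hz⟩).reachable
      · subst hz
        exact hv y u hyz.symm hu ▸ ih.1 hyz.ne
  exact key.1 hx

theorem exists_kempeEquiv_subsingleton_neighbors [Finite V] {H : SimpleGraph V}
    {v : V} {k : ℕ} (hdeg : (H.neighborSet v).ncard < k) {c : V → Fin k} (hc : Proper H c)
    (α β : Fin k) :
    ∃ c₀, KempeEquiv H c c₀ ∧ (∀ u, u ≠ v → c₀ u = c u) ∧
      ∀ a b, (kempeGraph H c₀ α β).Adj v a → (kempeGraph H c₀ α β).Adj v b → a = b := by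
  classical
  by_cases hs : ∀ a b, (kempeGraph H c α β).Adj v a → (kempeGraph H c α β).Adj v b → a = b
  · exact ⟨c, Relation.ReflTransGen.refl, fun _ _ => rfl, hs⟩
  push Not at hs
  obtain ⟨a, b, ha, hb, hab⟩ := hs
  rw [kempeGraph_adj] at ha hb
  have hva := hc ha.1
  have hvb := hc hb.1
  have hcab : c a = c b := by grind
  obtain ⟨γ, hγ⟩ : ∃ γ, γ ∉ insert (c v) (c '' (H.neighborSet v \ {a})) := by
    by_contra! hall
    have huniv : insert (c v) (c '' (H.neighborSet v \ {a})) = Set.univ :=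
      Set.eq_univ_of_forall hall
    have h₁ := Set.ncard_insert_le (c v) (c '' (H.neighborSet v \ {a}))
    have h₂ := Set.ncard_image_le (f := c) (Set.toFinite (H.neighborSet v \ {a}))
    have h₃ := Set.ncard_sdiff_singleton_add_one (s := H.neighborSet v) (a := a) ha.1
      (Set.toFinite _)
    rw [huniv, Set.ncard_univ, Nat.card_eq_fintype_card, Fintype.card_fin] at h₁
    omega
  simp only [Set.mem_insert_iff, Set.mem_image, Set.mem_sdiff, Set.mem_singleton_iff,
    SimpleGraph.mem_neighborSet, not_or, not_exists, not_and] at hγ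
  obtain ⟨hγv, hγ⟩ := hγ
  have hbγ : c b ≠ γ := hγ b ⟨hb.1, hab.symm⟩
  have hnbr : ∀ u, H.Adj v u → c u ≠ γ := by
    intro u hu
    by_cases hua : u = a
    · rw [hua, hcab]
      exact hbγ
    · exact hγ u ⟨hu, hua⟩
  refine ⟨Function.update c v γ, Relation.ReflTransGen.single (kempeStep_recolor hc v ?_ ?_),
    fun u hu => Function.update_of_ne hu _ _, fun x y hx _ => ?_⟩
  · simpa using hnbr
  · exact fun u hu => Function.update_of_ne hu _ _
  · have hx' := (kempeGraph_adj.1 hx).2.1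
    rw [Function.update_self] at hx'
    grind

/-- A Kempe swap in the graph with the edges at `v` deleted lifts to a sequence of Kempe swaps in
the whole graph, provided `v` has fewer than `k` neighbors. -/
theorem KempeStep.lift [Finite V] {H H' : SimpleGraph V} {v : V} {k : ℕ}
    (hH : ∀ a b, H'.Adj a b ↔ H.Adj a b ∧ a ≠ v ∧ b ≠ v)
    (hdeg : (H.neighborSet v).ncard < k) {b b' c : V → Fin k} (hstep : KempeStep H' b b')
    (hc : Proper H c) (hcb : ∀ u, u ≠ v → c u = b u) :
    ∃ c', KempeEquiv H c c' ∧ ∀ u, u ≠ v → c' u = b' u := by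
  classical
  obtain ⟨α, β, w, hin, hout⟩ := hstep
  by_cases hw : w = v
  · subst hw
    refine ⟨c, Relation.ReflTransGen.refl, fun u hu => ?_⟩
    rw [hcb u hu, hout u fun hreach => hu (eq_of_reachable_of_forall_not_adj ?_ hreach)]
    intro y hy
    exact ((hH _ _).1 (kempeGraph_adj.1 hy).1).2.1 rfl
  obtain ⟨c₀, hcc₀, hoff, hsub⟩ := exists_kempeEquiv_subsingleton_neighbors hdeg hc α β
  have hK : ∀ x y, (kempeGraph H' b α β).Adj x y ↔
      (kempeGraph H c₀ α β).Adj x y ∧ x ≠ v ∧ y ≠ v := by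
    intro x y
    rw [kempeGraph_adj, kempeGraph_adj, hH]
    grind
  refine ⟨fun x => if (kempeGraph H c₀ α β).Reachable w x then Equiv.swap α β (c₀ x) else c₀ x,
    hcc₀.tail ⟨α, β, w, fun x hx => if_pos hx, fun x hx => if_neg hx⟩, fun u hu => ?_⟩
  have hiff := reachable_iff_of_subsingleton_neighbors hK hsub hw hu
  dsimp only
  split_ifs with hr
  · rw [hin u (hiff.1 hr), hoff u hu, hcb u hu]
  · rw [hout u (mt hiff.2 hr), hoff u hu, hcb u hu]

theorem KempeEquiv.lift [Finite V] {H H' : SimpleGraph V} {v : V} {k : ℕ}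
    (hH : ∀ a b, H'.Adj a b ↔ H.Adj a b ∧ a ≠ v ∧ b ≠ v)
    (hdeg : (H.neighborSet v).ncard < k) {c b : V → Fin k} (h : KempeEquiv H' c b)
    (hc : Proper H c) : ∃ c', KempeEquiv H c c' ∧ ∀ u, u ≠ v → c' u = b u := by
  induction h with
  | refl => exact ⟨c, Relation.ReflTransGen.refl, fun _ _ => rfl⟩
  | tail _ hstep ih =>
    obtain ⟨c', hcc', heq⟩ := ih
    obtain ⟨c'', hc'', heq'⟩ := hstep.lift hH hdeg (KempeEquiv.proper hcc' hc) heq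
    exact ⟨c'', Relation.ReflTransGen.trans hcc' hc'', heq'⟩

/-- The spanning subgraph of `G` whose edges are those with both ends in `S`. -/
def restrictEdges (G : SimpleGraph V) (S : Set V) : SimpleGraph V where
  Adj a b := G.Adj a b ∧ a ∈ S ∧ b ∈ S
  symm := ⟨fun _ _ h => ⟨h.1.symm, h.2.2, h.2.1⟩⟩
  loopless := ⟨fun _ h => h.1.ne rfl⟩

theorem Degenerate.exists_kempeEquiv_restrictEdges [Finite V] {G : SimpleGraph V}
    {d k : ℕ} (hdk : d < k) (hG : Degenerate G d) (n : ℕ) (S : Set V) (hS : S.ncard = n)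
    {c₁ c₂ : V → Fin k} (h₁ : Proper (restrictEdges G S) c₁)
    (h₂ : Proper (restrictEdges G S) c₂) :
    ∃ c, KempeEquiv (restrictEdges G S) c₁ c ∧ ∀ u ∈ S, c u = c₂ u := by
  classical
  induction n generalizing S with
  | zero =>
    rw [Set.ncard_eq_zero (Set.toFinite S)] at hS
    subst hS
    exact ⟨c₁, Relation.ReflTransGen.refl, fun u hu => hu.elim⟩
  | succ n ih =>
    obtain ⟨v, hv, hdeg⟩ := hG S (Set.toFinite S)
      ((Set.ncard_pos (Set.toFinite S)).1 (hS ▸ n.succ_pos))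
    have hH : ∀ a b, (restrictEdges G (S \ {v})).Adj a b ↔
        (restrictEdges G S).Adj a b ∧ a ≠ v ∧ b ≠ v := by
      intro a b
      simp only [restrictEdges, Set.mem_sdiff, Set.mem_singleton_iff]
      tauto
    have hdeg' : ((restrictEdges G S).neighborSet v).ncard < k :=
      (Set.ncard_le_ncard (t := S ∩ G.neighborSet v) (fun u hu => ⟨hu.2.2, hu.1⟩)
        (Set.toFinite _)).trans_lt (hdeg.trans_lt hdk)
    have hcard : (S \ {v}).ncard = n := by
      have := Set.ncard_sdiff_singleton_add_one hv (Set.toFinite S)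
      omega
    obtain ⟨b, hb, hb₂⟩ := ih (S \ {v}) hcard (fun x y hxy => h₁ ((hH x y).1 hxy).1)
      (fun x y hxy => h₂ ((hH x y).1 hxy).1)
    obtain ⟨c, hc, hcb⟩ := KempeEquiv.lift hH hdeg' hb h₁
    refine ⟨Function.update c v (c₂ v), Relation.ReflTransGen.tail hc
      (kempeStep_recolor (KempeEquiv.proper hc h₁) v ?_ ?_), fun u hu => ?_⟩
    · intro u hu
      rw [Function.update_self, hcb u hu.ne', hb₂ u ⟨hu.2.2, hu.ne'⟩]
      exact (h₂ hu).symm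
    · exact fun u hu => Function.update_of_ne hu _ _
    · by_cases huv : u = v
      · rw [huv, Function.update_self]
      · rw [Function.update_of_ne huv, hcb u huv, hb₂ u ⟨hu, huv⟩]

/-- If `G` is `d`-degenerate and `d < k`, then any two proper
`k`-colorings of `G` are Kempe `k`-equivalent. -/
theorem statement_2 {V : Type*} [Fintype V] (G : SimpleGraph V) (d k : ℕ)
    (hk : 0 < k) (hdk : d < k) (hG : Degenerate G d)
    (c₁ c₂ : V → Fin k) (h₁ : Proper G c₁) (h₂ : Proper G c₂) :
    KempeEquiv G c₁ c₂ := by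
  have huniv : restrictEdges G Set.univ = G := by
    ext a b
    simp [restrictEdges]
  obtain ⟨c, hc, heq⟩ := hG.exists_kempeEquiv_restrictEdges hdk _ Set.univ rfl
    (c₁ := c₁) (c₂ := c₂) (huniv.symm ▸ h₁) (huniv.symm ▸ h₂)
  rw [huniv] at hc
  rwa [← funext fun u => heq u (Set.mem_univ u)]

end KempePaper
end
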